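/- Let G be a plane graph with no cycle of length 4 whose outer face is F, let P ⊆ F be a subpath of the boundary of F containing at most three vertices, and let L be a (*,1)-list assignment on G satisfying: (i) |L(v)| ≥ 3 for every v ∈ V(G)\V(F); (ii) |L(v)| ≥ 2 for every v ∈ V(F)\V(P); (iii) |L(v)| = 1 for every v ∈ V(P); (iv) no two vertices with lists of size two are adjacent in G; (v) the subgraph of G induced by V(P) is L-colorable; (vi) no vertex with a list of size two is adjacent to two vertices of P. Then G is L-colorable. -/

import Mathlib

open Set

namespace ChoosSep

/-- `G` has a cycle of length `n`. -/
def HasCycleLen {V : Type} (G : SimpleGraph V) (n : ℕ) : Prop :=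
  ∃ (v : V) (c : G.Walk v v), c.IsCycle ∧ c.length = n

/-- `G` has a proper coloring choosing each color from the list `L v`. -/
def ColorableWith {V : Type} (G : SimpleGraph V) (L : V → Finset ℕ) : Prop :=
  ∃ φ : V → ℕ, (∀ v, φ v ∈ L v) ∧ ∀ ⦃u v⦄, G.Adj u v → φ u ≠ φ v

/-- `G` is `(k,d)`-choosable: it has an `L`-coloring for every list assignment
giving each vertex at least `k` colors and any two adjacent vertices at most `d`
common colors. -/
def Choosable {V : Type} (G : SimpleGraph V) (k d : ℕ) : Prop :=
  ∀ L : V → Finset ℕ, (∀ v, k ≤ (L v).card) →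
    (∀ ⦃u v⦄, G.Adj u v → ((L u) ∩ (L v)).card ≤ d) →
    ColorableWith G L

/-- The closed straight segment between two points of the plane. -/
def seg (x y : ℝ × ℝ) : Set (ℝ × ℝ) := segment ℝ x y

/-- A straight-line plane embedding of `G`: vertices go to distinct points, edges are
drawn as straight segments, two distinct edges meet only in common endpoints, and no
vertex lies on the drawing of an edge it does not belong to.  By Fáry's theorem a
finite simple graph admits such an embedding iff it is planar. -/
structure PlaneEmb {V : Type} (G : SimpleGraph V) where
  pos : V → ℝ × ℝ
  inj : Function.Injective pos
  edges_meet : ∀ ⦃a b c d : V⦄, G.Adj a b → G.Adj c d → s(a, b) ≠ s(c, d) →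
    seg (pos a) (pos b) ∩ seg (pos c) (pos d) ⊆ ({pos a, pos b} ∩ {pos c, pos d} : Set (ℝ × ℝ))
  vertex_off : ∀ ⦃a b v : V⦄, G.Adj a b → v ≠ a → v ≠ b → pos v ∉ seg (pos a) (pos b)

/-- `G` is planar: it admits a plane embedding. -/
def IsPlanar {V : Type} (G : SimpleGraph V) : Prop := Nonempty (PlaneEmb G)

variable {V : Type} {G : SimpleGraph V}

/-- The drawing of the graph in the plane: all vertex points and all edge segments. -/
def PlaneEmb.drawing (E : PlaneEmb G) : Set (ℝ × ℝ) :=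
  Set.range E.pos ∪ ⋃ (a : V) (b : V) (_ : G.Adj a b), seg (E.pos a) (E.pos b)

/-- A face of the embedding: a connected component of the complement of the drawing. -/
def PlaneEmb.IsFace (E : PlaneEmb G) (C : Set (ℝ × ℝ)) : Prop :=
  ∃ q, q ∉ E.drawing ∧ C = connectedComponentIn E.drawingᶜ q

/-- The outer face: the unbounded face. -/
def PlaneEmb.IsOuterFace (E : PlaneEmb G) (C : Set (ℝ × ℝ)) : Prop :=
  E.IsFace C ∧ ¬ Bornology.IsBounded C

/-- The vertices lying on the boundary of the face `C`. -/
def PlaneEmb.onFace (E : PlaneEmb G) (C : Set (ℝ × ℝ)) : Set V :=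
  {v | E.pos v ∈ closure C}

/-- An edge of `G` lying on the boundary of the face `C`. -/
def PlaneEmb.BoundaryEdge (E : PlaneEmb G) (C : Set (ℝ × ℝ)) (u v : V) : Prop :=
  G.Adj u v ∧ seg (E.pos u) (E.pos v) ⊆ closure C

/-- `C` is a 3-face with (mutually adjacent) incident vertices `x`, `y`, `z`. -/
def PlaneEmb.IsTriFace (E : PlaneEmb G) (C : Set (ℝ × ℝ)) (x y z : V) : Prop :=
  E.IsFace C ∧ G.Adj x y ∧ G.Adj y z ∧ G.Adj x z ∧
    frontier C = seg (E.pos x) (E.pos y) ∪ seg (E.pos y) (E.pos z) ∪ seg (E.pos x) (E.pos z)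

/-- `C` is a 4-face with incident 4-cycle `w x y z`. -/
def PlaneEmb.IsQuadFace (E : PlaneEmb G) (C : Set (ℝ × ℝ)) (w x y z : V) : Prop :=
  E.IsFace C ∧ G.Adj w x ∧ G.Adj x y ∧ G.Adj y z ∧ G.Adj z w ∧ w ≠ y ∧ x ≠ z ∧
    frontier C = seg (E.pos w) (E.pos x) ∪ seg (E.pos x) (E.pos y) ∪
      seg (E.pos y) (E.pos z) ∪ seg (E.pos z) (E.pos w)

/-- `x z1 y z2` is a diamond: a 4-cycle formed by two adjacent 3-faces
`x y z1` and `x y z2` sharing the edge `x y`. -/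
def PlaneEmb.IsDiamond (E : PlaneEmb G) (x z1 y z2 : V) : Prop :=
  z1 ≠ z2 ∧ ∃ C1 C2 : Set (ℝ × ℝ), C1 ≠ C2 ∧ E.IsTriFace C1 x y z1 ∧ E.IsTriFace C2 x y z2

/-- The union of the three sides of the triangle `a b c`. -/
def triBoundary (a b c : ℝ × ℝ) : Set (ℝ × ℝ) := seg a b ∪ seg b c ∪ seg a c

/-- The open interior region of the triangle `a b c`: points off the triangle whose
connected component in the complement of the triangle is bounded. -/
def triInterior (a b c : ℝ × ℝ) : Set (ℝ × ℝ) :=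
  {p | p ∉ triBoundary a b c ∧
    Bornology.IsBounded (connectedComponentIn (triBoundary a b c)ᶜ p)}

/-- The degree of a vertex. -/
noncomputable def deg (G : SimpleGraph V) (v : V) : ℕ := Nat.card {u : V // G.Adj v u}

/-- `G` is 2-connected: connected and with no cutvertex. -/
def TwoConnected (G : SimpleGraph V) : Prop :=
  G.Connected ∧ ∀ v : V, (G.induce {u : V | u ≠ v}).Connected

/-- The edges joining consecutive entries of a list. -/
def edgesL : List V → List (Sym2 V)
  | [] => []
  | [_] => []
  | x :: y :: t => s(x, y) :: edgesL (y :: t)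

@[simp] theorem edgesL_nil : edgesL ([] : List V) = [] := rfl
@[simp] theorem edgesL_singleton (x : V) : edgesL [x] = [] := rfl
@[simp] theorem edgesL_cons_cons (x y : V) (t : List V) :
    edgesL (x :: y :: t) = s(x, y) :: edgesL (y :: t) := rfl

theorem edgesL_append (l₁ : List V) (x : V) (l₂ : List V) :
    edgesL (l₁ ++ x :: l₂) = edgesL (l₁ ++ [x]) ++ edgesL (x :: l₂) := by
  induction l₁ with
  | nil => simp
  | cons a l ih =>
    cases l with
    | nil => simp
    | cons b l => simpa using ih

theorem edgesL_reverse (l : List V) : edgesL l.reverse = (edgesL l).reverse := by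
  induction l with
  | nil => simp
  | cons a l ih =>
    cases l with
    | nil => simp
    | cons b l =>
      rw [List.reverse_cons, List.reverse_cons, List.append_assoc, List.singleton_append,
        edgesL_append, ← List.reverse_cons, ih]
      simp [Sym2.eq_swap]

theorem mem_of_mem_edgesL {l : List V} {a b : V} (h : s(a, b) ∈ edgesL l) : a ∈ l ∧ b ∈ l := by
  induction l with
  | nil => simp at h
  | cons x l ih =>
    cases l with
    | nil => simp at h
    | cons y l =>
      rw [edgesL_cons_cons, List.mem_cons] at h
      rcases h with h | h
      · rcases Sym2.eq_iff.1 h with ⟨rfl, rfl⟩ | ⟨rfl, rfl⟩ <;> simp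
      · have := ih h
        exact ⟨List.mem_cons_of_mem _ this.1, List.mem_cons_of_mem _ this.2⟩

theorem isChain_iff_edgesL {H : SimpleGraph V} {l : List V} :
    l.IsChain H.Adj ↔ ∀ d ∈ edgesL l, d ∈ H.edgeSet := by
  induction l with
  | nil => simp
  | cons x l ih =>
    cases l with
    | nil => simp
    | cons y l => simp [List.isChain_cons_cons, ih]

/-- The sum of `w d e` over the edges `d` joining consecutive entries of `l`. -/
def psum (w : Sym2 V → Sym2 V → ZMod 2) (l : List V) (e : Sym2 V) : ZMod 2 :=
  ((edgesL l).map (w · e)).sum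

theorem psum_append (w : Sym2 V → Sym2 V → ZMod 2) (l₁ : List V) (x : V) (l₂ : List V)
    (e : Sym2 V) : psum w (l₁ ++ x :: l₂) e = psum w (l₁ ++ [x]) e + psum w (x :: l₂) e := by
  simp only [psum]
  rw [edgesL_append, List.map_append, List.sum_append]

/-- Parities of closed walks around edges of `G`, with the properties that hold for the
number of edges of a plane closed walk that lie above a point of an edge. -/
structure ParSys (G : SimpleGraph V) where
  w : Sym2 V → Sym2 V → ZMod 2
  prop : ∀ (x : V) (t : List V) (v a b : V), (x :: t ++ [x]).IsChain G.Adj → v ∉ x :: t →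
    G.Adj v a → G.Adj v b → psum w (x :: t ++ [x]) s(v, a) = psum w (x :: t ++ [x]) s(v, b)
  theta : ∀ (b b' : V) (a₁ a₂ a₃ : List V), b ≠ b' →
    (b :: (a₁ ++ [b'])).IsChain G.Adj → (b :: (a₂ ++ [b'])).IsChain G.Adj →
    (b :: (a₃ ++ [b'])).IsChain G.Adj → b ∉ a₁ → b ∉ a₂ → b ∉ a₃ →
    a₁.headD b' ≠ a₂.headD b' → a₁.headD b' ≠ a₃.headD b' → a₂.headD b' ≠ a₃.headD b' →
    (psum w (b :: (a₂ ++ [b'])) s(b, a₁.headD b') + psum w (b :: (a₃ ++ [b'])) s(b, a₁.headD b')) +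
    (psum w (b :: (a₁ ++ [b'])) s(b, a₂.headD b') + psum w (b :: (a₃ ++ [b'])) s(b, a₂.headD b')) +
    (psum w (b :: (a₁ ++ [b'])) s(b, a₃.headD b') + psum w (b :: (a₂ ++ [b'])) s(b, a₃.headD b'))
      = 1
  outer : ∀ T : Set (Sym2 V), T ⊆ G.edgeSet → T.Nonempty → ∃ e ∈ T, ∀ (x : V) (t : List V),
    (x :: t ++ [x]).IsChain G.Adj → (∀ d ∈ edgesL (x :: t ++ [x]), d ∈ T ∧ d ≠ e) →
    psum w (x :: t ++ [x]) e = 0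

/-- The list `l` runs through the vertices of a cycle of `H`. -/
def IsCyc (H : SimpleGraph V) : List V → Prop
  | [] => False
  | x :: t => (x :: t).Nodup ∧ 2 ≤ t.length ∧ (x :: t ++ [x]).IsChain H.Adj

/-- Closed version of `psum`. -/
def csum (w : Sym2 V → Sym2 V → ZMod 2) : List V → Sym2 V → ZMod 2
  | [], _ => 0
  | x :: t, e => psum w (x :: t ++ [x]) e

/-- No edge at `v` lies inside a cycle of `H` that avoids `v`. -/
def Outer (S : ParSys G) (H : SimpleGraph V) (v : V) : Prop :=
  ∀ l, IsCyc H l → v ∉ l → ∀ u, H.Adj v u → csum S.w l s(v, u) = 0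

section Geometry

/-- Twice the signed area of the triangle `a b q`. -/
noncomputable def cr (a b q : ℝ × ℝ) : ℝ := (b.1 - a.1) * (q.2 - a.2) - (b.2 - a.2) * (q.1 - a.1)

open Classical in
/-- Indicator of the segment `a b` lying above the point `q`. -/
noncomputable def abv (a b q : ℝ × ℝ) : ZMod 2 :=
  if (a.1 ≤ q.1 ∧ q.1 < b.1 ∧ cr a b q < 0) ∨ (b.1 ≤ q.1 ∧ q.1 < a.1 ∧ cr b a q < 0) then 1 else 0

theorem abv_comm (a b q : ℝ × ℝ) : abv a b q = abv b a q := by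
  unfold abv; congr 1; simp only [eq_iff_iff]; tauto

theorem abv_of_lt {a b q : ℝ × ℝ} (h : a.1 < b.1) : 
    abv a b q = open Classical in if a.1 ≤ q.1 ∧ q.1 < b.1 ∧ cr a b q < 0 then 1 else 0 := by
  unfold abv; congr 1; simp only [eq_iff_iff]
  constructor
  · rintro (h1 | h1)
    · exact h1
    · linarith [h1.1, h1.2.1]
  · exact Or.inl

theorem abv_eq_zero_of_lt {a b q : ℝ × ℝ} (h1 : q.1 < a.1) (h2 : q.1 < b.1) : abv a b q = 0 := by
  unfold abv; rw [if_neg]; rintro (h | h) <;> linarith [h.1]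

theorem abv_eq_zero_of_ge {a b q : ℝ × ℝ} (h1 : a.1 ≤ q.1) (h2 : b.1 ≤ q.1) : abv a b q = 0 := by
  unfold abv; rw [if_neg]; rintro (h | h) <;> linarith [h.2.1]

/-- Height of the line `a b` over the abscissa `x`. -/
noncomputable def lin (a b : ℝ × ℝ) (x : ℝ) : ℝ := a.2 + (b.2 - a.2) / (b.1 - a.1) * (x - a.1)

theorem lin_mem {a b : ℝ × ℝ} (h : a.1 < b.1) {x : ℝ} (h1 : a.1 ≤ x) (h2 : x ≤ b.1) :
    (x, lin a b x) ∈ seg a b := by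
  have h0 : 0 < b.1 - a.1 := by linarith
  rw [seg, segment_eq_image']
  refine ⟨(x - a.1) / (b.1 - a.1), ⟨by apply div_nonneg <;> linarith, ?_⟩, ?_⟩
  · rw [div_le_one h0]; linarith
  · ext
    · simp; field_simp; ring
    · simp [lin]; field_simp

theorem cr_eq_lin {a b : ℝ × ℝ} (h : a.1 < b.1) (q : ℝ × ℝ) :
    cr a b q = (b.1 - a.1) * (q.2 - lin a b q.1) := by
  have h0 : b.1 - a.1 ≠ 0 := by linarith
  unfold cr lin; field_simp; ring

theorem cr_neg_iff {a b : ℝ × ℝ} (h : a.1 < b.1) (q : ℝ × ℝ) : cr a b q < 0 ↔ q.2 < lin a b q.1 := by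
  rw [cr_eq_lin h, mul_neg_iff]
  constructor
  · rintro (h1 | h1) <;> linarith [h1.1, h1.2]
  · intro h1; left; constructor <;> linarith

theorem lin_left {a b : ℝ × ℝ} : lin a b a.1 = a.2 := by simp [lin]
theorem lin_right {a b : ℝ × ℝ} (h : a.1 < b.1) : lin a b b.1 = b.2 := by
  have h0 : b.1 - a.1 ≠ 0 := by linarith
  unfold lin; field_simp; ring

theorem lin_lt_aux {a b c d : ℝ × ℝ} (hab : a.1 < b.1) (hcd : c.1 < d.1)
    (hdisj : Disjoint (seg a b) (seg c d)) {x y : ℝ} (hx : a.1 ≤ x ∧ x ≤ b.1 ∧ c.1 ≤ x ∧ x ≤ d.1)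
    (hy : a.1 ≤ y ∧ y ≤ b.1 ∧ c.1 ≤ y ∧ y ≤ d.1) (h : lin c d x < lin a b x) :
    lin c d y < lin a b y := by
  by_contra hcon
  push Not at hcon
  have hcont : ContinuousOn (fun t => lin a b t - lin c d t) (uIcc y x) := by
    unfold lin; fun_prop
  have hm : (0 : ℝ) ∈ uIcc ((fun t => lin a b t - lin c d t) y) ((fun t => lin a b t - lin c d t) x) := by
    rw [mem_uIcc]; left; constructor <;> simp <;> linarith
  obtain ⟨z, hz, hz0⟩ := intermediate_value_uIcc hcont hm
  have hz1 : a.1 ≤ z ∧ z ≤ b.1 ∧ c.1 ≤ z ∧ z ≤ d.1 := by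
    rw [mem_uIcc] at hz
    rcases hz with hz | hz <;> refine ⟨?_, ?_, ?_, ?_⟩ <;> linarith [hz.1, hz.2]
  have e : lin a b z = lin c d z := by simpa [sub_eq_zero] using hz0
  refine Set.disjoint_left.1 hdisj (lin_mem hab hz1.1 hz1.2.1) ?_
  rw [e]
  exact lin_mem hcd hz1.2.2.1 hz1.2.2.2

theorem lin_lt_iff {a b c d : ℝ × ℝ} (hab : a.1 < b.1) (hcd : c.1 < d.1)
    (hdisj : Disjoint (seg a b) (seg c d)) {x y : ℝ} (hx : a.1 ≤ x ∧ x ≤ b.1 ∧ c.1 ≤ x ∧ x ≤ d.1)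
    (hy : a.1 ≤ y ∧ y ≤ b.1 ∧ c.1 ≤ y ∧ y ≤ d.1) :
    lin c d x < lin a b x ↔ lin c d y < lin a b y :=
  ⟨lin_lt_aux hab hcd hdisj hx hy, lin_lt_aux hab hcd hdisj hy hx⟩

theorem seg_comm (a b : ℝ × ℝ) : seg a b = seg b a := segment_symm ℝ a b

open Classical in
/-- Indicator of `c` lying above the segment from `q` to `q'`. -/
noncomputable def chi (q q' c : ℝ × ℝ) : ZMod 2 :=
  if q.1 < c.1 ∧ c.1 ≤ q'.1 ∧ lin q q' c.1 < c.2 then 1 else 0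

theorem abv_add_abv_aux {a b q q' : ℝ × ℝ} (hab : a.1 < b.1) (hq : q.1 < q'.1)
    (hdisj : Disjoint (seg a b) (seg q q')) :
    abv a b q + abv a b q' = chi q q' a + chi q q' b := by
  rw [abv_of_lt hab, abv_of_lt hab]
  unfold chi
  simp only [cr_neg_iff hab]
  have key := fun x y hx hy => lin_lt_iff hab hq hdisj (x := x) (y := y) hx hy
  have e1 : lin q q' q.1 = q.2 := lin_left
  have e2 : lin q q' q'.1 = q'.2 := lin_right hq
  have e3 : lin a b a.1 = a.2 := lin_left
  have e4 : lin a b b.1 = b.2 := lin_right hab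
  rcases le_or_gt b.1 q.1 with h | h
  · rw [if_neg, if_neg, if_neg, if_neg] <;> rintro ⟨h1, h2, h3⟩ <;> linarith
  rcases lt_or_ge q'.1 a.1 with h' | h'
  · rw [if_neg, if_neg, if_neg, if_neg] <;> rintro ⟨h1, h2, h3⟩ <;> linarith
  rcases le_or_gt a.1 q.1 with h1 | h1 <;> rcases le_or_gt b.1 q'.1 with h2 | h2
  · have := key q.1 b.1 (by refine ⟨?_, ?_, ?_, ?_⟩ <;> linarith) (by refine ⟨?_, ?_, ?_, ?_⟩ <;> linarith)
    rw [e1, e4] at this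
    rw [if_neg (c := a.1 ≤ q'.1 ∧ _) (by rintro ⟨h1, h2, h3⟩; linarith),
      if_neg (c := q.1 < a.1 ∧ _) (by rintro ⟨h1, h2, h3⟩; linarith)]
    simp [h, h1, h2, this]
  · have := key q.1 q'.1 (by refine ⟨?_, ?_, ?_, ?_⟩ <;> linarith) (by refine ⟨?_, ?_, ?_, ?_⟩ <;> linarith)
    rw [e1, e2] at this
    rw [if_neg (c := q.1 < a.1 ∧ _) (by rintro ⟨h1, h2, h3⟩; linarith),
      if_neg (c := q.1 < b.1 ∧ _) (by rintro ⟨h1, h2, h3⟩; linarith)]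
    simp [h, h', h1, h2, this]
    split_ifs <;> decide
  · have := key a.1 b.1 (by refine ⟨?_, ?_, ?_, ?_⟩ <;> linarith) (by refine ⟨?_, ?_, ?_, ?_⟩ <;> linarith)
    rw [e3, e4] at this
    rw [if_neg (c := a.1 ≤ q.1 ∧ _) (by rintro ⟨h1, h2, h3⟩; linarith),
      if_neg (c := a.1 ≤ q'.1 ∧ _) (by rintro ⟨h1, h2, h3⟩; linarith)]
    simp [h, h', h1, h2, this]
    split_ifs <;> decide
  · have := key a.1 q'.1 (by refine ⟨?_, ?_, ?_, ?_⟩ <;> linarith) (by refine ⟨?_, ?_, ?_, ?_⟩ <;> linarith)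
    rw [e3, e2] at this
    rw [if_neg (c := a.1 ≤ q.1 ∧ _) (by rintro ⟨h1, h2, h3⟩; linarith),
      if_neg (c := q.1 < b.1 ∧ _) (by rintro ⟨h1, h2, h3⟩; linarith)]
    simp [h', h1, h2, this]

theorem abv_add_abv {a b q q' : ℝ × ℝ} (hab : a.1 ≠ b.1) (hq : q.1 < q'.1)
    (hdisj : Disjoint (seg a b) (seg q q')) :
    abv a b q + abv a b q' = chi q q' a + chi q q' b := by
  rcases lt_or_gt_of_ne hab with h | h
  · exact abv_add_abv_aux h hq hdisj
  · rw [abv_comm, abv_comm a b q', add_comm (chi _ _ _)]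
    exact abv_add_abv_aux h hq (by rwa [seg_comm])

theorem vert_mem_seg {q q' : ℝ × ℝ} (h : q.1 = q'.1) {y : ℝ} (h1 : q.2 ≤ y) (h2 : y ≤ q'.2) :
    (q.1, y) ∈ seg q q' := by
  have : (y : ℝ) ∈ segment ℝ q.2 q'.2 := by
    rw [segment_eq_Icc (h1.trans h2)]; exact ⟨h1, h2⟩
  have := Prod.image_mk_segment_right (𝕜 := ℝ) q.1 q.2 q'.2
  have h3 : ((q.1, y) : ℝ × ℝ) ∈ segment ℝ (q.1, q.2) (q.1, q'.2) := by
    rw [← this]; exact ⟨y, ‹_›, rfl⟩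
  have e : q' = (q.1, q'.2) := Prod.ext h.symm rfl
  rw [seg, e]
  exact h3

theorem abv_vert_aux {a b q q' : ℝ × ℝ} (hab : a.1 < b.1) (hq : q.1 = q'.1)
    (hdisj : Disjoint (seg a b) (seg q q')) (h : a.1 ≤ q.1) (h' : q.1 < b.1)
    (h1 : q.2 < lin a b q.1) : q'.2 < lin a b q'.1 := by
  by_contra hcon
  push Not at hcon
  refine Set.disjoint_left.1 hdisj (lin_mem hab h h'.le) (vert_mem_seg hq h1.le ?_)
  rw [hq]; exact hcon

theorem abv_vert {a b q q' : ℝ × ℝ} (hab : a.1 ≠ b.1) (hq : q.1 = q'.1)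
    (hdisj : Disjoint (seg a b) (seg q q')) : abv a b q = abv a b q' := by
  wlog h : a.1 < b.1 generalizing a b
  · rw [abv_comm, abv_comm a b]
    exact this hab.symm (by rwa [seg_comm]) (lt_of_le_of_ne (not_lt.1 h) hab.symm)
  rw [abv_of_lt h, abv_of_lt h]
  simp only [cr_neg_iff h]
  congr 1
  simp only [eq_iff_iff]
  constructor
  · rintro ⟨h1, h2, h3⟩
    exact ⟨hq ▸ h1, hq ▸ h2, abv_vert_aux h hq hdisj h1 h2 h3⟩
  · rintro ⟨h1, h2, h3⟩
    exact ⟨hq ▸ h1, hq ▸ h2, abv_vert_aux h hq.symm (by rwa [seg_comm q']) h1 h2 h3⟩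

/-- `abv` for an edge given as an unordered pair. -/
noncomputable def abvE (E : PlaneEmb G) (d : Sym2 V) (q : ℝ × ℝ) : ZMod 2 :=
  Sym2.lift ⟨fun a b => abv (E.pos a) (E.pos b) q, fun _ _ => abv_comm _ _ _⟩ d

/-- Midpoint of the drawing of an edge. -/
noncomputable def midE (E : PlaneEmb G) (e : Sym2 V) : ℝ × ℝ :=
  Sym2.lift ⟨fun a b => midpoint ℝ (E.pos a) (E.pos b), fun _ _ => midpoint_comm _ _⟩ e

/-- Number of edges of the walk `l` above the point `q`. -/
noncomputable def par (E : PlaneEmb G) (l : List V) (q : ℝ × ℝ) : ZMod 2 :=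
  ((edgesL l).map (abvE E · q)).sum

@[simp] theorem abvE_mk (E : PlaneEmb G) (a b : V) (q : ℝ × ℝ) :
    abvE E s(a, b) q = abv (E.pos a) (E.pos b) q := rfl

@[simp] theorem midE_mk (E : PlaneEmb G) (a b : V) :
    midE E s(a, b) = midpoint ℝ (E.pos a) (E.pos b) := rfl

theorem psum_eq_par (E : PlaneEmb G) (l : List V) (e : Sym2 V) :
    psum (fun d e => abvE E d (midE E e)) l e = par E l (midE E e) := rfl

theorem par_cons_cons (E : PlaneEmb G) (x y : V) (t : List V) (q : ℝ × ℝ) :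
    par E (x :: y :: t) q = abv (E.pos x) (E.pos y) q + par E (y :: t) q := by simp [par]

/-- The closed segment drawing an edge. -/
def segE (E : PlaneEmb G) (d : Sym2 V) : Set (ℝ × ℝ) :=
  Sym2.lift ⟨fun a b => seg (E.pos a) (E.pos b), fun _ _ => seg_comm _ _⟩ d

@[simp] theorem segE_mk (E : PlaneEmb G) (a b : V) :
    segE E s(a, b) = seg (E.pos a) (E.pos b) := rfl

theorem telescope (g : Sym2 V → ZMod 2) (χ : V → ZMod 2)
    (x : V) (t : List V) (y : V)
    (h : ∀ a b, s(a, b) ∈ edgesL (x :: t ++ [y]) → g s(a, b) = χ a + χ b) :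
    ((edgesL (x :: t ++ [y])).map g).sum = χ x + χ y := by
  induction t generalizing x with
  | nil => simpa using h x y (by simp)
  | cons z t ih =>
    simp only [List.cons_append, edgesL_cons_cons, List.map_cons, List.sum_cons]
    rw [h x z (by simp)]
    have := ih z (fun a b hab => h a b (by
      simp only [List.cons_append, edgesL_cons_cons, List.mem_cons] at hab ⊢; exact Or.inr hab))
    simp only [List.cons_append] at this
    rw [this]
    generalize χ x = a; generalize χ y = b; generalize χ z = c
    revert a b c; decide

def XInj (E : PlaneEmb G) : Prop := Function.Injective fun v => (E.pos v).1

theorem zmod2_eq_of_add {a b : ZMod 2} : a + b = 0 → a = b := by revert a b; decide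

theorem par_eq_of_disjoint {E : PlaneEmb G} (hE : XInj E) {x : V} {t : List V} {q q' : ℝ × ℝ}
    (hch : (x :: t ++ [x]).IsChain G.Adj)
    (h : ∀ d ∈ edgesL (x :: t ++ [x]), Disjoint (segE E d) (seg q q')) :
    par E (x :: t ++ [x]) q = par E (x :: t ++ [x]) q' := by
  wlog hq : q.1 ≤ q'.1 generalizing q q'
  · exact (this (fun d hd => by rw [seg_comm]; exact h d hd) (not_le.1 hq).le).symm
  have hne : ∀ a b, s(a, b) ∈ edgesL (x :: t ++ [x]) → (E.pos a).1 ≠ (E.pos b).1 := by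
    intro a b hab h0
    have : G.Adj a b := isChain_iff_edgesL.1 hch _ hab
    exact this.ne (hE h0)
  rcases hq.lt_or_eq with hq | hq
  · apply zmod2_eq_of_add
    unfold par
    rw [← List.sum_map_add, telescope _ (fun v => chi q q' (E.pos v))]
    · exact CharTwo.add_self_eq_zero _
    · intro a b hab
      exact abv_add_abv (hne a b hab) hq (h _ hab)
  · unfold par
    congr 1
    apply List.map_congr_left
    intro d
    induction d with | _ a b
    intro hd
    exact abv_vert (hne a b hd) hq (h _ hd)

theorem openSegment_disjoint (E : PlaneEmb G) {a b : V} (hab : G.Adj a b) {d : Sym2 V}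
    (hd : d ∈ G.edgeSet) (hne : d ≠ s(a, b)) :
    Disjoint (segE E d) (openSegment ℝ (E.pos a) (E.pos b)) := by
  induction d with | _ c e
  rw [Set.disjoint_left]
  intro z hz hz'
  have h1 := E.edges_meet hd hab hne ⟨hz, openSegment_subset_segment _ _ _ hz'⟩
  have hne : E.pos a ≠ E.pos b := fun h => hab.ne (E.inj h)
  rcases h1.2 with h2 | h2
  · rw [h2] at hz'; exact hne (left_mem_openSegment_iff.1 hz')
  · rw [Set.mem_singleton_iff.1 h2] at hz'; exact hne (right_mem_openSegment_iff.1 hz')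

theorem mid_mem_openSegment (a b : ℝ × ℝ) : midpoint ℝ a b ∈ openSegment ℝ a b := by
  refine ⟨1/2, 1/2, by norm_num, by norm_num, by norm_num, ?_⟩
  rw [midpoint_eq_smul_add, smul_add]; norm_num

theorem par_openSegment {E : PlaneEmb G} (hE : XInj E) {x : V} {t : List V}
    (hch : (x :: t ++ [x]).IsChain G.Adj) {a b : V} (hab : G.Adj a b)
    (hn : s(a, b) ∉ edgesL (x :: t ++ [x])) {q : ℝ × ℝ}
    (hq : q ∈ openSegment ℝ (E.pos a) (E.pos b)) :
    par E (x :: t ++ [x]) (midE E s(a, b)) = par E (x :: t ++ [x]) q := by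
  apply par_eq_of_disjoint hE hch
  intro d hd
  refine (openSegment_disjoint E hab (isChain_iff_edgesL.1 hch d hd) ?_).mono_right
    ((convex_openSegment _ _).segment_subset (mid_mem_openSegment _ _) hq)
  rintro rfl; exact hn hd

theorem par_vertex {E : PlaneEmb G} (hE : XInj E) {x : V} {t : List V}
    (hch : (x :: t ++ [x]).IsChain G.Adj) {v b : V} (hab : G.Adj v b)
    (hv : v ∉ x :: t) :
    par E (x :: t ++ [x]) (midE E s(v, b)) = par E (x :: t ++ [x]) (E.pos v) := by
  have hv' : v ∉ x :: t ++ [x] := by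
    simp only [List.cons_append, List.mem_cons, List.mem_append, not_or] at hv ⊢; simp_all
  apply par_eq_of_disjoint hE hch
  intro d
  induction d with | _ c e
  intro hd
  rw [Set.disjoint_left]
  intro z hz hz'
  have hm := mem_of_mem_edgesL hd
  have hsub : seg (midE E s(v, b)) (E.pos v) ⊆ seg (E.pos v) (E.pos b) :=
    (convex_segment _ _).segment_subset (openSegment_subset_segment _ _ _
      (mid_mem_openSegment _ _)) (left_mem_segment ℝ _ _)
  have h1 := E.edges_meet (isChain_iff_edgesL.1 hch _ hd) hab (by
    intro h
    rw [h] at hd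
    exact hv' (mem_of_mem_edgesL hd).1) ⟨hz, hsub hz'⟩
  have h2 : z = E.pos b := by
    rcases h1.2 with h2 | h2
    · rcases h1.1 with h3 | h3
      · exact absurd (E.inj (h2.symm.trans h3)) (fun h => hv' (h ▸ hm.1))
      · exact absurd (E.inj (h2.symm.trans h3)) (fun h => hv' (h ▸ hm.2))
    · exact h2
  rw [h2] at hz'
  have hx : (E.pos b).1 ∈ segment ℝ (midE E s(v, b)).1 (E.pos v).1 := by
    have := Prod.segment_subset (𝕜 := ℝ) (midE E s(v, b)) (E.pos v) hz'
    exact this.1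
  have hxne : (E.pos v).1 ≠ (E.pos b).1 := fun h => hab.ne (hE h)
  have hmid : (midE E s(v, b)).1 = ((E.pos v).1 + (E.pos b).1) / 2 := by
    simp [midpoint_eq_smul_add]; ring
  rw [hmid, segment_eq_uIcc, mem_uIcc] at hx
  apply hxne
  rcases hx with hx | hx <;> linarith [hx.1, hx.2]

theorem par_append (E : PlaneEmb G) (l₁ : List V) (x : V) (l₂ : List V) (q : ℝ × ℝ) :
    par E (l₁ ++ x :: l₂) q = par E (l₁ ++ [x]) q + par E (x :: l₂) q := by
  unfold par; rw [edgesL_append, List.map_append, List.sum_append]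

theorem par_reverse (E : PlaneEmb G) (l : List V) (q : ℝ × ℝ) :
    par E l.reverse q = par E l q := by
  simp [par, edgesL_reverse, List.sum_reverse]

/-- Slope of the line through two points. -/
noncomputable def slopeP (p q : ℝ × ℝ) : ℝ := (q.2 - p.2) / (q.1 - p.1)

/-- The point of the line `p q` at horizontal distance `δ` from `p`, on the side of `q`. -/
noncomputable def nearP (δ : ℝ) (p q : ℝ × ℝ) : ℝ × ℝ :=
  if p.1 < q.1 then (p.1 + δ, p.2 + δ * slopeP p q) else (p.1 - δ, p.2 - δ * slopeP p q)

theorem nearP_of_lt {δ : ℝ} {p q : ℝ × ℝ} (h : p.1 < q.1) :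
    nearP δ p q = (p.1 + δ, p.2 + δ * slopeP p q) := if_pos h

theorem nearP_of_gt {δ : ℝ} {p q : ℝ × ℝ} (h : q.1 < p.1) :
    nearP δ p q = (p.1 - δ, p.2 - δ * slopeP p q) := if_neg h.not_gt

theorem nearP_mem {δ : ℝ} {p q : ℝ × ℝ} (h0 : 0 < δ) (h : δ < |q.1 - p.1|) :
    nearP δ p q ∈ openSegment ℝ p q := by
  rw [openSegment_eq_image']
  have hne : q.1 - p.1 ≠ 0 := by
    intro h1; rw [h1, abs_zero] at h; linarith
  refine ⟨δ / |q.1 - p.1|, ⟨by positivity, (div_lt_one (h0.trans h)).2 h⟩, ?_⟩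
  rcases lt_or_gt_of_ne hne with h1 | h1
  · rw [nearP_of_gt (by linarith), abs_of_neg h1]
    unfold slopeP
    have : -(q.1 - p.1) ≠ 0 := by linarith
    have h3 : p.1 - q.1 ≠ 0 := by linarith
    ext <;> simp <;> field_simp <;> ring
  · rw [nearP_of_lt (by linarith), abs_of_pos h1]
    unfold slopeP
    ext <;> simp <;> field_simp

theorem nearP_fst {δ : ℝ} (p q : ℝ × ℝ) :
    (nearP δ p q).1 = p.1 + δ ∨ (nearP δ p q).1 = p.1 - δ := by
  unfold nearP; split_ifs <;> simp

theorem exists_gap [Finite V] (E : PlaneEmb G) (hE : XInj E) (b : V) :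
    ∃ δ > 0, ∀ c ≠ b, δ < |(E.pos c).1 - (E.pos b).1| := by
  have h : ∀ᶠ δ in nhdsWithin (0 : ℝ) (Ioi 0), ∀ c, c ≠ b → δ < |(E.pos c).1 - (E.pos b).1| := by
    rw [Filter.eventually_all]
    intro c
    by_cases hc : c = b
    · simp [hc]
    · have h0 : 0 < |(E.pos c).1 - (E.pos b).1| := by
        rw [abs_pos, sub_ne_zero]; exact fun h => hc (hE h)
      filter_upwards [(eventually_lt_nhds h0).filter_mono nhdsWithin_le_nhds] with δ hδ _ using hδ
  obtain ⟨δ, h1, h2⟩ := (h.and self_mem_nhdsWithin).exists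
  exact ⟨δ, h2, h1⟩

theorem chi_eq_zero {q q' c : ℝ × ℝ} (h : c.1 ≤ q.1 ∨ q'.1 < c.1) : chi q q' c = 0 := by
  unfold chi; rw [if_neg]; rintro ⟨h1, h2, h3⟩; rcases h with h | h <;> linarith

theorem abv_near {E : PlaneEmb G} (hE : XInj E) {b : V} {δ : ℝ} (h0 : 0 < δ)
    (hδ : ∀ c ≠ b, δ < |(E.pos c).1 - (E.pos b).1|) {a c d : V} (hba : G.Adj b a)
    (hcd : G.Adj c d) (hc : c ≠ b) (hd : d ≠ b) :
    abv (E.pos c) (E.pos d) (nearP δ (E.pos b) (E.pos a)) = abv (E.pos c) (E.pos d) (E.pos b) := by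
  have hgap := fun c hc => lt_abs.1 (hδ c hc)
  have hmem := nearP_mem h0 (hδ a hba.ne.symm)
  have hdisj : Disjoint (seg (E.pos c) (E.pos d)) (seg (nearP δ (E.pos b) (E.pos a)) (E.pos b)) := by
    rw [Set.disjoint_left]
    intro z hz hz'
    have hsub : seg (nearP δ (E.pos b) (E.pos a)) (E.pos b) ⊆ seg (E.pos b) (E.pos a) :=
      (convex_segment _ _).segment_subset (openSegment_subset_segment _ _ _ hmem)
        (left_mem_segment ℝ _ _)
    have h1 := E.edges_meet hcd hba (by
      intro h; rcases Sym2.eq_iff.1 h with h | h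
      · exact hc h.1
      · exact hd h.2) ⟨hz, hsub hz'⟩
    have h2 : z = E.pos a := by
      rcases h1.2 with h2 | h2
      · rcases h1.1 with h3 | h3
        · exact absurd (E.inj (h2.symm.trans h3)) hc.symm
        · exact absurd (E.inj (h2.symm.trans h3)) hd.symm
      · exact h2
    rw [h2] at hz'
    have hx := (Prod.segment_subset (𝕜 := ℝ) _ _ hz').1
    rw [segment_eq_uIcc, mem_uIcc] at hx
    rcases nearP_fst (δ := δ) (E.pos b) (E.pos a) with h4 | h4 <;> rw [h4] at hx <;>
      rcases hx with hx | hx <;> rcases hgap a hba.ne.symm with h5 | h5 <;> linarith [hx.1, hx.2]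
  have hne : (E.pos c).1 ≠ (E.pos d).1 := fun h => hcd.ne (hE h)
  apply zmod2_eq_of_add
  rcases nearP_fst (δ := δ) (E.pos b) (E.pos a) with h4 | h4
  · rw [add_comm, abv_add_abv hne (by rw [h4]; linarith) (by rwa [seg_comm (E.pos b)]),
      chi_eq_zero, chi_eq_zero, add_zero]
    · rw [h4]; rcases hgap d hd with h5 | h5
      · right; linarith
      · left; linarith
    · rw [h4]; rcases hgap c hc with h5 | h5
      · right; linarith
      · left; linarith
  · rw [abv_add_abv hne (by rw [h4]; linarith) hdisj,
      chi_eq_zero, chi_eq_zero, add_zero]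
    · rw [h4]; rcases hgap d hd with h5 | h5
      · right; linarith
      · left; linarith
    · rw [h4]; rcases hgap c hc with h5 | h5
      · right; linarith
      · left; linarith

open Classical in
theorem abv_right {δ : ℝ} (h0 : 0 < δ) {b a c : ℝ × ℝ} (ha : δ < |a.1 - b.1|)
    (h : b.1 < a.1) (h' : b.1 < c.1) :
    abv b a (nearP δ b c) = if slopeP b c < slopeP b a then 1 else 0 := by
  rw [lt_abs] at ha
  rw [nearP_of_lt h', abv_of_lt h]
  congr 1
  have h1 : 0 < a.1 - b.1 := by linarith
  have e : cr b a (b.1 + δ, b.2 + δ * slopeP b c)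
      = ((a.1 - b.1) * δ) * (slopeP b c - slopeP b a) := by
    unfold cr slopeP; field_simp; ring
  rw [e]
  simp only [eq_iff_iff]
  constructor
  · rintro ⟨_, _, h3⟩
    nlinarith [mul_pos h1 h0]
  · intro h3
    refine ⟨by linarith, ?_, mul_neg_of_pos_of_neg (mul_pos h1 h0) (by linarith)⟩
    rcases ha with ha | ha <;> linarith

open Classical in
theorem abv_left {δ : ℝ} (h0 : 0 < δ) {b a c : ℝ × ℝ} (ha : δ < |a.1 - b.1|)
    (h : a.1 < b.1) (h' : c.1 < b.1) :
    abv b a (nearP δ b c) = if slopeP b a < slopeP b c then 1 else 0 := by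
  rw [lt_abs] at ha
  rw [nearP_of_gt h', abv_comm, abv_of_lt h]
  congr 1
  have h1 : 0 < b.1 - a.1 := by linarith
  have e : cr a b (b.1 - δ, b.2 - δ * slopeP b c)
      = ((b.1 - a.1) * δ) * ((b.2 - a.2) / (b.1 - a.1) - slopeP b c) := by
    unfold cr; field_simp; ring
  have e2 : (b.2 - a.2) / (b.1 - a.1) = slopeP b a := by
    unfold slopeP; rw [← neg_sub a.2, ← neg_sub a.1, neg_div_neg_eq]
  rw [e, e2]
  simp only [eq_iff_iff]
  constructor
  · rintro ⟨_, _, h3⟩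
    nlinarith [mul_pos h1 h0]
  · intro h3
    refine ⟨?_, by linarith, mul_neg_of_pos_of_neg (mul_pos h1 h0) (by linarith)⟩
    rcases ha with ha | ha <;> linarith

theorem abv_opp {δ : ℝ} (h0 : 0 < δ) {b a c : ℝ × ℝ} (hc : δ < |c.1 - b.1|)
    (hs : ¬ (b.1 < a.1 ↔ b.1 < c.1)) : abv b a (nearP δ b c) = 0 := by
  rw [lt_abs] at hc
  by_cases h : b.1 < a.1
  · have h3 : c.1 < b.1 := by
      have : ¬ b.1 < c.1 := fun h' => hs ⟨fun _ => h', fun _ => h⟩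
      rcases hc with ha | ha <;> linarith
    apply abv_eq_zero_of_lt <;> rw [nearP_of_gt h3] <;> simp <;> linarith
  · have h3 : b.1 < c.1 := by
      by_contra h'
      exact hs ⟨fun h1 => absurd h1 h, fun h1 => absurd h1 h'⟩
    apply abv_eq_zero_of_ge <;> rw [nearP_of_lt h3] <;> simp <;> linarith

open Classical in
theorem abv_pair {E : PlaneEmb G} {b : V} {δ : ℝ} (h0 : 0 < δ)
    (hδ : ∀ c ≠ b, δ < |(E.pos c).1 - (E.pos b).1|) {a c : V} (ha : G.Adj b a) (hc : G.Adj b c)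
    (hac : a ≠ c) :
    abv (E.pos b) (E.pos a) (nearP δ (E.pos b) (E.pos c)) +
      abv (E.pos b) (E.pos c) (nearP δ (E.pos b) (E.pos a)) =
      if ((E.pos b).1 < (E.pos a).1 ↔ (E.pos b).1 < (E.pos c).1) then 1 else 0 := by
  have da := hδ a ha.ne.symm
  have dc := hδ c hc.ne.symm
  split_ifs with hs
  · have hsl : slopeP (E.pos b) (E.pos a) ≠ slopeP (E.pos b) (E.pos c) := by
      intro h
      have h1 : nearP δ (E.pos b) (E.pos a) = nearP δ (E.pos b) (E.pos c) := by
        unfold nearP; rw [h]; simp only [hs]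
      have h2 := openSegment_disjoint E hc (d := s(b, a)) ha (by
        intro h; rcases Sym2.eq_iff.1 h with h | h
        · exact hac h.2
        · exact ha.ne h.2.symm)
      refine Set.disjoint_left.1 h2 (openSegment_subset_segment _ _ _ (nearP_mem h0 da)) ?_
      rw [h1]; exact nearP_mem h0 dc
    by_cases hb : (E.pos b).1 < (E.pos a).1
    · rw [abv_right h0 da hb (hs.1 hb), abv_right h0 dc (hs.1 hb) hb]
      rcases lt_or_gt_of_ne hsl with h | h <;> simp [h, h.le]
    · have lt : ∀ x, δ < |(E.pos x).1 - (E.pos b).1| → ¬ (E.pos b).1 < (E.pos x).1 →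
          (E.pos x).1 < (E.pos b).1 := fun x hx hn => by
        rcases lt_abs.1 hx with hx | hx <;> linarith
      have ha' := lt a da hb
      have hc' := lt c dc (fun h => hb (hs.2 h))
      rw [abv_left h0 da ha' hc', abv_left h0 dc hc' ha']
      rcases lt_or_gt_of_ne hsl with h | h <;> simp [h, h.le]
  · rw [abv_opp h0 dc hs, abv_opp h0 da (fun h => hs h.symm), add_zero]

theorem par_near {E : PlaneEmb G} (hE : XInj E) {b : V} {δ : ℝ} (h0 : 0 < δ)
    (hδ : ∀ c ≠ b, δ < |(E.pos c).1 - (E.pos b).1|) {a h : V} {r : List V} (ha : G.Adj b a)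
    (hch : (b :: h :: r).IsChain G.Adj) (hb : b ∉ h :: r) :
    par E (b :: h :: r) (nearP δ (E.pos b) (E.pos a)) =
      abv (E.pos b) (E.pos h) (nearP δ (E.pos b) (E.pos a)) + par E (h :: r) (E.pos b) := by
  rw [par_cons_cons]
  congr 1
  unfold par
  congr 1
  apply List.map_congr_left
  intro d
  induction d with | _ c e
  intro hd
  have hm := mem_of_mem_edgesL hd
  exact abv_near hE h0 hδ ha (isChain_iff_edgesL.1 hch.of_cons _ hd)
    (fun h => hb (h ▸ hm.1)) (fun h => hb (h ▸ hm.2))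

theorem par_two {E : PlaneEmb G} (hE : XInj E) {b b' : V} {δ : ℝ} (h0 : 0 < δ)
    (hδ : ∀ c ≠ b, δ < |(E.pos c).1 - (E.pos b).1|) {a : V} {a₂ a₃ : List V} (ha : G.Adj b a)
    (hbb : b ≠ b') (h₂ : (b :: (a₂ ++ [b'])).IsChain G.Adj) (h₃ : (b :: (a₃ ++ [b'])).IsChain G.Adj)
    (hb₂ : b ∉ a₂) (hb₃ : b ∉ a₃) (h12 : a ≠ a₂.headD b') (h13 : a ≠ a₃.headD b') :
    par E (b :: (a₂ ++ [b'])) (midE E s(b, a)) + par E (b :: (a₃ ++ [b'])) (midE E s(b, a)) =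
    par E (b :: (a₂ ++ [b'])) (nearP δ (E.pos b) (E.pos a)) +
      par E (b :: (a₃ ++ [b'])) (nearP δ (E.pos b) (E.pos a)) := by
  have hcl : ∀ q, par E (b :: (a₂ ++ [b'])) q + par E (b :: (a₃ ++ [b'])) q =
      par E (b :: (a₂ ++ b' :: a₃.reverse) ++ [b]) q := by
    intro q
    have : b :: (a₂ ++ b' :: a₃.reverse) ++ [b] = (b :: a₂) ++ b' :: (a₃.reverse ++ [b]) := by simp
    rw [this, par_append, ← par_reverse E (b :: (a₃ ++ [b']))]
    simp
  have hed : ∀ l : List V, b ∉ l → a ≠ l.headD b' → s(b, a) ∉ edgesL (b :: (l ++ [b'])) := by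
    intro l hl hh
    cases l with
    | nil => simp only [List.headD_nil] at hh; simp [hh]; exact fun h => absurd h hbb
    | cons x l =>
      simp only [List.headD_cons] at hh
      simp only [List.cons_append, edgesL_cons_cons, List.mem_cons, not_or]
      constructor
      · intro h; rcases Sym2.eq_iff.1 h with h | h
        · exact hh h.2
        · exact hl (by simp [h.1])
      · intro h
        have := (mem_of_mem_edgesL h).1
        simp only [List.mem_cons, List.mem_append, List.not_mem_nil, or_false] at this hl
        tauto
  rw [hcl, hcl]
  have e : b :: (a₂ ++ b' :: a₃.reverse) ++ [b] = (b :: a₂) ++ b' :: (a₃.reverse ++ [b]) := by simp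
  have e3 : b' :: (a₃.reverse ++ [b]) = (b :: (a₃ ++ [b'])).reverse := by simp
  apply par_openSegment hE _ ha _ (nearP_mem h0 (hδ a ha.ne.symm))
  · rw [isChain_iff_edgesL] at *
    intro d hd
    rw [e, edgesL_append, List.mem_append, e3, edgesL_reverse, List.mem_reverse] at hd
    rcases hd with hd | hd
    · exact h₂ d (by simpa using hd)
    · exact h₃ d hd
  · intro hd
    rw [e, edgesL_append, List.mem_append, e3, edgesL_reverse, List.mem_reverse] at hd
    rcases hd with hd | hd
    · exact hed a₂ hb₂ h12 (by simpa using hd)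
    · exact hed a₃ hb₃ h13 hd

theorem headD_append_singleton (l : List V) (b : V) : l ++ [b] = l.headD b :: (l ++ [b]).tail := by
  cases l <;> simp

theorem two_classes (s₁ s₂ s₃ : Prop) [Decidable (s₁ ↔ s₂)] [Decidable (s₁ ↔ s₃)]
    [Decidable (s₂ ↔ s₃)] : ((if s₁ ↔ s₂ then 1 else 0) + (if s₁ ↔ s₃ then 1 else 0) +
      (if s₂ ↔ s₃ then 1 else 0) : ZMod 2) = 1 := by
  by_cases h₁ : s₁ <;> by_cases h₂ : s₂ <;> by_cases h₃ : s₃ <;> simp [h₁, h₂, h₃] <;> decide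

theorem par_theta [Finite V] {E : PlaneEmb G} (hE : XInj E) {b b' : V} {a₁ a₂ a₃ : List V}
    (hbb : b ≠ b') (h₁ : (b :: (a₁ ++ [b'])).IsChain G.Adj)
    (h₂ : (b :: (a₂ ++ [b'])).IsChain G.Adj)
    (h₃ : (b :: (a₃ ++ [b'])).IsChain G.Adj) (hb₁ : b ∉ a₁) (hb₂ : b ∉ a₂) (hb₃ : b ∉ a₃)
    (h12 : a₁.headD b' ≠ a₂.headD b') (h13 : a₁.headD b' ≠ a₃.headD b')
    (h23 : a₂.headD b' ≠ a₃.headD b') :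
    (par E (b :: (a₂ ++ [b'])) (midE E s(b, a₁.headD b')) +
      par E (b :: (a₃ ++ [b'])) (midE E s(b, a₁.headD b'))) +
    (par E (b :: (a₁ ++ [b'])) (midE E s(b, a₂.headD b')) +
      par E (b :: (a₃ ++ [b'])) (midE E s(b, a₂.headD b'))) +
    (par E (b :: (a₁ ++ [b'])) (midE E s(b, a₃.headD b')) +
      par E (b :: (a₂ ++ [b'])) (midE E s(b, a₃.headD b'))) = 1 := by
  classical
  obtain ⟨δ, h0, hδ⟩ := exists_gap E hE b
  have adj : ∀ a : List V, (b :: (a ++ [b'])).IsChain G.Adj → G.Adj b (a.headD b') := by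
    intro a h
    rw [headD_append_singleton, List.isChain_cons_cons] at h
    exact h.1
  have near : ∀ a : List V, (b :: (a ++ [b'])).IsChain G.Adj → b ∉ a → ∀ c, G.Adj b c →
      par E (b :: (a ++ [b'])) (nearP δ (E.pos b) (E.pos c)) =
      abv (E.pos b) (E.pos (a.headD b')) (nearP δ (E.pos b) (E.pos c)) +
        par E (a ++ [b']) (E.pos b) := by
    intro a h hb c hc
    have hb' : b ∉ a ++ [b'] := by simp [hb, hbb]
    rw [headD_append_singleton] at h hb' ⊢
    exact par_near hE h0 hδ hc h hb'
  rw [par_two hE h0 hδ (adj _ h₁) hbb h₂ h₃ hb₂ hb₃ h12 h13,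
    par_two hE h0 hδ (adj _ h₂) hbb h₁ h₃ hb₁ hb₃ h12.symm h23,
    par_two hE h0 hδ (adj _ h₃) hbb h₁ h₂ hb₁ hb₂ h13.symm h23.symm,
    near _ h₂ hb₂ _ (adj _ h₁), near _ h₃ hb₃ _ (adj _ h₁), near _ h₁ hb₁ _ (adj _ h₂),
    near _ h₃ hb₃ _ (adj _ h₂), near _ h₁ hb₁ _ (adj _ h₃), near _ h₂ hb₂ _ (adj _ h₃)]
  have p12 := abv_pair h0 hδ (adj _ h₁) (adj _ h₂) h12
  have p13 := abv_pair h0 hδ (adj _ h₁) (adj _ h₃) h13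
  have p23 := abv_pair h0 hδ (adj _ h₂) (adj _ h₃) h23
  generalize abv (E.pos b) (E.pos (a₁.headD b')) (nearP δ (E.pos b) (E.pos (a₂.headD b'))) = x12 at *
  generalize abv (E.pos b) (E.pos (a₂.headD b')) (nearP δ (E.pos b) (E.pos (a₁.headD b'))) = x21 at *
  generalize abv (E.pos b) (E.pos (a₁.headD b')) (nearP δ (E.pos b) (E.pos (a₃.headD b'))) = x13 at *
  generalize abv (E.pos b) (E.pos (a₃.headD b')) (nearP δ (E.pos b) (E.pos (a₁.headD b'))) = x31 at *
  generalize abv (E.pos b) (E.pos (a₂.headD b')) (nearP δ (E.pos b) (E.pos (a₃.headD b'))) = x23 at *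
  generalize abv (E.pos b) (E.pos (a₃.headD b')) (nearP δ (E.pos b) (E.pos (a₂.headD b'))) = x32 at *
  generalize par E (a₁ ++ [b']) (E.pos b) = R1
  generalize par E (a₂ ++ [b']) (E.pos b) = R2
  generalize par E (a₃ ++ [b']) (E.pos b) = R3
  have e : x21 + R2 + (x31 + R3) + (x12 + R1 + (x32 + R3)) + (x13 + R1 + (x23 + R2)) =
    (x12 + x21) + (x13 + x31) + (x23 + x32) + (R1 + R1) + (R2 + R2) + (R3 + R3) := by ring
  rw [e, CharTwo.add_self_eq_zero, CharTwo.add_self_eq_zero, CharTwo.add_self_eq_zero, p12, p13, p23]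
  rw [add_zero, add_zero, add_zero]
  exact two_classes _ _ _

theorem par_outer [Finite V] {E : PlaneEmb G} (hE : XInj E) {T : Set (Sym2 V)}
    (hT : T ⊆ G.edgeSet) (hne : T.Nonempty) : ∃ e ∈ T, ∀ (x : V) (t : List V),
    (x :: t ++ [x]).IsChain G.Adj → (∀ d ∈ edgesL (x :: t ++ [x]), d ∈ T ∧ d ≠ e) →
    par E (x :: t ++ [x]) (midE E e) = 0 := by
  classical
  obtain ⟨v, hv, hmin⟩ := Set.exists_min_image {v : V | ∃ d ∈ T, v ∈ d} (fun v => (E.pos v).1)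
    (Set.toFinite _) (by obtain ⟨d, hd⟩ := hne; exact ⟨_, d, hd, Sym2.out_fst_mem d⟩)
  obtain ⟨a, ha, hmax⟩ := Set.exists_max_image {a : V | s(v, a) ∈ T}
    (fun a => slopeP (E.pos v) (E.pos a)) (Set.toFinite _) (by
      obtain ⟨d, hd, hvd⟩ := hv
      obtain ⟨a, rfl⟩ := hvd
      exact ⟨a, hd⟩)
  obtain ⟨δ, h0, hδ⟩ := exists_gap E hE v
  have hlt : ∀ c d, s(c, d) ∈ T → c ≠ v → (E.pos v).1 + δ < (E.pos c).1 := by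
    intro c d hcd hc
    have h1 := hmin c ⟨_, hcd, by simp⟩
    rcases lt_abs.1 (hδ c hc) with h2 | h2 <;> linarith
  have hva : G.Adj v a := hT ha
  have hav : (E.pos v).1 < (E.pos a).1 := by
    have := hlt a v (by rw [Sym2.eq_swap]; exact ha) hva.ne.symm; linarith
  refine ⟨s(v, a), ha, fun x t hch hd => ?_⟩
  rw [par_openSegment hE hch hva (fun h => (hd _ h).2 rfl) (nearP_mem h0 (hδ a hva.ne.symm))]
  have hz : ∀ c, s(v, c) ∈ T → abv (E.pos v) (E.pos c) (nearP δ (E.pos v) (E.pos a)) = 0 := by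
    intro c hc
    have hvc : G.Adj v c := hT hc
    have hcv : (E.pos v).1 < (E.pos c).1 := by
      have := hlt c v (by rw [Sym2.eq_swap]; exact hc) hvc.ne.symm; linarith
    rw [abv_right h0 (hδ c hvc.ne.symm) hcv hav, if_neg]
    exact not_lt.2 (hmax c hc)
  unfold par
  apply List.sum_eq_zero
  intro y hy
  obtain ⟨d, hd', rfl⟩ := List.mem_map.1 hy
  have hdT := (hd d hd').1
  clear hy hd'
  induction d with | _ c e
  rw [abvE_mk]
  by_cases hc : c = v
  · rw [hc] at hdT ⊢; exact hz e hdT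
  by_cases he : e = v
  · rw [he] at hdT ⊢; rw [abv_comm]; exact hz c (by rwa [Sym2.eq_swap])
  apply abv_eq_zero_of_lt <;> rw [nearP_of_lt hav]
  · exact hlt c e hdT hc
  · exact hlt e c (by rwa [Sym2.eq_swap]) he

/-- The parity system of a plane embedding. -/
noncomputable def parSys [Finite V] (E : PlaneEmb G) (hE : XInj E) : ParSys G where
  w d e := abvE E d (midE E e)
  prop x t v a b hch hv ha hb := by
    simp only [psum_eq_par]
    rw [par_vertex hE hch ha hv, par_vertex hE hch hb hv]
  theta b b' a₁ a₂ a₃ hbb h₁ h₂ h₃ hb₁ hb₂ hb₃ h12 h13 h23 := by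
    simp only [psum_eq_par]
    exact par_theta hE hbb h₁ h₂ h₃ hb₁ hb₂ hb₃ h12 h13 h23
  outer T hT hne := by
    simp only [psum_eq_par]
    exact par_outer hE hT hne

theorem isCompact_seg (a b : ℝ × ℝ) : IsCompact (seg a b) := by
  rw [seg, segment_eq_image']
  exact isCompact_Icc.image (by fun_prop)

/-- The drawing of a walk. -/
def drawL (E : PlaneEmb G) (l : List V) : Set (ℝ × ℝ) := ⋃ d ∈ {d | d ∈ edgesL l}, segE E d

theorem isClosed_drawL (E : PlaneEmb G) (l : List V) : IsClosed (drawL E l) := by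
  refine (List.finite_toSet _).isClosed_biUnion fun d _ => ?_
  induction d with | _ a b
  exact (isCompact_seg _ _).isClosed

theorem isBounded_drawL (E : PlaneEmb G) (l : List V) : Bornology.IsBounded (drawL E l) := by
  refine (Bornology.isBounded_biUnion (List.finite_toSet _)).2 fun d _ => ?_
  induction d with | _ a b
  exact (isCompact_seg _ _).isBounded

theorem par_eq_of_drawL {E : PlaneEmb G} (hE : XInj E) {x : V} {t : List V} {q q' : ℝ × ℝ}
    (hch : (x :: t ++ [x]).IsChain G.Adj) (h : Disjoint (drawL E (x :: t ++ [x])) (seg q q')) :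
    par E (x :: t ++ [x]) q = par E (x :: t ++ [x]) q' :=
  par_eq_of_disjoint hE hch fun _ hd => h.mono_left (subset_biUnion_of_mem (u := segE E) hd)

theorem par_locally_const {E : PlaneEmb G} (hE : XInj E) {x : V} {t : List V} {q : ℝ × ℝ}
    (hch : (x :: t ++ [x]).IsChain G.Adj) (h : q ∉ drawL E (x :: t ++ [x])) :
    ∃ r > 0, ∀ q' ∈ Metric.ball q r, q' ∉ drawL E (x :: t ++ [x]) ∧
      par E (x :: t ++ [x]) q = par E (x :: t ++ [x]) q' := by
  obtain ⟨r, hr, hb⟩ := Metric.isOpen_iff.1 (isClosed_drawL E (x :: t ++ [x])).isOpen_compl q h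
  refine ⟨r, hr, fun q' hq' => ⟨hb hq', par_eq_of_drawL hE hch ?_⟩⟩
  rw [Set.disjoint_left]
  intro z hz hz'
  exact hb ((convex_ball q r).segment_subset (Metric.mem_ball_self hr) hq' hz') hz

theorem par_eq_zero_of_right {E : PlaneEmb G} {l : List V} {q : ℝ × ℝ}
    (h : ∀ d ∈ edgesL l, ∀ p ∈ segE E d, p.1 ≤ q.1) : par E l q = 0 := by
  unfold par
  apply List.sum_eq_zero
  intro y hy
  obtain ⟨d, hd, rfl⟩ := List.mem_map.1 hy
  have := h d hd
  clear hy hd h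
  induction d with | _ a b
  exact abv_eq_zero_of_ge (this _ (left_mem_segment ℝ _ _)) (this _ (right_mem_segment ℝ _ _))

theorem par_far {E : PlaneEmb G} (hE : XInj E) {x : V} {t : List V}
    (hch : (x :: t ++ [x]).IsChain G.Adj) {F : Set (ℝ × ℝ)} (hF : ¬ Bornology.IsBounded F) :
    ∃ q ∈ F, par E (x :: t ++ [x]) q = 0 := by
  obtain ⟨R, hR⟩ := (isBounded_iff_forall_norm_le).1 (isBounded_drawL E (x :: t ++ [x]))
  have hb : ∃ q ∈ F, R < ‖q‖ := by
    by_contra h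
    push Not at h
    exact hF (isBounded_iff_forall_norm_le.2 ⟨R, h⟩)
  obtain ⟨q, hq, hqR⟩ := hb
  refine ⟨q, hq, ?_⟩
  have hbd : ∀ d ∈ edgesL (x :: t ++ [x]), ∀ p ∈ segE E d, |p.1| ≤ R ∧ |p.2| ≤ R := by
    intro d hd p hp
    have := hR p (mem_biUnion hd hp)
    exact ⟨(norm_fst_le p).trans this, (norm_snd_le p).trans this⟩
  have hslide : ∀ p : ℝ × ℝ, R < |p.2| → par E (x :: t ++ [x]) p = 0 := by
    intro p hp
    have h1 : par E (x :: t ++ [x]) p = par E (x :: t ++ [x]) (|R|, p.2) := by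
      apply par_eq_of_disjoint hE hch
      intro d hd
      rw [Set.disjoint_left]
      intro z hz hz'
      have h2 := (Prod.segment_subset (𝕜 := ℝ) _ _ hz').2
      simp only [segment_same, mem_singleton_iff] at h2
      have := (hbd d hd z hz).2
      rw [h2] at this
      linarith
    rw [h1]
    apply par_eq_zero_of_right
    intro d hd p hp
    exact (le_abs_self _).trans ((hbd d hd p hp).1.trans (le_abs_self _))
  rcases le_or_gt (|q.2|) R with h | h
  · have h1 : R < |q.1| := by
      rw [Prod.norm_def, lt_max_iff] at hqR
      rcases hqR with h' | h'
      · exact h'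
      · exact absurd h' h.not_gt
    rcases lt_abs.1 h1 with h2 | h2
    · apply par_eq_zero_of_right
      intro d hd p hp
      linarith [(abs_le.1 (hbd d hd p hp).1).2]
    · unfold par
      apply List.sum_eq_zero
      intro y hy
      obtain ⟨d, hd, rfl⟩ := List.mem_map.1 hy
      have := hbd d hd
      clear hy hd hbd
      induction d with | _ a b
      apply abv_eq_zero_of_lt
      · linarith [(abs_le.1 (this _ (left_mem_segment ℝ _ _)).1).1]
      · linarith [(abs_le.1 (this _ (right_mem_segment ℝ _ _)).1).1]
  · exact hslide q h

theorem outer_of_mem_closure [Finite V] {E : PlaneEmb G} (hE : XInj E) {F : Set (ℝ × ℝ)}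
    (hF : IsPreconnected F) (hub : ¬ Bornology.IsBounded F) (hd : Disjoint F E.drawing) {v : V}
    (hv : E.pos v ∈ closure F) : Outer (parSys E hE) G v := by
  intro l hl hvl u hvu
  match l, hl with
  | x :: t, hl =>
  have hch := hl.2.2
  change par E (x :: t ++ [x]) (midE E s(v, u)) = 0
  rw [par_vertex hE hch hvu hvl]
  have hvl' : v ∉ x :: t ++ [x] := by
    simp only [List.cons_append, List.mem_cons, List.mem_append, not_or] at hvl ⊢; simp_all
  have hvd : E.pos v ∉ drawL E (x :: t ++ [x]) := by
    intro h
    obtain ⟨d, hd, hz⟩ := mem_iUnion₂.1 h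
    induction d with | _ a b
    have hm := mem_of_mem_edgesL hd
    exact E.vertex_off (isChain_iff_edgesL.1 hch _ hd) (fun h : v = a => hvl' (h ▸ hm.1))
      (fun h : v = b => hvl' (h ▸ hm.2)) hz
  have hsub : drawL E (x :: t ++ [x]) ⊆ E.drawing := by
    intro z hz
    obtain ⟨d, hd, hz⟩ := mem_iUnion₂.1 hz
    induction d with | _ a b
    have hab : G.Adj a b := isChain_iff_edgesL.1 hch _ hd
    exact Or.inr (mem_iUnion.2 ⟨a, mem_iUnion.2 ⟨b, mem_iUnion.2 ⟨hab, hz⟩⟩⟩)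
  obtain ⟨r, hr, hball⟩ := par_locally_const hE hch hvd
  obtain ⟨q, hqF, hqr⟩ := Metric.mem_closure_iff.1 hv r hr
  rw [(hball q (by rw [Metric.mem_ball, dist_comm]; exact hqr)).2]
  obtain ⟨q₀, hq₀, hz₀⟩ := par_far hE hch hub
  let A : Set (ℝ × ℝ) := {q | q ∉ drawL E (x :: t ++ [x]) ∧ par E (x :: t ++ [x]) q = 0}
  let B : Set (ℝ × ℝ) := {q | q ∉ drawL E (x :: t ++ [x]) ∧ par E (x :: t ++ [x]) q ≠ 0}
  have hA : IsOpen A := by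
    rw [Metric.isOpen_iff]
    rintro q ⟨h1, h2⟩
    obtain ⟨r, hr, h3⟩ := par_locally_const hE hch h1
    exact ⟨r, hr, fun q' hq' => ⟨(h3 q' hq').1, (h3 q' hq').2 ▸ h2⟩⟩
  have hB : IsOpen B := by
    rw [Metric.isOpen_iff]
    rintro q ⟨h1, h2⟩
    obtain ⟨r, hr, h3⟩ := par_locally_const hE hch h1
    exact ⟨r, hr, fun q' hq' => ⟨(h3 q' hq').1, (h3 q' hq').2 ▸ h2⟩⟩
  have hFd : ∀ q ∈ F, q ∉ drawL E (x :: t ++ [x]) := fun q hq h =>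
    Set.disjoint_left.1 hd hq (hsub h)
  have hFA : F ⊆ A := by
    apply hF.subset_left_of_subset_union hA hB
    · rw [Set.disjoint_left]; rintro q ⟨_, h1⟩ ⟨_, h2⟩; exact h2 h1
    · intro q hq
      by_cases h : par E (x :: t ++ [x]) q = 0
      · exact Or.inl ⟨hFd q hq, h⟩
      · exact Or.inr ⟨hFd q hq, h⟩
    · exact ⟨q₀, hq₀, hFd _ hq₀, hz₀⟩
  exact (hFA hqF).2

/-- The image of an embedding under a linear automorphism of the plane. -/
def PlaneEmb.map (E : PlaneEmb G) (T : (ℝ × ℝ) ≃L[ℝ] ℝ × ℝ) : PlaneEmb G where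
  pos v := T (E.pos v)
  inj := T.injective.comp E.inj
  edges_meet a b c d hab hcd hne := by
    have e : ∀ p q, seg (T p) (T q) = T '' seg p q := fun p q =>
      (image_segment ℝ T.toLinearMap.toAffineMap p q).symm
    rw [e, e, ← image_inter T.injective]
    rintro _ ⟨z, hz, rfl⟩
    have := E.edges_meet hab hcd hne hz
    simpa [T.injective.eq_iff] using this
  vertex_off a b v hab ha hb := by
    have e : ∀ p q, seg (T p) (T q) = T '' seg p q := fun p q =>
      (image_segment ℝ T.toLinearMap.toAffineMap p q).symm
    rw [e]
    rintro ⟨z, hz, h⟩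
    rw [T.injective h] at hz
    exact E.vertex_off hab ha hb hz

theorem PlaneEmb.map_drawing (E : PlaneEmb G) (T : (ℝ × ℝ) ≃L[ℝ] ℝ × ℝ) :
    (E.map T).drawing = T '' E.drawing := by
  have e : ∀ p q, seg (T p) (T q) = T '' seg p q := fun p q =>
      (image_segment ℝ T.toLinearMap.toAffineMap p q).symm
  simp only [PlaneEmb.drawing, image_union, image_iUnion, PlaneEmb.map, e]
  congr 1
  exact Set.range_comp _ _

/-- The shear `(x, y) ↦ (x + ε y, y)`. -/
noncomputable def shear (ε : ℝ) : (ℝ × ℝ) ≃L[ℝ] ℝ × ℝ :=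
  LinearEquiv.toContinuousLinearEquiv
    { toFun := fun p => (p.1 + ε * p.2, p.2)
      invFun := fun p => (p.1 - ε * p.2, p.2)
      map_add' := fun p q => by ext <;> simp; ring
      map_smul' := fun c p => by ext <;> simp; ring
      left_inv := fun p => by simp
      right_inv := fun p => by simp }

theorem exists_shear [Finite V] (E : PlaneEmb G) : ∃ ε, XInj (E.map (shear ε)) := by
  have hfin : {ε : ℝ | ∃ u v, u ≠ v ∧
      (E.pos u).1 + ε * (E.pos u).2 = (E.pos v).1 + ε * (E.pos v).2}.Finite := by
    have : {ε : ℝ | ∃ u v, u ≠ v ∧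
      (E.pos u).1 + ε * (E.pos u).2 = (E.pos v).1 + ε * (E.pos v).2} =
      ⋃ u, ⋃ v, {ε : ℝ | u ≠ v ∧
        (E.pos u).1 + ε * (E.pos u).2 = (E.pos v).1 + ε * (E.pos v).2} := by
      ext; simp
    rw [this]
    refine Set.finite_iUnion fun u => Set.finite_iUnion fun v => Set.Subsingleton.finite ?_
    rintro ε ⟨hne, h⟩ ε' ⟨_, h'⟩
    by_contra hε
    have h1 : (ε - ε') * ((E.pos u).2 - (E.pos v).2) = 0 := by linarith
    rcases mul_eq_zero.1 h1 with h2 | h2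
    · exact hε (by linarith)
    · refine hne (E.inj (Prod.ext ?_ (by linarith)))
      have h3 : (E.pos u).2 = (E.pos v).2 := by linarith
      rw [h3] at h; linarith
  obtain ⟨ε, hε⟩ := hfin.infinite_compl.nonempty
  refine ⟨ε, fun u v h => ?_⟩
  by_contra hne
  exact hε ⟨u, v, hne, h⟩

theorem exists_parSys [Finite V] (E : PlaneEmb G) {F : Set (ℝ × ℝ)} (hF : E.IsOuterFace F) :
    ∃ S : ParSys G, ∀ v ∈ E.onFace F, Outer S G v := by
  obtain ⟨⟨q, hq, rfl⟩, hub⟩ := hF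
  obtain ⟨ε, hE⟩ := exists_shear E
  refine ⟨parSys _ hE, fun v hv => ?_⟩
  let T := shear ε
  apply outer_of_mem_closure hE (F := T '' connectedComponentIn E.drawingᶜ q)
  · exact isPreconnected_connectedComponentIn.image _ T.continuous.continuousOn
  · intro h
    apply hub
    have := T.symm.lipschitz.isBounded_image h
    rwa [← image_comp, ContinuousLinearEquiv.symm_comp_self, image_id] at this
  · rw [PlaneEmb.map_drawing]
    refine (disjoint_image_iff T.injective).2 ?_
    exact Set.disjoint_left.2 fun z hz => connectedComponentIn_subset _ _ hz
  · exact image_closure_subset_closure_image T.continuous ⟨_, hv, rfl⟩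

end Geometry

/-- The edges of a cyclic list. -/
def cedges : List V → List (Sym2 V)
  | [] => []
  | x :: t => edgesL (x :: t ++ [x])

theorem csum_eq (w : Sym2 V → Sym2 V → ZMod 2) (l : List V) (e : Sym2 V) :
    csum w l e = ((cedges l).map (w · e)).sum := by cases l <;> rfl

theorem cedges_append_perm (l₁ l₂ : List V) : (cedges (l₁ ++ l₂)).Perm (cedges (l₂ ++ l₁)) := by
  match l₁, l₂ with
  | [], l₂ => simp
  | l₁, [] => simp
  | x :: s, y :: t =>
    have h1 : cedges (x :: s ++ y :: t) = edgesL ((x :: s) ++ y :: (t ++ [x])) := by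
      simp [cedges]
    have h2 : cedges (y :: t ++ x :: s) = edgesL ((y :: t) ++ x :: (s ++ [y])) := by
      simp [cedges]
    rw [h1, h2, edgesL_append, edgesL_append (y :: t)]
    exact List.perm_append_comm

theorem cedges_reverse_perm (l : List V) : (cedges l.reverse).Perm (cedges l) := by
  cases l with
  | nil => simp
  | cons x t =>
    rw [List.reverse_cons]
    refine (cedges_append_perm _ _).trans ?_
    have : cedges ([x] ++ t.reverse) = (edgesL (x :: t ++ [x])).reverse := by
      rw [← edgesL_reverse]; simp [cedges]
    rw [this]
    exact List.reverse_perm _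

theorem csum_append_comm (w : Sym2 V → Sym2 V → ZMod 2) (l₁ l₂ : List V) (e : Sym2 V) :
    csum w (l₁ ++ l₂) e = csum w (l₂ ++ l₁) e := by
  rw [csum_eq, csum_eq]
  exact ((cedges_append_perm l₁ l₂).map _).sum_eq

theorem csum_reverse (w : Sym2 V → Sym2 V → ZMod 2) (l : List V) (e : Sym2 V) :
    csum w l.reverse e = csum w l e := by
  rw [csum_eq, csum_eq]
  exact ((cedges_reverse_perm l).map _).sum_eq

theorem isCyc_iff {H : SimpleGraph V} {l : List V} :
    IsCyc H l ↔ l.Nodup ∧ 3 ≤ l.length ∧ ∀ d ∈ cedges l, d ∈ H.edgeSet := by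
  cases l with
  | nil => simp [IsCyc]
  | cons x t => simp [IsCyc, isChain_iff_edgesL, cedges]

theorem IsCyc.rotate {H : SimpleGraph V} {l₁ l₂ : List V} (h : IsCyc H (l₁ ++ l₂)) :
    IsCyc H (l₂ ++ l₁) := by
  rw [isCyc_iff] at *
  refine ⟨List.nodup_append_comm.1 h.1, by have := h.2.1; simp at *; omega, fun d hd => ?_⟩
  exact h.2.2 d ((cedges_append_perm l₁ l₂).mem_iff.2 hd)

theorem IsCyc.reverse {H : SimpleGraph V} {l : List V} (h : IsCyc H l) : IsCyc H l.reverse := by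
  rw [isCyc_iff] at *
  refine ⟨List.nodup_reverse.2 h.1, by simpa using h.2.1, fun d hd => ?_⟩
  exact h.2.2 d ((cedges_reverse_perm l).mem_iff.1 hd)

theorem mem_of_mem_cedges {l : List V} {a b : V} (h : s(a, b) ∈ cedges l) : a ∈ l ∧ b ∈ l := by
  cases l with
  | nil => simp [cedges] at h
  | cons x t =>
    have := mem_of_mem_edgesL h
    simp at this
    simp; tauto

/-- All edges of the cyclic list `z` belong to `H`. -/
def ClosedIn (H : SimpleGraph V) (z : List V) : Prop := ∀ d ∈ cedges z, d ∈ H.edgeSet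

theorem IsCyc.closedIn {H : SimpleGraph V} {l : List V} (h : IsCyc H l) : ClosedIn H l :=
  (isCyc_iff.1 h).2.2

theorem ClosedIn.mono {H H' : SimpleGraph V} (hH : H ≤ H') {z : List V} (h : ClosedIn H z) :
    ClosedIn H' z := fun d hd => SimpleGraph.edgeSet_mono hH (h d hd)

theorem IsCyc.mono {H H' : SimpleGraph V} (hH : H ≤ H') {z : List V} (h : IsCyc H z) :
    IsCyc H' z := by
  rw [isCyc_iff] at *
  exact ⟨h.1, h.2.1, ClosedIn.mono hH h.2.2⟩

theorem Outer.mono {S : ParSys G} {H H' : SimpleGraph V} (hH : H' ≤ H) {v : V}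
    (h : Outer S H v) : Outer S H' v :=
  fun l hl hv u hu => h l (hl.mono hH) hv u (hH hu)

theorem ParSys.csum_prop (S : ParSys G) {z : List V} (hz : ClosedIn G z) {v a b : V} (hv : v ∉ z)
    (ha : G.Adj v a) (hb : G.Adj v b) : csum S.w z s(v, a) = csum S.w z s(v, b) := by
  cases z with
  | nil => rfl
  | cons x t => exact S.prop x t v a b (isChain_iff_edgesL.2 hz) hv ha hb

theorem ParSys.csum_prop' (S : ParSys G) {z : List V} (hz : ClosedIn G z) {v : V} (hv : v ∉ z)
    {d e : Sym2 V} (hd : d ∈ G.edgeSet) (he : e ∈ G.edgeSet) (hvd : v ∈ d) (hve : v ∈ e) :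
    csum S.w z d = csum S.w z e := by
  obtain ⟨a, rfl⟩ := hvd
  obtain ⟨b, rfl⟩ := hve
  exact S.csum_prop hz hv hd he

theorem ParSys.csum_path (S : ParSys G) {z : List V} (hz : ClosedIn G z) {c c' : V} {r : List V}
    (hr : ∀ x ∈ r, x ∉ z) (hch : (c :: (r ++ [c'])).IsChain G.Adj) :
    ∀ d ∈ edgesL (c :: (r ++ [c'])), csum S.w z d = csum S.w z s(c, r.headD c') := by
  induction r generalizing c with
  | nil => simp
  | cons x r ih =>
    simp only [List.cons_append, edgesL_cons_cons, List.mem_cons, List.headD_cons]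
    simp only [List.cons_append, List.isChain_cons_cons] at hch
    rintro d (rfl | hd)
    · rfl
    · rw [ih (fun y hy => hr y (by simp [hy])) hch.2 d hd]
      have h1 : G.Adj x (r.headD c') := by
        have := hch.2
        rw [headD_append_singleton, List.isChain_cons_cons] at this
        exact this.1
      rw [S.csum_prop hz (hr x (by simp)) h1 hch.1.symm, Sym2.eq_swap]

theorem ParSys.csum_path_eq (S : ParSys G) {z : List V} (hz : ClosedIn G z) {c c' : V} {r : List V}
    (hr : ∀ x ∈ r, x ∉ z) (hch : (c :: (r ++ [c'])).IsChain G.Adj) {d d' : Sym2 V}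
    (hd : d ∈ edgesL (c :: (r ++ [c']))) (hd' : d' ∈ edgesL (c :: (r ++ [c']))) :
    csum S.w z d = csum S.w z d' := by
  rw [S.csum_path hz hr hch d hd, S.csum_path hz hr hch d' hd']

theorem head_mem_edgesL (b b' : V) (a : List V) : s(b, a.headD b') ∈ edgesL (b :: (a ++ [b'])) := by
  cases a <;> simp

theorem exists_mem_edgesL {b b' x : V} {a : List V} (h : x ∈ b :: (a ++ [b'])) :
    ∃ y, s(x, y) ∈ edgesL (b :: (a ++ [b'])) := by
  induction a generalizing b with
  | nil =>
    simp at h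
    rcases h with rfl | rfl
    · exact ⟨b', by simp⟩
    · exact ⟨b, by simp [Sym2.eq_swap]⟩
  | cons c a ih =>
    rw [List.mem_cons] at h
    rcases h with rfl | h
    · exact ⟨c, by simp⟩
    · obtain ⟨y, hy⟩ := ih h
      exact ⟨y, by simp at hy ⊢; tauto⟩

theorem exists_mem_cedges {x : V} {l : List V} (h : x ∈ l) : ∃ y, s(x, y) ∈ cedges l := by
  cases l with
  | nil => simp at h
  | cons b t => exact exists_mem_edgesL (by simp at h ⊢; tauto)

/-- The cyclic list formed by two paths from `b` to `b'`. -/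
def cyc2 (b b' : V) (a₁ a₂ : List V) : List V := b :: (a₁ ++ b' :: a₂.reverse)

theorem mem_cyc2 {b b' x : V} {a₁ a₂ : List V} :
    x ∈ cyc2 b b' a₁ a₂ ↔ x = b ∨ x = b' ∨ x ∈ a₁ ∨ x ∈ a₂ := by
  simp [cyc2]; tauto

theorem cedges_cyc2 (b b' : V) (a₁ a₂ : List V) : (cedges (cyc2 b b' a₁ a₂)).Perm
    (edgesL (b :: (a₁ ++ [b'])) ++ edgesL (b :: (a₂ ++ [b']))) := by
  have h1 : cedges (cyc2 b b' a₁ a₂) = edgesL ((b :: a₁) ++ b' :: (a₂.reverse ++ [b])) := by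
    simp [cedges, cyc2]
  have h2 : b' :: (a₂.reverse ++ [b]) = (b :: (a₂ ++ [b'])).reverse := by simp
  rw [h1, edgesL_append, h2, edgesL_reverse]
  exact List.Perm.append (by simp) (List.reverse_perm _)

theorem csum_cyc2 (w : Sym2 V → Sym2 V → ZMod 2) (b b' : V) (a₁ a₂ : List V) (e : Sym2 V) :
    csum w (cyc2 b b' a₁ a₂) e = psum w (b :: (a₁ ++ [b'])) e + psum w (b :: (a₂ ++ [b'])) e := by
  rw [csum_eq, ((cedges_cyc2 b b' a₁ a₂).map _).sum_eq, List.map_append, List.sum_append]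
  rfl

theorem mem_cedges_cyc2 {b b' : V} {a₁ a₂ : List V} {d : Sym2 V} : d ∈ cedges (cyc2 b b' a₁ a₂) ↔
    d ∈ edgesL (b :: (a₁ ++ [b'])) ∨ d ∈ edgesL (b :: (a₂ ++ [b'])) := by
  rw [(cedges_cyc2 b b' a₁ a₂).mem_iff, List.mem_append]

theorem closedIn_cyc2 {H : SimpleGraph V} {b b' : V} {a₁ a₂ : List V}
    (h₁ : (b :: (a₁ ++ [b'])).IsChain H.Adj) (h₂ : (b :: (a₂ ++ [b'])).IsChain H.Adj) :
    ClosedIn H (cyc2 b b' a₁ a₂) := by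
  intro d hd
  rcases mem_cedges_cyc2.1 hd with h | h
  · exact isChain_iff_edgesL.1 h₁ d h
  · exact isChain_iff_edgesL.1 h₂ d h

/-- Two internally disjoint paths between `b` and `b'`, with interiors `a₁`, `a₂`, that do not
share an edge. -/
structure TwoPaths (b b' : V) (a₁ a₂ : List V) : Prop where
  ne : b ≠ b'
  b₁ : b ∉ a₁
  b₂ : b ∉ a₂
  b₁' : b' ∉ a₁
  b₂' : b' ∉ a₂
  disj : ∀ x ∈ a₁, x ∉ a₂
  non : a₁ ≠ [] ∨ a₂ ≠ []

theorem TwoPaths.symm {b b' : V} {a₁ a₂ : List V} (h : TwoPaths b b' a₁ a₂) :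
    TwoPaths b b' a₂ a₁ :=
  ⟨h.ne, h.b₂, h.b₁, h.b₂', h.b₁', fun x hx hx' => h.disj x hx' hx, h.non.symm⟩

theorem TwoPaths.head_ne {b b' : V} {a₁ a₂ : List V} (h : TwoPaths b b' a₁ a₂) :
    a₁.headD b' ≠ a₂.headD b' := by
  have h1 := h.disj
  have h2 := h.b₁'
  have h3 := h.b₂'
  have h4 := h.non
  cases a₁ <;> cases a₂ <;> simp at * <;> tauto

theorem eq_nil_of_mem_edgesL {b b' : V} {a : List V} (hb : b ≠ b') (h1 : b ∉ a) (h2 : b' ∉ a)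
    (h : s(b, b') ∈ edgesL (b :: (a ++ [b']))) : a = [] := by
  cases a with
  | nil => rfl
  | cons x a =>
    simp only [List.cons_append, edgesL_cons_cons, List.mem_cons] at h
    rcases h with h | h
    · rcases Sym2.eq_iff.1 h with h | h
      · simp [h.2] at h2
      · exact absurd h.2.symm hb
    · have := (mem_of_mem_edgesL h).1
      simp at this h1
      tauto

theorem TwoPaths.edges_disj {b b' : V} {a₁ a₂ : List V} (h : TwoPaths b b' a₁ a₂)
    {H : SimpleGraph V} (h₁ : (b :: (a₁ ++ [b'])).IsChain H.Adj) {d : Sym2 V}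
    (hd₁ : d ∈ edgesL (b :: (a₁ ++ [b']))) (hd₂ : d ∈ edgesL (b :: (a₂ ++ [b']))) : False := by
  have hadj := isChain_iff_edgesL.1 h₁ d hd₁
  induction d with | _ x y
  have hxy : x ≠ y := H.ne_of_adj hadj
  have m1 := mem_of_mem_edgesL hd₁
  have m2 := mem_of_mem_edgesL hd₂
  have key : ∀ x, x ∈ b :: (a₁ ++ [b']) → x ∈ b :: (a₂ ++ [b']) → x = b ∨ x = b' := by
    intro x hx hx'
    simp at hx hx'
    have := h.disj x
    tauto
  have hs : s(x, y) = s(b, b') := by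
    rcases key x m1.1 m2.1 with rfl | rfl <;> rcases key y m1.2 m2.2 with rfl | rfl
    · exact absurd rfl hxy
    · rfl
    · exact Sym2.eq_swap
    · exact absurd rfl hxy
  rw [hs] at hd₁ hd₂
  have e1 := eq_nil_of_mem_edgesL h.ne h.b₁ h.b₁' hd₁
  have e2 := eq_nil_of_mem_edgesL h.ne h.b₂ h.b₂' hd₂
  exact h.non.elim (· e1) (· e2)

theorem TwoPaths.edge_notMem {b b' : V} {a₁ a₂ a₃ : List V} (h12 : TwoPaths b b' a₁ a₂)
    (h13 : TwoPaths b b' a₁ a₃)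
    {H : SimpleGraph V} (h₁ : (b :: (a₁ ++ [b'])).IsChain H.Adj) {d : Sym2 V}
    (hd₁ : d ∈ edgesL (b :: (a₁ ++ [b']))) : d ∉ cedges (cyc2 b b' a₂ a₃) := fun h => by
  rcases mem_cedges_cyc2.1 h with h | h
  · exact h12.edges_disj h₁ hd₁ h
  · exact h13.edges_disj h₁ hd₁ h

theorem TwoPaths.off {b b' : V} {a₁ a₂ a₃ : List V} (h12 : TwoPaths b b' a₁ a₂)
    (h13 : TwoPaths b b' a₁ a₃) : ∀ x ∈ a₁, x ∉ cyc2 b b' a₂ a₃ := by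
  intro x hx h
  rcases mem_cyc2.1 h with rfl | rfl | h | h
  · exact h12.b₁ hx
  · exact h12.b₁' hx
  · exact h12.disj x hx h
  · exact h13.disj x hx h

/-- Parity of the cycle `a₂ ∪ a₃` at the path `a₁`. -/
def pin (S : ParSys G) (b b' : V) (a₂ a₃ a₁ : List V) : ZMod 2 :=
  csum S.w (cyc2 b b' a₂ a₃) s(b, a₁.headD b')

theorem pin_eq (S : ParSys G) {b b' : V} {a₁ a₂ a₃ : List V} (h12 : TwoPaths b b' a₁ a₂)
    (h13 : TwoPaths b b' a₁ a₃) (h₁ : (b :: (a₁ ++ [b'])).IsChain G.Adj)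
    (h₂ : (b :: (a₂ ++ [b'])).IsChain G.Adj) (h₃ : (b :: (a₃ ++ [b'])).IsChain G.Adj)
    {d : Sym2 V} (hd : d ∈ edgesL (b :: (a₁ ++ [b']))) :
    csum S.w (cyc2 b b' a₂ a₃) d = pin S b b' a₂ a₃ a₁ :=
  S.csum_path (closedIn_cyc2 h₂ h₃) (h12.off h13) h₁ d hd

theorem pin_eq_vertex (S : ParSys G) {b b' : V} {a₁ a₂ a₃ : List V} (h12 : TwoPaths b b' a₁ a₂)
    (h13 : TwoPaths b b' a₁ a₃) (h₁ : (b :: (a₁ ++ [b'])).IsChain G.Adj)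
    (h₂ : (b :: (a₂ ++ [b'])).IsChain G.Adj) (h₃ : (b :: (a₃ ++ [b'])).IsChain G.Adj)
    {x : V} (hx : x ∈ a₁) {d : Sym2 V} (hd : d ∈ G.edgeSet) (hxd : x ∈ d) :
    csum S.w (cyc2 b b' a₂ a₃) d = pin S b b' a₂ a₃ a₁ := by
  obtain ⟨y, hy⟩ := exists_mem_edgesL (b := b) (b' := b') (x := x) (a := a₁) (by simp [hx])
  rw [← pin_eq S h12 h13 h₁ h₂ h₃ hy]
  exact S.csum_prop' (closedIn_cyc2 h₂ h₃) (h12.off h13 x hx) hd (isChain_iff_edgesL.1 h₁ _ hy)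
    hxd (by simp)

theorem zmod2_ne_zero {a : ZMod 2} : a ≠ 0 ↔ a = 1 := by revert a; decide

/-- Exactly one of the three paths of a theta lies inside the cycle of the other two. -/
theorem theta_pin (S : ParSys G) {b b' : V} {a₁ a₂ a₃ : List V} (h12 : TwoPaths b b' a₁ a₂)
    (h13 : TwoPaths b b' a₁ a₃) (h23 : TwoPaths b b' a₂ a₃)
    (h₁ : (b :: (a₁ ++ [b'])).IsChain G.Adj)
    (h₂ : (b :: (a₂ ++ [b'])).IsChain G.Adj) (h₃ : (b :: (a₃ ++ [b'])).IsChain G.Adj) :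
    (pin S b b' a₂ a₃ a₁ = 1 ∧ pin S b b' a₁ a₃ a₂ = 0 ∧ pin S b b' a₁ a₂ a₃ = 0) ∨
    (pin S b b' a₂ a₃ a₁ = 0 ∧ pin S b b' a₁ a₃ a₂ = 1 ∧ pin S b b' a₁ a₂ a₃ = 0) ∨
    (pin S b b' a₂ a₃ a₁ = 0 ∧ pin S b b' a₁ a₃ a₂ = 0 ∧ pin S b b' a₁ a₂ a₃ = 1) := by
  have hs : pin S b b' a₂ a₃ a₁ + pin S b b' a₁ a₃ a₂ + pin S b b' a₁ a₂ a₃ = 1 := by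
    have := S.theta b b' a₁ a₂ a₃ h12.ne h₁ h₂ h₃ h12.b₁ h12.b₂ h13.b₂ h12.head_ne h13.head_ne
      h23.head_ne
    simpa only [pin, csum_cyc2] using this
  have hn : pin S b b' a₂ a₃ a₁ = 0 ∨ pin S b b' a₁ a₃ a₂ = 0 ∨ pin S b b' a₁ a₂ a₃ = 0 := by
    obtain ⟨e, he, hout⟩ := S.outer {d | d ∈ edgesL (b :: (a₁ ++ [b'])) ∨
        d ∈ edgesL (b :: (a₂ ++ [b'])) ∨ d ∈ edgesL (b :: (a₃ ++ [b']))} (by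
          rintro d (hd | hd | hd)
          · exact isChain_iff_edgesL.1 h₁ d hd
          · exact isChain_iff_edgesL.1 h₂ d hd
          · exact isChain_iff_edgesL.1 h₃ d hd) ⟨_, Or.inl (head_mem_edgesL b b' a₁)⟩
    rcases he with he | he | he
    · left
      rw [← pin_eq S h12 h13 h₁ h₂ h₃ he]
      refine hout b _ (isChain_iff_edgesL.2 (closedIn_cyc2 h₂ h₃)) fun d hd => ⟨?_, ?_⟩
      · exact Or.inr (mem_cedges_cyc2.1 hd)
      · rintro rfl
        exact h12.edge_notMem h13 h₁ he hd
    · right; left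
      rw [← pin_eq S h12.symm h23 h₂ h₁ h₃ he]
      refine hout b _ (isChain_iff_edgesL.2 (closedIn_cyc2 h₁ h₃)) fun d hd => ⟨?_, ?_⟩
      · exact (mem_cedges_cyc2.1 hd).elim Or.inl fun h => Or.inr (Or.inr h)
      · rintro rfl
        exact h12.symm.edge_notMem h23 h₂ he hd
    · right; right
      rw [← pin_eq S h13.symm h23.symm h₃ h₁ h₂ he]
      refine hout b _ (isChain_iff_edgesL.2 (closedIn_cyc2 h₁ h₂)) fun d hd => ⟨?_, ?_⟩
      · exact (mem_cedges_cyc2.1 hd).elim Or.inl fun h => Or.inr (Or.inl h)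
      · rintro rfl
        exact h13.symm.edge_notMem h23.symm h₃ he hd
  generalize pin S b b' a₂ a₃ a₁ = p at *
  generalize pin S b b' a₁ a₃ a₂ = q at *
  generalize pin S b b' a₁ a₂ a₃ = r at *
  revert p q r; decide

/-- If `a₁` is inside `a₂ ∪ q`, `r` is inside `a₁ ∪ a₂`, `q` is outside, then `r` is inside
`a₂ ∪ q`. -/
theorem pin_trans (S : ParSys G) {b b' : V} {a₁ a₂ q r : List V} (h12 : TwoPaths b b' a₁ a₂)
    (h1q : TwoPaths b b' a₁ q) (h1r : TwoPaths b b' a₁ r)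
    (h2r : TwoPaths b b' a₂ r) (hqr : TwoPaths b b' q r)
    (h₁ : (b :: (a₁ ++ [b'])).IsChain G.Adj)
    (h₂ : (b :: (a₂ ++ [b'])).IsChain G.Adj) (hq : (b :: (q ++ [b'])).IsChain G.Adj)
    (hr : (b :: (r ++ [b'])).IsChain G.Adj) (e1 : pin S b b' a₁ a₂ r = 1)
    (e2 : pin S b b' a₂ q a₁ = 1) : pin S b b' a₂ q r = 1 := by
  have t2 := theta_pin S h12 h1r h2r h₁ h₂ hr
  have t3 := theta_pin S h1q h1r hqr h₁ hq hr
  simp only [pin, csum_cyc2] at *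
  generalize psum S.w (b :: (a₁ ++ [b'])) s(b, r.headD b') = x1r at *
  generalize psum S.w (b :: (a₂ ++ [b'])) s(b, r.headD b') = x2r at *
  generalize psum S.w (b :: (q ++ [b'])) s(b, r.headD b') = xqr at *
  generalize psum S.w (b :: (a₂ ++ [b'])) s(b, a₁.headD b') = x21 at *
  generalize psum S.w (b :: (q ++ [b'])) s(b, a₁.headD b') = xq1 at *
  generalize psum S.w (b :: (r ++ [b'])) s(b, a₁.headD b') = xr1 at *
  clear h12 h1q h1r h2r hqr h₁ h₂ hq hr
  have c1 : x21 + xr1 = 0 := by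
    rcases t2 with h | h | h
    · rw [e1] at h; simp at h
    · exact h.1
    · exact h.1
  have c2 : x1r + xqr = 1 → xq1 + xr1 = 0 := by
    intro h1
    rcases t3 with h | h | h
    · rw [h1] at h; simp at h
    · exact h.1
    · exact h.1
  clear t2 t3
  revert c2 c1 e2 e1
  revert x1r x2r xqr x21 xq1 xr1
  decide

theorem exists_path {H : SimpleGraph V} {a b : V} (h : H.Reachable a b) :
    ∃ l : List V, l.IsChain H.Adj ∧ l.Nodup ∧ l.head? = some a ∧ l.getLast? = some b := by
  classical
  obtain ⟨p⟩ := h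
  refine ⟨p.toPath.1.support, p.toPath.1.isChain_adj_support, p.toPath.2.support_nodup, ?_, ?_⟩
  · rw [← SimpleGraph.Walk.cons_tail_support]; rfl
  · rw [List.getLast?_eq_some_getLast (by simp), SimpleGraph.Walk.getLast_support]

theorem exists_path_of_ne {H : SimpleGraph V} {a b : V} (h : H.Reachable a b) (hab : a ≠ b) :
    ∃ r : List V, (a :: (r ++ [b])).IsChain H.Adj ∧ (a :: (r ++ [b])).Nodup := by
  obtain ⟨l, h1, h2, h3, h4⟩ := exists_path h
  obtain ⟨t, rfl⟩ := List.head?_eq_some_iff.1 h3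
  rcases List.eq_nil_or_concat t with rfl | ⟨r, c, rfl⟩
  · simp at h4; exact absurd h4 hab
  · have : c = b := by
      rw [List.concat_eq_append, ← List.cons_append, List.getLast?_append] at h4
      simpa using h4
    subst this
    exact ⟨r, by simpa using h1, by simpa using h2⟩

/-- No set of vertices meeting some edges but not all is attached through at most one vertex. -/
def NoSep (H : SimpleGraph V) : Prop :=
  ∀ (K : Set V) (c : V), c ∉ K → (∀ x ∈ K, ∀ y, H.Adj x y → y ∈ K ∨ y = c) →
    (∃ x ∈ K, ∃ y, H.Adj x y) → (∃ x y, H.Adj x y ∧ x ∉ K ∧ y ∉ K) → False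

theorem ear_of (S : ParSys G) {H : SimpleGraph V} (hH : H ≤ G) (hS : NoSep H) {M : Set V}
    (hM : ∃ x ∈ M, ∃ y ∈ M, H.Adj x y) {g : Sym2 V} (hg : g ∈ H.edgeSet) :
    ∃ (b b' : V) (r : List V), b ∈ M ∧ b' ∈ M ∧ b ≠ b' ∧ (∀ x ∈ r, x ∉ M) ∧ r.Nodup ∧
      (b :: (r ++ [b'])).IsChain H.Adj ∧ (r = [] → g = s(b, b')) ∧
      ∀ z, ClosedIn G z → (∀ x ∈ z, x ∈ M) →
        ∀ d ∈ edgesL (b :: (r ++ [b'])), csum S.w z d = csum S.w z g := by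
  by_cases hgM : ∀ x ∈ g, x ∈ M
  · induction g with | _ b b'
    refine ⟨b, b', [], hgM b (by simp), hgM b' (by simp), H.ne_of_adj hg, by simp, by simp,
      by simpa using hg, fun _ => rfl, fun z _ _ d hd => ?_⟩
    simp at hd
    rw [hd]
  push Not at hgM
  obtain ⟨x, hxg, hxM⟩ := hgM
  let HM : SimpleGraph V :=
    { Adj := fun a b => H.Adj a b ∧ a ∉ M ∧ b ∉ M
      symm := ⟨fun a b h => ⟨h.1.symm, h.2.2, h.2.1⟩⟩
      loopless := ⟨fun a h => H.loopless.irrefl a h.1⟩ }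
  have hKM : ∀ y, HM.Reachable x y → y ∉ M := by
    clear hxg
    rintro y ⟨p⟩
    induction p with
    | nil => exact hxM
    | cons h p ih => exact ih h.2.2
  have hcs : ∀ z, ClosedIn G z → (∀ x ∈ z, x ∈ M) → ∀ y, HM.Reachable x y → ∀ d ∈ H.edgeSet,
      y ∈ d → csum S.w z d = csum S.w z g := by
    intro z hz hzM y hy
    have := (SimpleGraph.reachable_iff_reflTransGen _ _).1 hy
    induction this with
    | refl =>
      exact fun d hd hyd => S.csum_prop' hz (fun h => hxM (hzM _ h))
        (SimpleGraph.edgeSet_mono hH hd) (SimpleGraph.edgeSet_mono hH hg) hyd hxg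
    | @tail b c h1 h2 ih =>
      intro d hd hcd
      rw [← ih ((SimpleGraph.reachable_iff_reflTransGen _ _).2 h1) s(b, c) h2.1 (by simp)]
      exact S.csum_prop' hz (fun h => h2.2.2 (hzM _ h)) (SimpleGraph.edgeSet_mono hH hd)
        (SimpleGraph.edgeSet_mono hH h2.1) hcd (by simp)
  have key : ∀ c ∈ M, ∃ y, HM.Reachable x y ∧ ∃ b ∈ M, b ≠ c ∧ H.Adj y b := by
    intro c hc
    by_contra hcon
    push Not at hcon
    refine hS {y | HM.Reachable x y} c (fun h => hKM c h hc) ?_ ?_ ?_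
    · intro y hy y' hyy'
      by_cases hy' : y' ∈ M
      · right
        by_contra hne
        exact hcon y hy y' hy' hne hyy'
      · left
        exact SimpleGraph.Reachable.trans hy (SimpleGraph.Adj.reachable (G := HM)
          ⟨hyy', hKM y hy, hy'⟩)
    · obtain ⟨y, rfl⟩ := hxg
      exact ⟨x, SimpleGraph.Reachable.refl _, y, hg⟩
    · obtain ⟨u, hu, v, hv, huv⟩ := hM
      exact ⟨u, v, huv, fun h => hKM u h hu, fun h => hKM v h hv⟩
  obtain ⟨u, hu, -⟩ := hM
  obtain ⟨y, hy, b, hb, -, hyb⟩ := key u hu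
  obtain ⟨y', hy', b', hb', hbb', hyb'⟩ := key b hb
  obtain ⟨r, h1, h2, h3, h4⟩ := exists_path (hy.symm.trans hy')
  have hr : ∀ v ∈ r, HM.Reachable x v := by
    obtain ⟨t, rfl⟩ := List.head?_eq_some_iff.1 h3
    clear h2 h3 h4 hyb
    induction t generalizing y with
    | nil => simpa using hy
    | cons w t ih =>
      rw [List.isChain_cons_cons] at h1
      have hw := hy.trans (SimpleGraph.Adj.reachable h1.1)
      have := ih w hw h1.2
      simpa using ⟨hy, by simpa using this⟩
  have hch : (b :: (r ++ [b'])).IsChain H.Adj := by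
    obtain ⟨t, rfl⟩ := List.head?_eq_some_iff.1 h3
    have h5 : (y :: t).IsChain H.Adj := h1.imp fun _ _ h => h.1
    rw [List.cons_append, List.isChain_cons_cons]
    refine ⟨hyb.symm, ?_⟩
    rw [← List.cons_append, List.isChain_append]
    refine ⟨h5, by simp, ?_⟩
    rw [h4]
    simpa using hyb'
  refine ⟨b, b', r, hb, hb', hbb'.symm, fun v hv => hKM v (hr v hv), h2, hch, ?_, ?_⟩
  · rintro rfl; simp at h3
  · intro z hz hzM d hd
    have hdH := isChain_iff_edgesL.1 hch d hd
    have : ∃ v ∈ d, v ∈ r := by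
      induction d with | _ v w
      by_contra hcon
      push Not at hcon
      have hv := hcon v (by simp)
      have hw := hcon w (by simp)
      have hm := mem_of_mem_edgesL hd
      simp [hv, hw] at hm
      have hne : v ≠ w := H.ne_of_adj hdH
      have hbr : b ∉ r := fun h => hKM b (hr b h) hb
      have hbr' : b' ∉ r := fun h => hKM b' (hr b' h) hb'
      have : s(v, w) = s(b, b') := by
        rcases hm with ⟨rfl | rfl, rfl | rfl⟩
        · exact absurd rfl hne
        · rfl
        · exact Sym2.eq_swap
        · exact absurd rfl hne
      rw [this] at hd
      rw [eq_nil_of_mem_edgesL hbb'.symm hbr hbr' hd] at h3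
      simp at h3
    obtain ⟨v, hvd, hvr⟩ := this
    exact hcs z hz hzM v (hr v hvr) d hdH hvd

theorem exists_isCyc {H : SimpleGraph V} (hS : NoSep H) {e e' : Sym2 V} (he : e ∈ H.edgeSet)
    (he' : e' ∈ H.edgeSet) (hne : e' ≠ e) : ∃ C, IsCyc H C := by
  induction e with | _ u v
  set H' := H.deleteEdges {s(u, v)} with hH'
  have hadj : ∀ {x y}, H'.Adj x y ↔ H.Adj x y ∧ s(x, y) ≠ s(u, v) := by
    intro x y; simp [hH', SimpleGraph.deleteEdges_adj]
  by_cases hr : H'.Reachable u v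
  · obtain ⟨r, h1, h2⟩ := exists_path_of_ne hr (H.ne_of_adj he)
    refine ⟨u :: (r ++ [v]), isCyc_iff.2 ⟨h2, ?_, ?_⟩⟩
    · cases r with
      | nil =>
        simp at h1
        exact absurd rfl (hadj.1 h1).2
      | cons x r => simp
    · have : cedges (u :: (r ++ [v])) = edgesL (u :: (r ++ [v])) ++ [s(v, u)] := by
        have : u :: (r ++ [v]) ++ [u] = (u :: r) ++ v :: [u] := by simp
        rw [cedges, this, edgesL_append]
        simp
      rw [this]
      intro d hd
      rw [List.mem_append] at hd
      rcases hd with hd | hd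
      · have := isChain_iff_edgesL.1 h1 d hd
        rw [hH', SimpleGraph.edgeSet_deleteEdges] at this
        exact this.1
      · simp at hd
        rw [hd, Sym2.eq_swap]
        exact he
  · exfalso
    have key : ∀ u' v', s(u', v') = s(u, v) → ¬ H'.Reachable u' v' →
        ∃ x y, s(x, y) = e' ∧ H'.Reachable v' x ∧ H'.Reachable v' y := by
      intro u' v' huv hr'
      by_contra hcon
      refine hS {y | H'.Reachable v' y} u' (fun h => hr' h.symm) ?_ ?_ ?_
      · intro x hx y hxy
        by_cases hs : s(x, y) = s(u, v)
        · rw [← huv] at hs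
          rcases Sym2.eq_iff.1 hs with ⟨rfl, rfl⟩ | ⟨rfl, rfl⟩
          · exact absurd hx.symm hr'
          · exact Or.inr rfl
        · exact Or.inl (hx.trans (SimpleGraph.Adj.reachable (hadj.2 ⟨hxy, hs⟩)))
      · refine ⟨v', SimpleGraph.Reachable.refl _, u', ?_⟩
        rw [← SimpleGraph.mem_edgeSet, Sym2.eq_swap, huv]
        exact he
      · induction e' with | _ x y
        have hxy : H'.Adj x y := hadj.2 ⟨he', hne⟩
        refine ⟨x, y, he', fun hx => ?_, fun hx => ?_⟩
        · exact hcon ⟨x, y, rfl, hx, hx.trans hxy.reachable⟩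
        · exact hcon ⟨x, y, rfl, hx.trans hxy.symm.reachable, hx⟩
    obtain ⟨x, y, rfl, h1, h2⟩ := key u v rfl hr
    obtain ⟨x', y', hs, h1', h2'⟩ := key v u Sym2.eq_swap (fun h => hr h.symm)
    rcases Sym2.eq_iff.1 hs with ⟨rfl, rfl⟩ | ⟨rfl, rfl⟩
    · exact hr (h1'.trans h1.symm)
    · exact hr (h1'.trans h2.symm)

theorem exists_append_of_isRotated {l l' : List V} (h : l ~r l') :
    ∃ l₁ l₂, l = l₁ ++ l₂ ∧ l' = l₂ ++ l₁ := by
  obtain ⟨n, rfl⟩ := h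
  exact ⟨_, _, (List.take_append_drop (n % l.length) l).symm,
    List.rotate_eq_drop_append_take_mod⟩

theorem mem_cedges_of_isRotated {l l' : List V} (h : l ~r l') {d : Sym2 V} :
    d ∈ cedges l ↔ d ∈ cedges l' := by
  obtain ⟨l₁, l₂, rfl, rfl⟩ := exists_append_of_isRotated h
  exact (cedges_append_perm l₁ l₂).mem_iff

theorem csum_of_isRotated (w : Sym2 V → Sym2 V → ZMod 2) {l l' : List V} (h : l ~r l')
    (e : Sym2 V) : csum w l e = csum w l' e := by
  obtain ⟨l₁, l₂, rfl, rfl⟩ := exists_append_of_isRotated h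
  exact csum_append_comm w l₁ l₂ e

theorem IsCyc.isRotated {H : SimpleGraph V} {l l' : List V} (hl : IsCyc H l) (h : l ~r l') :
    IsCyc H l' := by
  obtain ⟨l₁, l₂, rfl, rfl⟩ := exists_append_of_isRotated h
  exact hl.rotate

theorem exists_isRotated_cyc2 {C : List V} {b b' : V} (hb : b ∈ C) (hb' : b' ∈ C) (hne : b ≠ b') :
    ∃ a₁ a₂, C ~r cyc2 b b' a₁ a₂ := by
  obtain ⟨l₁, l₂, rfl⟩ := List.append_of_mem hb
  have h1 : (l₁ ++ b :: l₂) ~r (b :: l₂ ++ l₁) := List.isRotated_append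
  have h2 : b' ∈ l₂ ++ l₁ := by simp at hb' ⊢; tauto
  obtain ⟨a, a', h⟩ := List.append_of_mem h2
  refine ⟨a, a'.reverse, h1.trans ?_⟩
  rw [List.cons_append, h, cyc2, List.reverse_reverse]

theorem IsCyc.twoPaths {H : SimpleGraph V} {b b' : V} {a₁ a₂ : List V}
    (h : IsCyc H (cyc2 b b' a₁ a₂)) : TwoPaths b b' a₁ a₂ := by
  rw [isCyc_iff] at h
  obtain ⟨h1, h2, -⟩ := h
  simp [cyc2, List.nodup_append] at h1
  refine ⟨by tauto, by tauto, by tauto, ?_, by tauto, ?_, ?_⟩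
  · intro hb
    have := h1.2.2.2 b' hb
    tauto
  · intro x hx hx'
    have := (h1.2.2.2 x hx).2 x hx'
    tauto
  · by_contra hcon
    push Not at hcon
    simp [cyc2, hcon.1, hcon.2] at h2

theorem IsCyc.chains {H : SimpleGraph V} {b b' : V} {a₁ a₂ : List V}
    (h : IsCyc H (cyc2 b b' a₁ a₂)) : (b :: (a₁ ++ [b'])).IsChain H.Adj ∧
      (b :: (a₂ ++ [b'])).IsChain H.Adj ∧ a₁.Nodup ∧ a₂.Nodup := by
  have h' := isCyc_iff.1 h
  refine ⟨isChain_iff_edgesL.2 fun d hd => h.closedIn d (mem_cedges_cyc2.2 (Or.inl hd)),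
    isChain_iff_edgesL.2 fun d hd => h.closedIn d (mem_cedges_cyc2.2 (Or.inr hd)), ?_, ?_⟩
  · have := h'.1; simp [cyc2, List.nodup_append] at this; tauto
  · have := h'.1; simp [cyc2, List.nodup_append] at this; tauto

theorem TwoPaths.isCyc {H : SimpleGraph V} {b b' : V} {a₁ a₂ : List V} (h : TwoPaths b b' a₁ a₂)
    (h₁ : (b :: (a₁ ++ [b'])).IsChain H.Adj) (h₂ : (b :: (a₂ ++ [b'])).IsChain H.Adj)
    (n₁ : a₁.Nodup) (n₂ : a₂.Nodup) : IsCyc H (cyc2 b b' a₁ a₂) := by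
  refine isCyc_iff.2 ⟨?_, ?_, closedIn_cyc2 h₁ h₂⟩
  · simp only [cyc2, List.nodup_cons, List.mem_append, List.mem_cons, List.mem_reverse,
      List.nodup_append, List.nodup_reverse]
    refine ⟨fun hb => ?_, n₁, ⟨h.b₂', n₂⟩, ?_⟩
    · rcases hb with hb | hb | hb
      · exact h.b₁ hb
      · exact h.ne hb
      · exact h.b₂ hb
    · rintro x hx y (rfl | hy) rfl
      · exact h.b₁' hx
      · exact h.disj x hx hy
  · have := h.non
    rcases a₁ with _ | ⟨x, a₁⟩ <;> rcases a₂ with _ | ⟨y, a₂⟩ <;> simp [cyc2] at * <;> omega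

theorem cyc2_swap_mem {b b' : V} {a₁ a₂ : List V} {d : Sym2 V} :
    d ∈ cedges (cyc2 b b' a₁ a₂) ↔ d ∈ cedges (cyc2 b b' a₂ a₁) := by
  rw [mem_cedges_cyc2, mem_cedges_cyc2, or_comm]

theorem csum_cyc2_swap (w : Sym2 V → Sym2 V → ZMod 2) (b b' : V) (a₁ a₂ : List V) (e : Sym2 V) :
    csum w (cyc2 b b' a₁ a₂) e = csum w (cyc2 b b' a₂ a₁) e := by
  rw [csum_cyc2, csum_cyc2, add_comm]

theorem csum_cyc2_add (w : Sym2 V → Sym2 V → ZMod 2) (b b' : V) (a₁ a₂ a₃ : List V)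
    (e : Sym2 V) : csum w (cyc2 b b' a₁ a₂) e =
      csum w (cyc2 b b' a₁ a₃) e + csum w (cyc2 b b' a₂ a₃) e := by
  simp only [csum_cyc2]
  generalize psum w _ e = x
  generalize psum w _ e = y
  generalize psum w _ e = z
  revert x y z; decide

theorem mem_edgesL_reverse_path {b b' : V} {r : List V} {d : Sym2 V} :
    d ∈ edgesL (b :: (r ++ [b'])) ↔ d ∈ edgesL (b' :: (r.reverse ++ [b])) := by
  have : b' :: (r.reverse ++ [b]) = (b :: (r ++ [b'])).reverse := by simp
  rw [this, edgesL_reverse, List.mem_reverse]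

theorem isChain_reverse_path {H : SimpleGraph V} {b b' : V} {r : List V} :
    (b :: (r ++ [b'])).IsChain H.Adj ↔ (b' :: (r.reverse ++ [b])).IsChain H.Adj := by
  rw [isChain_iff_edgesL, isChain_iff_edgesL]
  simp only [mem_edgesL_reverse_path (b' := b') (b := b)]

/-- The edges of `H` on or inside the cycle `C`. -/
def within (S : ParSys G) (H : SimpleGraph V) (C : List V) : Set (Sym2 V) :=
  {d | d ∈ H.edgeSet ∧ (d ∈ cedges C ∨ csum S.w C d = 1)}

theorem within_ssubset (S : ParSys G) {H : SimpleGraph V} (hH : H ≤ G) (hS : NoSep H) {b b' : V}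
    {a₁ a₂ q : List V} (hC : IsCyc H (cyc2 b b' a₁ a₂)) (h1q : TwoPaths b b' a₁ q)
    (h2q : TwoPaths b b' a₂ q) (hq : (b :: (q ++ [b'])).IsChain H.Adj)
    (p1 : pin S b b' a₂ q a₁ = 1) :
    within S H (cyc2 b b' a₁ a₂) ⊂ within S H (cyc2 b b' a₂ q) := by
  have h12 := hC.twoPaths
  obtain ⟨h₁, h₂, -, -⟩ := hC.chains
  have toG : ∀ {l : List V}, l.IsChain H.Adj → l.IsChain G.Adj := fun h => h.imp fun _ _ h => hH h
  have t := theta_pin S h12 h1q h2q (toG h₁) (toG h₂) (toG hq)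
  obtain ⟨p2, pq⟩ : pin S b b' a₁ q a₂ = 0 ∧ pin S b b' a₁ a₂ q = 0 := by
    rw [p1] at t; simpa using t
  clear t
  rw [Set.ssubset_iff_of_subset]
  · refine ⟨s(b, q.headD b'), ⟨isChain_iff_edgesL.1 hq _ (head_mem_edgesL _ _ _), Or.inl ?_⟩, ?_⟩
    · exact mem_cedges_cyc2.2 (Or.inr (head_mem_edgesL _ _ _))
    · rintro ⟨-, h | h⟩
      · exact h1q.symm.edge_notMem h2q.symm hq (head_mem_edgesL _ _ _) h
      · have : csum S.w (cyc2 b b' a₁ a₂) s(b, q.headD b') = 0 := pq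
        rw [this] at h; simp at h
  rintro g ⟨hg, hgC⟩
  refine ⟨hg, ?_⟩
  rcases hgC with hgC | hgC
  · rcases mem_cedges_cyc2.1 hgC with h | h
    · right
      rw [pin_eq S h12 h1q (toG h₁) (toG h₂) (toG hq) h, p1]
    · exact Or.inl (mem_cedges_cyc2.2 (Or.inl h))
  by_contra hcon
  push Not at hcon
  obtain ⟨hg', hg0⟩ := hcon
  replace hg0 : csum S.w (cyc2 b b' a₂ q) g = 0 := by
    by_contra h; exact hg0 (zmod2_ne_zero.1 h)
  have hgC' : g ∉ cedges (cyc2 b b' a₁ a₂) := by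
    intro h
    rcases mem_cedges_cyc2.1 h with h | h
    · rw [pin_eq S h12 h1q (toG h₁) (toG h₂) (toG hq) h, p1] at hg0
      simp at hg0
    · exact hg' (mem_cedges_cyc2.2 (Or.inl h))
  have c12 := closedIn_cyc2 (toG h₁) (toG h₂)
  have c1q := closedIn_cyc2 (toG h₁) (toG hq)
  have c2q := closedIn_cyc2 (toG h₂) (toG hq)
  have hM : ∃ x ∈ {x | x = b ∨ x = b' ∨ x ∈ a₁ ∨ x ∈ a₂ ∨ x ∈ q},
      ∃ y ∈ {x | x = b ∨ x = b' ∨ x ∈ a₁ ∨ x ∈ a₂ ∨ x ∈ q}, H.Adj x y := by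
    have he := isChain_iff_edgesL.1 h₁ _ (head_mem_edgesL b b' a₁)
    refine ⟨b, Or.inl rfl, _, ?_, he⟩
    cases a₁ <;> simp
  obtain ⟨c, c', r, hc, hc', hcc', hr, hrn, hch, hr0, hcs⟩ := ear_of S hH hS hM hg
  have ear : ∀ d ∈ edgesL (c :: (r ++ [c'])), csum S.w (cyc2 b b' a₁ a₂) d = 1 ∧
      csum S.w (cyc2 b b' a₂ q) d = 0 := by
    intro d hd
    rw [hcs _ c12 (by intro x hx; rw [mem_cyc2] at hx; clear * - hx; simp; tauto) d hd,
      hcs _ c2q (by intro x hx; rw [mem_cyc2] at hx; clear * - hx; simp; tauto) d hd]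
    exact ⟨hgC, hg0⟩
  have ends : ∀ m, m = c ∨ m = c' → m = b ∨ m = b' := by
    intro m hm
    have hmM : m = b ∨ m = b' ∨ m ∈ a₁ ∨ m ∈ a₂ ∨ m ∈ q := by
      rcases hm with rfl | rfl
      · exact hc
      · exact hc'
    obtain ⟨y, hd⟩ := exists_mem_edgesL (b := c) (b' := c') (x := m) (a := r)
      (by rcases hm with rfl | rfl <;> simp)
    have hdG := isChain_iff_edgesL.1 (toG hch) _ hd
    obtain ⟨e1, e2⟩ := ear _ hd
    rcases hmM with h | h | h | h | h
    · exact Or.inl h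
    · exact Or.inr h
    · rw [pin_eq_vertex S h12 h1q (toG h₁) (toG h₂) (toG hq) h hdG (by simp), p1] at e2
      simp at e2
    · have := pin_eq_vertex S h12.symm h2q (toG h₂) (toG h₁) (toG hq) h hdG (by simp)
      rw [p2] at this
      rw [csum_cyc2_add _ _ _ _ _ q, this, e2] at e1
      simp at e1
    · rw [pin_eq_vertex S h1q.symm h2q.symm (toG hq) (toG h₁) (toG h₂) h hdG (by simp), pq] at e1
      simp at e1
  obtain ⟨r', hr', hch', hr0', hcs'⟩ : ∃ r' : List V, (∀ x ∈ r', ¬ (x = b ∨ x = b' ∨ x ∈ a₁ ∨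
      x ∈ a₂ ∨ x ∈ q)) ∧ (b :: (r' ++ [b'])).IsChain H.Adj ∧ (r' = [] → g = s(b, b')) ∧
      (∀ d ∈ edgesL (b :: (r' ++ [b'])), csum S.w (cyc2 b b' a₁ a₂) d = 1 ∧
      csum S.w (cyc2 b b' a₂ q) d = 0) := by
    rcases ends c (Or.inl rfl) with rfl | rfl <;> rcases ends c' (Or.inr rfl) with rfl | rfl
    · exact absurd rfl hcc'
    · exact ⟨r, hr, hch, hr0, ear⟩
    · refine ⟨r.reverse, by simpa using hr, isChain_reverse_path.1 hch, ?_, ?_⟩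
      · intro h; rw [hr0 (by simpa using h), Sym2.eq_swap]
      · intro d hd; exact ear d (mem_edgesL_reverse_path.2 hd)
    · exact absurd rfl hcc'
  have hbr : b ∉ r' := fun h => hr' b h (Or.inl rfl)
  have hbr' : b' ∉ r' := fun h => hr' b' h (Or.inr (Or.inl rfl))
  have hnil : ∀ a, g ∉ edgesL (b :: (a ++ [b'])) → a ≠ [] ∨ r' ≠ [] := by
    intro a hga
    by_contra hcon
    push Not at hcon
    rw [hr0' hcon.2, hcon.1] at hga
    simp at hga
  have h1r : TwoPaths b b' a₁ r' := ⟨h12.ne, h12.b₁, hbr, h12.b₁', hbr', fun x hx hx' =>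
    hr' x hx' (by clear * - hx; tauto), hnil _ fun h => hgC' (mem_cedges_cyc2.2 (Or.inl h))⟩
  have h2r : TwoPaths b b' a₂ r' := ⟨h12.ne, h12.b₂, hbr, h12.b₂', hbr', fun x hx hx' =>
    hr' x hx' (by clear * - hx; tauto), hnil _ fun h => hgC' (mem_cedges_cyc2.2 (Or.inr h))⟩
  have hqr : TwoPaths b b' q r' := ⟨h12.ne, h2q.b₂, hbr, h2q.b₂', hbr', fun x hx hx' =>
    hr' x hx' (by clear * - hx; tauto), hnil _ fun h => hg' (mem_cedges_cyc2.2 (Or.inr h))⟩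
  have e := hcs' _ (head_mem_edgesL _ _ _)
  have := pin_trans S h12 h1q h1r h2r hqr (toG h₁) (toG h₂) (toG hq) (toG hch') e.1 p1
  rw [pin, e.2] at this
  simp at this

/-- `C` is a cycle of `H` and all other edges of `H` lie inside it. -/
def Bd (S : ParSys G) (H : SimpleGraph V) (C : List V) : Prop :=
  IsCyc H C ∧ ∀ d ∈ H.edgeSet, d ∉ cedges C → csum S.w C d = 1

theorem Bd.isRotated {S : ParSys G} {H : SimpleGraph V} {C C' : List V} (h : Bd S H C)
    (hr : C ~r C') : Bd S H C' :=
  ⟨h.1.isRotated hr, fun d hd hdC => by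
    rw [← csum_of_isRotated S.w hr]
    exact h.2 d hd fun h' => hdC ((mem_cedges_of_isRotated hr).1 h')⟩

theorem Bd.reverse {S : ParSys G} {H : SimpleGraph V} {C : List V} (h : Bd S H C) :
    Bd S H C.reverse :=
  ⟨h.1.reverse, fun d hd hdC => by
    rw [csum_reverse]
    exact h.2 d hd fun h' => hdC ((cedges_reverse_perm C).mem_iff.2 h')⟩

theorem Bd.swap {S : ParSys G} {H : SimpleGraph V} {b b' : V} {a₁ a₂ : List V}
    (h : Bd S H (cyc2 b b' a₁ a₂)) : Bd S H (cyc2 b b' a₂ a₁) := by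
  obtain ⟨h₁, h₂, n₁, n₂⟩ := h.1.chains
  refine ⟨h.1.twoPaths.symm.isCyc h₂ h₁ n₂ n₁, fun d hd hdC => ?_⟩
  rw [csum_cyc2_swap]
  exact h.2 d hd fun h' => hdC (cyc2_swap_mem.1 h')

theorem exists_bd [Finite V] (S : ParSys G) {H : SimpleGraph V} (hH : H ≤ G) (hS : NoSep H)
    (hex : ∃ C, IsCyc H C) : ∃ C, Bd S H C := by
  by_contra hno
  have step : ∀ C, IsCyc H C → ∃ C', IsCyc H C' ∧ within S H C ⊂ within S H C' := by
    intro C hC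
    have : ¬ Bd S H C := fun h => hno ⟨C, h⟩
    simp only [Bd, hC, true_and] at this
    push Not at this
    obtain ⟨e, he, heC, hce⟩ := this
    replace hce : csum S.w C e = 0 := by
      by_contra h; exact hce (zmod2_ne_zero.1 h)
    have hM : ∃ x ∈ {x | x ∈ C}, ∃ y ∈ {x | x ∈ C}, H.Adj x y := by
      have h3 := (isCyc_iff.1 hC).2.1
      cases C with
      | nil => simp at h3
      | cons x t =>
        obtain ⟨y, hy⟩ := exists_mem_cedges (x := x) (l := x :: t) (by simp)
        exact ⟨x, by simp, y, (mem_of_mem_cedges hy).2, hC.closedIn _ hy⟩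
    obtain ⟨b, b', q, hb, hb', hbb', hq, hqn, hch, hq0, hcs⟩ := ear_of S hH hS hM he
    obtain ⟨a₁, a₂, hrot⟩ := exists_isRotated_cyc2 hb hb' hbb'
    have hw : within S H C = within S H (cyc2 b b' a₁ a₂) := by
      ext d
      simp only [within, Set.mem_ofPred_eq, mem_cedges_of_isRotated hrot, csum_of_isRotated S.w hrot]
    have hC2 := hC.isRotated hrot
    have h12 := hC2.twoPaths
    obtain ⟨h₁, h₂, n₁, n₂⟩ := hC2.chains
    have mem : ∀ x, x ∈ C ↔ x = b ∨ x = b' ∨ x ∈ a₁ ∨ x ∈ a₂ := fun x => by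
      rw [hrot.perm.mem_iff, mem_cyc2]
    rw [mem_cedges_of_isRotated hrot, mem_cedges_cyc2] at heC
    push Not at heC
    have non : ∀ a, e ∉ edgesL (b :: (a ++ [b'])) → a ≠ [] ∨ q ≠ [] := by
      intro a ha
      by_contra hcon
      push Not at hcon
      rw [hcon.1, hq0 hcon.2] at ha
      simp at ha
    have h1q : TwoPaths b b' a₁ q := ⟨hbb', h12.b₁, fun h => hq _ h hb, h12.b₁',
      fun h => hq _ h hb', fun x hx hx' => hq x hx' ((mem x).2 (by tauto)), non _ heC.1⟩
    have h2q : TwoPaths b b' a₂ q := ⟨hbb', h12.b₂, fun h => hq _ h hb, h12.b₂',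
      fun h => hq _ h hb', fun x hx hx' => hq x hx' ((mem x).2 (by tauto)), non _ heC.2⟩
    have toG : ∀ {l : List V}, l.IsChain H.Adj → l.IsChain G.Adj :=
      fun h => h.imp fun _ _ h => hH h
    have pq : pin S b b' a₁ a₂ q = 0 := by
      rw [pin, ← csum_of_isRotated S.w hrot, hcs C (hC.mono hH).closedIn (fun _ h => h) _
        (head_mem_edgesL _ _ _), hce]
    rcases theta_pin S h12 h1q h2q (toG h₁) (toG h₂) (toG hch) with h | h | h
    · refine ⟨_, h2q.isCyc h₂ hch n₂ hqn, ?_⟩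
      rw [hw]
      exact within_ssubset S hH hS hC2 h1q h2q hch h.1
    · refine ⟨_, h1q.isCyc h₁ hch n₁ hqn, ?_⟩
      have hw' : within S H C = within S H (cyc2 b b' a₂ a₁) := by
        rw [hw]
        ext d
        simp only [within, Set.mem_ofPred_eq, cyc2_swap_mem (a₁ := a₁), csum_cyc2_swap S.w b b' a₁]
      rw [hw']
      exact within_ssubset S hH hS (h12.symm.isCyc h₂ h₁ n₂ n₁) h2q h1q hch h.2.1
    · rw [pq] at h; simp at h
  have big : ∀ n : ℕ, ∃ C, IsCyc H C ∧ n ≤ (within S H C).ncard := by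
    intro n
    induction n with
    | zero => exact hex.imp fun C hC => ⟨hC, by simp⟩
    | succ n ih =>
      obtain ⟨C, hC, hn⟩ := ih
      obtain ⟨C', hC', hlt⟩ := step C hC
      exact ⟨C', hC', Nat.succ_le_of_lt (hn.trans_lt (Set.ncard_lt_ncard hlt (Set.toFinite _)))⟩
  obtain ⟨C, -, h⟩ := big (H.edgeSet.ncard + 1)
  have := Set.ncard_le_ncard (s := within S H C) (t := H.edgeSet) (fun d hd => hd.1)
    (Set.toFinite _)
  omega

theorem exists_isRotated_cons {C : List V} {v : V} (hv : v ∈ C) : ∃ t, C ~r (v :: t) := by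
  obtain ⟨l₁, l₂, rfl⟩ := List.append_of_mem hv
  exact ⟨l₂ ++ l₁, List.isRotated_append⟩

theorem mem_edgesL_of_mem_cedges {v a b : V} {t : List V} (h : s(a, b) ∈ cedges (v :: t))
    (ha : a ≠ v) (hb : b ≠ v) : s(a, b) ∈ edgesL t := by
  rcases List.eq_nil_or_concat t with rfl | ⟨l, y, rfl⟩
  · simp [cedges] at h
    exact absurd h.1 ha
  · have h1 : cedges (v :: l.concat y) = edgesL ((v :: l) ++ y :: [v]) := by simp [cedges]
    rw [h1, edgesL_append, List.mem_append] at h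
    rcases h with h | h
    · rw [List.concat_eq_append]
      have h2 : v :: l ++ [y] = v :: (l ++ [y]) := rfl
      rw [h2] at h
      cases hl : l ++ [y] with
      | nil => simp at hl
      | cons z l' =>
        rw [hl, edgesL_cons_cons, List.mem_cons] at h
        rcases h with h | h
        · rcases Sym2.eq_iff.1 h with h | h
          · exact absurd h.1 ha
          · exact absurd h.2 hb
        · exact h
    · simp at h
      rcases h with h | h
      · exact absurd h.2 hb
      · exact absurd h.1 ha

theorem exists_potential (f : Sym2 V → ZMod 2) {t : List V} (ht : t.Nodup) :
    ∃ h : V → ZMod 2, ∀ a b, s(a, b) ∈ edgesL t → f s(a, b) = h a + h b := by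
  classical
  induction t with
  | nil => exact ⟨fun _ => 0, by simp⟩
  | cons x t ih =>
    cases t with
    | nil => exact ⟨fun _ => 0, by simp⟩
    | cons y t =>
      obtain ⟨h, hh⟩ := ih ht.of_cons
      have hx : x ∉ y :: t := (List.nodup_cons.1 ht).1
      have hyx : y ≠ x := fun e => hx (by simp [e])
      have h2 : ∀ p q : ZMod 2, p = p + q + q ∧ p = q + (p + q) := by decide
      refine ⟨Function.update h x (f s(x, y) + h y), fun a b hab => ?_⟩
      rw [edgesL_cons_cons, List.mem_cons] at hab
      rcases hab with hab | hab
      · rw [hab]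
        rcases Sym2.eq_iff.1 hab with ⟨rfl, rfl⟩ | ⟨rfl, rfl⟩
        · rw [Function.update_self, Function.update_of_ne hyx]
          exact (h2 _ _).1
        · rw [Function.update_self, Function.update_of_ne hyx]
          exact (h2 _ _).2
      · have hm := mem_of_mem_edgesL hab
        have ha : a ≠ x := fun e => hx (e ▸ hm.1)
        have hb : b ≠ x := fun e => hx (e ▸ hm.2)
        rw [Function.update_of_ne ha, Function.update_of_ne hb]
        exact hh a b hab

theorem psum_segment_aux (S : ParSys G) {H : SimpleGraph V} (hH : H ≤ G) {v : V} {t : List V}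
    (hB : Bd S H (v :: t)) {e : Sym2 V} (he : e ∈ H.edgeSet) (hve : v ∈ e) {h : V → ZMod 2}
    (hh : ∀ a b, s(a, b) ∈ edgesL t → S.w s(a, b) e = h a + h b) (c c' : V) (s : List V)
    (hc : c ∈ t) (hc' : c' ∈ t)
    (hch : (c :: (s ++ [c'])).IsChain H.Adj)
    (hnd : (c :: (s ++ [c'])).Nodup) (hvs : v ∉ s) (hs : ∀ m ∈ s, m ∉ t) :
    psum S.w (c :: (s ++ [c'])) e = h c + h c' := by
  have toG : ∀ {l : List V}, l.IsChain H.Adj → l.IsChain G.Adj := fun h => h.imp fun _ _ h => hH h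
  have hvt : v ∉ t := (List.nodup_cons.1 (isCyc_iff.1 hB.1).1).1
  have hcv : c ≠ v := fun e => hvt (e ▸ hc)
  have hcv' : c' ≠ v := fun e => hvt (e ▸ hc')
  have hne : c ≠ c' := by
    rintro rfl; simp at hnd
  by_cases hedge : s = [] ∧ s(c, c') ∈ cedges (v :: t)
  · obtain ⟨rfl, h1⟩ := hedge
    have := hh c c' (mem_edgesL_of_mem_cedges h1 hcv hcv')
    simpa [psum] using this
  · obtain ⟨a₁, a₂, hrot⟩ := exists_isRotated_cyc2 (C := v :: t) (by simp [hc]) (by simp [hc']) hne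
    have hv : v ∈ cyc2 c c' a₁ a₂ := hrot.perm.mem_iff.1 (by simp)
    have main : ∀ a₁ a₂, Bd S H (cyc2 c c' a₁ a₂) →
        (∀ d, d ∈ cedges (cyc2 c c' a₁ a₂) ↔ d ∈ cedges (v :: t)) →
        (∀ x, x ∈ cyc2 c c' a₁ a₂ → x = v ∨ x ∈ t) → v ∈ a₁ →
        psum S.w (c :: (s ++ [c'])) e = h c + h c' := by
      intro a₁ a₂ hB2 hed hvx hva
      have h12 := hB2.1.twoPaths
      obtain ⟨h₁, h₂, n₁, n₂⟩ := hB2.1.chains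
      have hcs : c ∉ s ∧ c' ∉ s := by
        simp [List.nodup_append] at hnd
        refine ⟨hnd.1.1, fun h => ?_⟩
        have := hnd.2.2 c' h
        tauto
      have hsd : ∀ x, (x ∈ a₁ ∨ x ∈ a₂) → x ∉ s := by
        intro x hx hxs
        rcases hvx x (mem_cyc2.2 (by tauto)) with rfl | h
        · exact hvs hxs
        · exact hs x hxs h
      have non : ∀ a, (∀ d ∈ edgesL (c :: (a ++ [c'])), d ∈ cedges (v :: t)) →
          a ≠ [] ∨ s ≠ [] := by
        intro a ha
        by_contra hcon
        push Not at hcon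
        refine hedge ⟨hcon.2, ha _ ?_⟩
        rw [hcon.1]; simp
      have h1s : TwoPaths c c' a₁ s := ⟨hne, h12.b₁, hcs.1, h12.b₁', hcs.2,
        fun x hx => hsd x (Or.inl hx), non a₁ fun d hd => (hed d).1 (mem_cedges_cyc2.2 (Or.inl hd))⟩
      have h2s : TwoPaths c c' a₂ s := ⟨hne, h12.b₂, hcs.1, h12.b₂', hcs.2,
        fun x hx => hsd x (Or.inr hx), non a₂ fun d hd => (hed d).1 (mem_cedges_cyc2.2 (Or.inr hd))⟩
      have ps : pin S c c' a₁ a₂ s = 1 := hB2.2 _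
        (isChain_iff_edgesL.1 hch _ (head_mem_edgesL _ _ _))
        (h1s.symm.edge_notMem h2s.symm hch (head_mem_edgesL _ _ _))
      have th := theta_pin S h12 h1s h2s (toG h₁) (toG h₂) (toG hch)
      have p1 : pin S c c' a₂ s a₁ = 0 := by
        rcases th with h | h | h
        · rw [ps] at h; simp at h
        · exact h.1
        · exact h.1
      have h0 := pin_eq_vertex S h12 h1s (toG h₁) (toG h₂) (toG hch) hva
        (SimpleGraph.edgeSet_mono hH he) hve
      rw [p1, csum_cyc2] at h0
      have h3 : psum S.w (c :: (a₂ ++ [c'])) e = h c + h c' := by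
        refine telescope (S.w · e) h c a₂ c' fun a b hab => ?_
        have hm := mem_of_mem_edgesL hab
        have hva₂ : v ∉ c :: (a₂ ++ [c']) := by
          simp only [List.mem_cons, List.mem_append, List.mem_nil_iff, or_false]
          rintro (h | h | h)
          · exact hcv h.symm
          · exact h12.disj v hva h
          · exact hcv' h.symm
        refine hh a b (mem_edgesL_of_mem_cedges ((hed _).1 (mem_cedges_cyc2.2 (Or.inr hab))) ?_ ?_)
        · rintro rfl; exact hva₂ hm.1
        · rintro rfl; exact hva₂ hm.2
      rw [← h3]
      exact (zmod2_eq_of_add h0).symm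
    have hx : ∀ x, x ∈ cyc2 c c' a₁ a₂ → x = v ∨ x ∈ t := fun x hx => by
      simpa using hrot.perm.mem_iff.2 hx
    rcases mem_cyc2.1 hv with h | h | h | h
    · exact absurd h.symm hcv
    · exact absurd h.symm hcv'
    · exact main a₁ a₂ (hB.isRotated hrot) (fun d => (mem_cedges_of_isRotated hrot).symm) hx h
    · refine main a₂ a₁ (hB.isRotated hrot).swap (fun d => ?_) (fun x h => hx x ?_) h
      · rw [cyc2_swap_mem]; exact (mem_cedges_of_isRotated hrot).symm
      · rw [mem_cyc2] at *; tauto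

theorem psum_segment (S : ParSys G) {H : SimpleGraph V} (hH : H ≤ G) {v : V} {t : List V}
    (hB : Bd S H (v :: t)) {e : Sym2 V} (he : e ∈ H.edgeSet) (hve : v ∈ e) {h : V → ZMod 2}
    (hh : ∀ a b, s(a, b) ∈ edgesL t → S.w s(a, b) e = h a + h b) (n : ℕ) (s : List V) (c c' : V)
    (hn : s.length ≤ n) (hc : c ∈ t) (hc' : c' ∈ t) (hch : (c :: (s ++ [c'])).IsChain H.Adj)
    (hnd : (c :: (s ++ [c'])).Nodup) (hvs : v ∉ s) :
    psum S.w (c :: (s ++ [c'])) e = h c + h c' := by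
  have toG : ∀ {l : List V}, l.IsChain H.Adj → l.IsChain G.Adj := fun h => h.imp fun _ _ h => hH h
  have hvt : v ∉ t := (List.nodup_cons.1 (isCyc_iff.1 hB.1).1).1
  have hcv : c ≠ v := fun e => hvt (e ▸ hc)
  have hcv' : c' ≠ v := fun e => hvt (e ▸ hc')
  have hne : c ≠ c' := by
    rintro rfl; simp at hnd
  induction n generalizing s c c' with
  | zero =>
    obtain rfl := List.length_eq_zero_iff.1 (Nat.le_zero.1 hn)
    exact psum_segment_aux S hH hB he hve hh c c' [] hc hc' hch hnd hvs (by simp)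
  | succ n ih =>
    by_cases hs : ∃ m ∈ s, m ∈ t
    · obtain ⟨m, hm, hmt⟩ := hs
      obtain ⟨s₁, s₂, rfl⟩ := List.append_of_mem hm
      have e1 : c :: (s₁ ++ m :: s₂ ++ [c']) = (c :: s₁) ++ m :: (s₂ ++ [c']) := by simp
      rw [e1] at hch hnd ⊢
      have hmv : m ≠ v := fun e => hvt (e ▸ hmt)
      have hch1 := hch
      rw [List.isChain_split] at hch
      have hnd1 : (c :: (s₁ ++ [m])).Nodup := by
        refine hnd.sublist ?_
        rw [← List.cons_append]
        exact (List.Sublist.refl (c :: s₁)).append (by simp)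
      have hnd2 : (m :: (s₂ ++ [c'])).Nodup := (List.nodup_append.1 hnd).2.1
      rw [psum_append]
      have i1 := ih s₁ c m (by simp at hn; omega) hc hmt (by simpa using hch.1) hnd1
        (fun h => hvs (by simp [h])) hcv hmv (by rintro rfl; simp at hnd1)
      have i2 := ih s₂ m c' (by simp at hn; omega) hmt hc' hch.2 hnd2
        (fun h => hvs (by simp [h])) hmv hcv' (by rintro rfl; simp at hnd2)
      rw [List.cons_append, i1, i2]
      have : ∀ x y z : ZMod 2, x + y + (y + z) = x + z := by decide
      exact this _ _ _
    · push Not at hs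
      exact psum_segment_aux S hH hB he hve hh c c' s hc hc' hch hnd hvs hs

/-- The vertices of a cycle that contains all other edges inside are outer. -/
theorem Bd.outer {S : ParSys G} {H : SimpleGraph V} (hH : H ≤ G) {C : List V} (hB : Bd S H C)
    {v : V} (hv : v ∈ C) : Outer S H v := by
  intro z hz hvz u hvu
  obtain ⟨t, hrot⟩ := exists_isRotated_cons hv
  replace hB := hB.isRotated hrot
  clear hv hrot C
  have hvt : v ∉ t := (List.nodup_cons.1 (isCyc_iff.1 hB.1).1).1
  by_cases hcc : ∃ c ∈ t, ∃ c' ∈ t, c ≠ c' ∧ c ∈ z ∧ c' ∈ z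
  · obtain ⟨c, hc, c', hc', hne, hcz, hcz'⟩ := hcc
    obtain ⟨s₁, s₂, hr2⟩ := exists_isRotated_cyc2 hcz hcz' hne
    have hz2 := hz.isRotated hr2
    obtain ⟨h₁, h₂, n₁, n₂⟩ := hz2.chains
    have h12 := hz2.twoPaths
    obtain ⟨h, hh⟩ := exists_potential (S.w · s(v, u)) (List.nodup_cons.1 (isCyc_iff.1 hB.1).1).2
    have hvz2 : v ∉ cyc2 c c' s₁ s₂ := fun h => hvz (hr2.perm.mem_iff.2 h)
    rw [mem_cyc2] at hvz2
    push Not at hvz2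
    have nd : ∀ s : List V, s.Nodup → c ∉ s → c' ∉ s → (c :: (s ++ [c'])).Nodup := by
      intro s hs hcs hcs'
      simp only [List.nodup_cons, List.mem_append, List.mem_singleton, not_or, List.nodup_append]
      refine ⟨⟨hcs, hne⟩, hs, by simp, ?_⟩
      rintro x hx y rfl rfl
      exact hcs' hx
    rw [csum_of_isRotated S.w hr2, csum_cyc2,
      psum_segment S hH hB (e := s(v, u)) hvu (by simp) hh _ s₁ c c' le_rfl hc hc' h₁
        (nd _ n₁ h12.b₁ h12.b₁') hvz2.2.2.1,
      psum_segment S hH hB (e := s(v, u)) hvu (by simp) hh _ s₂ c c' le_rfl hc hc' h₂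
        (nd _ n₂ h12.b₂ h12.b₂') hvz2.2.2.2]
    generalize h c + h c' = x
    revert x; decide
  · push Not at hcc
    by_contra hcon
    replace hcon := zmod2_ne_zero.1 hcon
    have hzG := (hz.mono hH).closedIn
    have hzC : ∀ d ∈ cedges z, csum S.w (v :: t) d = 1 := by
      intro d hd
      refine hB.2 d (hz.closedIn d hd) fun hdC => ?_
      have hdH := hz.closedIn d hd
      induction d with | _ x y
      have h1 := mem_of_mem_cedges hd
      have hxv : x ≠ v := by rintro rfl; exact hvz h1.1
      have hyv : y ≠ v := by rintro rfl; exact hvz h1.2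
      have h2 := mem_of_mem_cedges hdC
      simp only [List.mem_cons, hxv, hyv, false_or] at h2
      exact hcc x h2.1 y h2.2 (H.ne_of_adj hdH) h1.1 h1.2
    have hCz : ∀ d ∈ cedges (v :: t), csum S.w z d = 1 := by
      obtain ⟨c₀, t', hrot, ht'⟩ : ∃ c₀ t', (v :: t) ~r (c₀ :: t') ∧ ∀ x ∈ t', x ∉ z := by
        by_cases h : ∃ c₀ ∈ t, c₀ ∈ z
        · obtain ⟨c₀, hc₀, hcz⟩ := h
          obtain ⟨t', hrot⟩ := exists_isRotated_cons (C := v :: t) (v := c₀) (by simp [hc₀])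
          refine ⟨c₀, t', hrot, fun x hx hxz => ?_⟩
          have hnd := (isCyc_iff.1 (hB.isRotated hrot).1).1
          have hxC : x ∈ v :: t := hrot.perm.mem_iff.2 (by simp [hx])
          have hxv : x ≠ v := by rintro rfl; exact hvz hxz
          simp only [List.mem_cons, hxv, false_or] at hxC
          refine hcc c₀ hc₀ x hxC ?_ hcz hxz
          rintro rfl
          exact (List.nodup_cons.1 hnd).1 hx
        · push Not at h
          exact ⟨v, t, List.IsRotated.refl _, h⟩
      have hch : (c₀ :: (t' ++ [c₀])).IsChain G.Adj :=
        isChain_iff_edgesL.2 ((hB.isRotated hrot).1.mono hH).closedIn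
      obtain ⟨y, hy⟩ := exists_mem_cedges (x := v) (l := c₀ :: t')
        (hrot.perm.mem_iff.1 (by simp))
      intro d hd
      rw [S.csum_path_eq hzG ht' hch (d := d) (d' := s(v, y))
        ((mem_cedges_of_isRotated hrot).1 hd) hy]
      rw [S.csum_prop hzG hvz ((isCyc_iff.1 ((hB.isRotated hrot).1.mono hH)).2.2 _ hy) (hH hvu)]
      exact hcon
    obtain ⟨e, he, hout⟩ := S.outer {d | d ∈ cedges (v :: t) ∨ d ∈ cedges z} (by
        rintro d (hd | hd)
        · exact (hB.1.mono hH).closedIn d hd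
        · exact hzG d hd) (by
        obtain ⟨y, hy⟩ := exists_mem_cedges (x := v) (l := v :: t) (by simp)
        exact ⟨_, Or.inl hy⟩)
    rcases he with he | he
    · have hez := hCz e he
      cases z with
      | nil => simp [csum] at hez
      | cons x z =>
        have : csum S.w (x :: z) e = 0 := hout x z (isChain_iff_edgesL.2 hzG) fun d hd =>
          ⟨Or.inr hd, fun h => ?_⟩
        · rw [this] at hez; simp at hez
        · rw [h] at hd
          have := hzC e hd
          induction e with | _ a b
          have h1 := mem_of_mem_cedges (l := x :: z) hd
          have h2 := mem_of_mem_cedges he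
          have hav : a ≠ v := by rintro rfl; exact hvz h1.1
          have hbv : b ≠ v := by rintro rfl; exact hvz h1.2
          simp only [List.mem_cons, hav, hbv, false_or] at h2
          exact hcc a h2.1 b h2.2 (G.ne_of_adj (hzG _ hd)) h1.1 h1.2
    · have heC := hzC e he
      have : csum S.w (v :: t) e = 0 := hout v t (isChain_iff_edgesL.2 (hB.1.mono hH).closedIn)
        fun d hd => ⟨Or.inl hd, fun h => ?_⟩
      · rw [this] at heC; simp at heC
      · rw [h] at hd
        induction e with | _ a b
        have h1 := mem_of_mem_cedges he
        have h2 := mem_of_mem_cedges (l := v :: t) hd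
        have hav : a ≠ v := by rintro rfl; exact hvz h1.1
        have hbv : b ≠ v := by rintro rfl; exact hvz h1.2
        simp only [List.mem_cons, hav, hbv, false_or] at h2
        exact hcc a h2.1 b h2.2 (G.ne_of_adj (hzG _ he)) h1.1 h1.2

theorem exists_mem_of_mem_edgesL {b b' : V} {a : List V} (hb : b ≠ b') (h1 : b ∉ a) (h2 : b' ∉ a)
    (ha : a ≠ []) {H : SimpleGraph V} {x y : V} (hxy : H.Adj x y)
    (h : s(x, y) ∈ edgesL (b :: (a ++ [b']))) : x ∈ a ∨ y ∈ a := by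
  by_contra hcon
  push Not at hcon
  have hm := mem_of_mem_edgesL h
  simp only [List.mem_cons, List.mem_append, hcon, false_or, List.not_mem_nil, or_false] at hm
  have hs : s(x, y) = s(b, b') := by
    rcases hm with ⟨rfl | rfl, rfl | rfl⟩
    · exact absurd rfl hxy.ne
    · rfl
    · exact Sym2.eq_swap
    · exact absurd rfl hxy.ne
  rw [hs] at h
  exact ha (eq_nil_of_mem_edgesL hb h1 h2 h)

/-- The subgraph of the edges that touch `K` or belong to `l`. -/
def inside (H : SimpleGraph V) (K : Set V) (l : List (Sym2 V)) : SimpleGraph V where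
  Adj x y := H.Adj x y ∧ (x ∈ K ∨ y ∈ K ∨ s(x, y) ∈ l)
  symm := ⟨fun x y h => ⟨h.1.symm, by rw [Sym2.eq_swap]; tauto⟩⟩
  loopless := ⟨fun x h => H.loopless.irrefl x h.1⟩

theorem inside_le (H : SimpleGraph V) (K : Set V) (l : List (Sym2 V)) : inside H K l ≤ H :=
  fun _ _ h => h.1

theorem Bd.split {S : ParSys G} {H : SimpleGraph V} (hH : H ≤ G) {b b' : V} {a₁ a₂ q : List V}
    (hB : Bd S H (cyc2 b b' a₁ a₂)) (ha : a₁ ≠ []) (h1q : TwoPaths b b' a₁ q)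
    (h2q : TwoPaths b b' a₂ q) (hq : (b :: (q ++ [b'])).IsChain H.Adj) (nq : q.Nodup) :
    ∃ K : Set V, (∀ x ∈ a₁, x ∈ K) ∧ (∀ x ∈ a₂, x ∉ K) ∧ b ∉ K ∧ b' ∉ K ∧ (∀ x ∈ q, x ∉ K) ∧
      (∀ x ∈ K, ∀ y, H.Adj x y → y ∈ K ∨ y = b ∨ y = b' ∨ y ∈ q) ∧
      ∀ v ∈ cyc2 b b' a₁ q, Outer S (inside H K (edgesL (b :: (q ++ [b'])))) v := by
  have h12 := hB.1.twoPaths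
  obtain ⟨h₁, h₂, n₁, n₂⟩ := hB.1.chains
  have toG : ∀ {l : List V}, l.IsChain H.Adj → l.IsChain G.Adj := fun h => h.imp fun _ _ h => hH h
  have pq : pin S b b' a₁ a₂ q = 1 := hB.2 _ (isChain_iff_edgesL.1 hq _ (head_mem_edgesL _ _ _))
    (h1q.symm.edge_notMem h2q.symm hq (head_mem_edgesL _ _ _))
  have th := theta_pin S h12 h1q h2q (toG h₁) (toG h₂) (toG hq)
  have p : pin S b b' a₂ q a₁ = 0 ∧ pin S b b' a₁ q a₂ = 0 := by
    rw [pq] at th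
    simpa using th
  have e1 : ∀ x ∈ a₁, ∀ y, H.Adj x y → csum S.w (cyc2 b b' a₂ q) s(x, y) = 0 := fun x hx y hxy => by
    rw [pin_eq_vertex S h12 h1q (toG h₁) (toG h₂) (toG hq) hx (d := s(x, y)) (hH hxy) (by simp), p.1]
  have e2 : ∀ x ∈ a₂, ∀ y, H.Adj x y → csum S.w (cyc2 b b' a₁ q) s(x, y) = 0 := fun x hx y hxy => by
    rw [pin_eq_vertex S h12.symm h2q (toG h₂) (toG h₁) (toG hq) hx (d := s(x, y)) (hH hxy) (by simp),
      p.2]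
  have key : ∀ x ∈ a₁, ∀ y, H.Adj x y → s(x, y) ∉ cedges (cyc2 b b' a₁ a₂) →
      csum S.w (cyc2 b b' a₁ q) s(x, y) = 1 := fun x hx y hxy hd => by
    have := csum_cyc2_add S.w b b' a₁ a₂ q s(x, y)
    rw [hB.2 _ hxy hd, e1 x hx y hxy, add_zero] at this
    exact this.symm
  have offa₂ : ∀ x ∈ a₁, ∀ y, s(x, y) ∉ edgesL (b :: (a₂ ++ [b'])) := fun x hx y h => by
    have := (mem_of_mem_edgesL h).1
    simp only [List.mem_cons, List.mem_append, List.not_mem_nil, or_false] at this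
    rcases this with rfl | h | rfl
    · exact h12.b₁ hx
    · exact h12.disj x hx h
    · exact h12.b₁' hx
  have cl : ClosedIn G (cyc2 b b' a₁ q) := closedIn_cyc2 (toG h₁) (toG hq)
  refine ⟨{x | x ∈ a₁ ∨ (x ∉ cyc2 b b' a₁ a₂ ∧ x ∉ q ∧
    ∃ y, H.Adj x y ∧ csum S.w (cyc2 b b' a₁ q) s(x, y) = 1)}, ?_, ?_, ?_, ?_, ?_, ?_, ?_⟩
  · exact fun x hx => Or.inl hx
  · rintro x hx (h | ⟨h, -⟩)
    · exact h12.disj x h hx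
    · exact h (mem_cyc2.2 (by tauto))
  · rintro (h | ⟨h, -⟩)
    · exact h12.b₁ h
    · exact h (mem_cyc2.2 (by tauto))
  · rintro (h | ⟨h, -⟩)
    · exact h12.b₁' h
    · exact h (mem_cyc2.2 (by tauto))
  · rintro x hx (h | ⟨-, h, -⟩)
    · exact h1q.disj x h hx
    · exact h hx
  · rintro x hx y hxy
    by_cases hy : y = b ∨ y = b' ∨ y ∈ q
    · exact Or.inr hy
    by_cases hya : y ∈ a₁
    · exact Or.inl (Or.inl hya)
    push Not at hy
    have hx1 : y ∉ cyc2 b b' a₁ a₂ ∨ y ∈ a₂ → csum S.w (cyc2 b b' a₁ q) s(x, y) = 1 := by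
      intro hyc
      rcases hx with hx | ⟨hxC, hxq, z, hxz, hz⟩
      · refine key x hx y hxy fun hd => ?_
        rcases hyc with hyc | hyc
        · exact hyc (mem_of_mem_cedges hd).2
        · rcases mem_cedges_cyc2.1 hd with h | h
          · have := (mem_of_mem_edgesL h).2
            simp only [List.mem_cons, List.mem_append, List.not_mem_nil, or_false] at this
            tauto
          · exact offa₂ x hx y h
      · rw [S.csum_prop cl (a := y) (b := z) ?_ (hH hxy) (hH hxz)]
        · exact hz
        · intro h
          rcases mem_cyc2.1 h with h | h | h | h
          · exact hxC (mem_cyc2.2 (by tauto))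
          · exact hxC (mem_cyc2.2 (by tauto))
          · exact hxC (mem_cyc2.2 (by tauto))
          · exact hxq h
    by_cases hy2 : y ∈ a₂
    · have := hx1 (Or.inr hy2)
      rw [Sym2.eq_swap, e2 y hy2 x hxy.symm] at this
      simp at this
    · have hyC : y ∉ cyc2 b b' a₁ a₂ := fun h => by
        rcases mem_cyc2.1 h with h | h | h | h <;> tauto
      refine Or.inl (Or.inr ⟨hyC, hy.2.2, x, hxy.symm, ?_⟩)
      rw [Sym2.eq_swap]
      exact hx1 (Or.inl hyC)
  · intro v hv
    refine Bd.outer (C := cyc2 b b' a₁ q) ((inside_le _ _ _).trans hH) ⟨?_, ?_⟩ hv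
    · refine h1q.isCyc ?_ ?_ n₁ nq
      · refine isChain_iff_edgesL.2 fun d hd => ?_
        have hadj := isChain_iff_edgesL.1 h₁ d hd
        induction d with | _ x y
        refine ⟨hadj, ?_⟩
        rcases exists_mem_of_mem_edgesL h12.ne h12.b₁ h12.b₁' ha hadj hd with h | h
        · exact Or.inl (Or.inl h)
        · exact Or.inr (Or.inl (Or.inl h))
      · refine isChain_iff_edgesL.2 fun d hd => ?_
        have hadj := isChain_iff_edgesL.1 hq d hd
        induction d with | _ x y
        exact ⟨hadj, Or.inr (Or.inr hd)⟩
    · have main : ∀ x y, H.Adj x y → s(x, y) ∉ cedges (cyc2 b b' a₁ q) →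
          (x ∈ a₁ ∨ (x ∉ cyc2 b b' a₁ a₂ ∧ x ∉ q ∧
            ∃ y, H.Adj x y ∧ csum S.w (cyc2 b b' a₁ q) s(x, y) = 1)) →
          csum S.w (cyc2 b b' a₁ q) s(x, y) = 1 := by
        rintro x y hxy hd (hx | ⟨hxC, hxq, z, hxz, hz⟩)
        · refine key x hx y hxy fun h => ?_
          rcases mem_cedges_cyc2.1 h with h | h
          · exact hd (mem_cedges_cyc2.2 (Or.inl h))
          · exact offa₂ x hx y h
        · rw [S.csum_prop cl (a := y) (b := z) ?_ (hH hxy) (hH hxz)]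
          · exact hz
          · intro h
            rcases mem_cyc2.1 h with h | h | h | h
            · exact hxC (mem_cyc2.2 (by tauto))
            · exact hxC (mem_cyc2.2 (by tauto))
            · exact hxC (mem_cyc2.2 (by tauto))
            · exact hxq h
      intro d hd hdC
      induction d with | _ x y
      rcases hd with ⟨hxy, h | h | h⟩
      · exact main x y hxy hdC h
      · rw [Sym2.eq_swap] at hdC ⊢
        exact main y x hxy.symm hdC h
      · exact absurd (mem_cedges_cyc2.2 (Or.inr h)) hdC

/-- The hypotheses of the theorem for a subgraph `H` of `G`; isolated vertices are ignored. -/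
structure Good (S : ParSys G) (H : SimpleGraph V) (P : List V) (L : V → Finset ℕ) : Prop where
  le : H ≤ G
  nd : P.Nodup
  len : P.length ≤ 3
  chain : P.IsChain H.Adj
  out : ∀ v ∈ P, Outer S H v
  one : ∀ v ∈ P, (L v).card = 1
  pos : ∀ v, (L v).Nonempty
  sep : ∀ u v, H.Adj u v → (L u ∩ L v).card ≤ 1
  two : ∀ v ∉ P, ∀ u, H.Adj v u → 2 ≤ (L v).card
  twoOuter : ∀ v ∉ P, ∀ u, H.Adj v u → (L v).card = 2 → Outer S H v
  nn : ∀ u v, H.Adj u v → (L u).card = 2 → (L v).card ≠ 2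
  proper : ∀ u ∈ P, ∀ v ∈ P, H.Adj u v → L u ≠ L v
  noTwo : ∀ x, (L x).card = 2 → ∀ u ∈ P, ∀ v ∈ P, u ≠ v → H.Adj x u → H.Adj x v → False

/-- `G` has no cycle of length four. -/
def NoC4 (G : SimpleGraph V) : Prop :=
  ∀ a b c d, G.Adj a b → G.Adj b c → G.Adj c d → G.Adj d a → a ≠ c → b ≠ d → False

/-- A minimal counterexample. -/
structure MC (S : ParSys G) (H : SimpleGraph V) (P : List V) (L : V → Finset ℕ) : Prop
    extends Good S H P L where
  c4 : NoC4 G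
  nc : ¬ ColorableWith H L
  ih : ∀ H' P' L', Good S H' P' L' → H'.edgeSet.ncard < H.edgeSet.ncard ∨
    H'.edgeSet.ncard = H.edgeSet.ncard ∧ P.length < P'.length → ColorableWith H' L'
  ex : ∃ p ∈ P, ∃ y, H.Adj p y

open Classical in
/-- The colors of `M v` not used by `ψ` on a neighbour of `v` in `D`. -/
noncomputable def trim (H : SimpleGraph V) (D : Set V) (ψ : V → ℕ) (M : V → Finset ℕ) (v : V) :
    Finset ℕ :=
  (M v).filter fun c => ∀ d ∈ D, H.Adj d v → ψ d ≠ c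

theorem mem_trim {H : SimpleGraph V} {D : Set V} {ψ : V → ℕ} {M : V → Finset ℕ} {v : V} {c : ℕ} :
    c ∈ trim H D ψ M v ↔ c ∈ M v ∧ ∀ d ∈ D, H.Adj d v → ψ d ≠ c := by
  simp [trim]

theorem trim_eq {H : SimpleGraph V} {D : Set V} {ψ : V → ℕ} {M : V → Finset ℕ} {v : V}
    (h : ∀ d ∈ D, ¬ H.Adj d v) : trim H D ψ M v = M v := by
  ext c
  rw [mem_trim]
  exact ⟨And.left, fun hc => ⟨hc, fun d hd hdv => absurd hdv (h d hd)⟩⟩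

theorem IsCyc.exists_adj {H : SimpleGraph V} {z : List V} (hz : IsCyc H z) {x : V} (hx : x ∈ z) :
    ∃ y, H.Adj x y := by
  obtain ⟨y, hy⟩ := exists_mem_cedges hx
  exact ⟨y, hz.closedIn _ hy⟩

theorem edgeSet_ncard_lt [Finite V] {H H' : SimpleGraph V} (hle : H' ≤ H) {x y : V}
    (h : H.Adj x y) (h' : ¬ H'.Adj x y) : H'.edgeSet.ncard < H.edgeSet.ncard := by
  refine Set.ncard_lt_ncard ?_ (Set.toFinite _)
  exact ⟨SimpleGraph.edgeSet_mono hle, fun hc => h' (hc (show s(x, y) ∈ H.edgeSet from h))⟩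

/-- Precolor `D ∪ P'` by `ψ`, and color the rest of `H₀` from `M` by minimality. -/
theorem MC.extend [Finite V] {S : ParSys G} {H : SimpleGraph V} {P : List V} {L : V → Finset ℕ}
    (h : MC S H P L) {H₀ : SimpleGraph V} (hle : H₀ ≤ H) (D : Set V) (P' : List V)
    (M : V → Finset ℕ) (ψ : V → ℕ) (hM : ∀ v, M v ⊆ L v) (hpos : ∀ v, (M v).Nonempty)
    (hlt : (∃ x y, H.Adj x y ∧ (¬ H₀.Adj x y ∨ x ∈ D ∨ y ∈ D)) ∨ P.length < P'.length)
    (nd : P'.Nodup) (len : P'.length ≤ 3) (chain : P'.IsChain H₀.Adj)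
    (out : ∀ v ∈ P', Outer S H₀ v) (hPD : ∀ v ∈ P', v ∉ D) (hψ : ∀ v, v ∈ D ∨ v ∈ P' → ψ v ∈ M v)
    (proper : ∀ u v, H₀.Adj u v → u ∈ D ∨ u ∈ P' → v ∈ D ∨ v ∈ P' → ψ u ≠ ψ v)
    (outD : ∀ v ∈ D, Outer S H₀ v)
    (outM : ∀ v, v ∉ D → v ∉ P' → ∀ u, H₀.Adj v u → (M v).card = 2 → Outer S H₀ v)
    (two : ∀ v, v ∉ D → v ∉ P' → ∀ u, H₀.Adj v u → 2 ≤ (trim H₀ D ψ M v).card)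
    (nn : ∀ u v, H₀.Adj u v → u ∉ D → v ∉ D → u ∉ P' → v ∉ P' → (trim H₀ D ψ M u).card = 2 →
      (trim H₀ D ψ M v).card = 2 → Disjoint (trim H₀ D ψ M u) (trim H₀ D ψ M v))
    (noTwo : ∀ v, v ∉ D → v ∉ P' → (trim H₀ D ψ M v).card = 2 → ∀ p ∈ P', ∀ q ∈ P', p ≠ q →
      H₀.Adj v p → H₀.Adj v q → False) :
    ∃ φ : V → ℕ, (∀ v, φ v ∈ M v) ∧ (∀ u v, H₀.Adj u v → φ u ≠ φ v) ∧
      ∀ v, v ∈ D ∨ v ∈ P' → φ v = ψ v := by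
  classical
  let N : V → Finset ℕ := fun v => if v ∈ D ∨ v ∈ P' then {ψ v} else trim H₀ D ψ M v
  have N1 : ∀ v, v ∈ D ∨ v ∈ P' → N v = {ψ v} := fun v hv => if_pos hv
  have N2 : ∀ v, v ∉ D → v ∉ P' → N v = trim H₀ D ψ M v := fun v h1 h2 => if_neg (by tauto)
  have NM : ∀ v, N v ⊆ M v := by
    intro v
    by_cases hv : v ∈ D ∨ v ∈ P'
    · rw [N1 v hv, Finset.singleton_subset_iff]; exact hψ v hv
    · push Not at hv
      rw [N2 v hv.1 hv.2]
      exact fun c hc => (mem_trim.1 hc).1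
  let H' : SimpleGraph V :=
    { Adj := fun x y => H₀.Adj x y ∧ x ∉ D ∧ y ∉ D ∧ ((x ∈ P' ∧ y ∈ P') ∨ ¬ Disjoint (N x) (N y))
      symm := ⟨fun x y h => ⟨h.1.symm, h.2.2.1, h.2.1, by
        rw [disjoint_comm]; have := h.2.2.2; tauto⟩⟩
      loopless := ⟨fun x h => H₀.loopless.irrefl x h.1⟩ }
  have hH' : H' ≤ H₀ := fun x y h => h.1
  have hG : H' ≤ G := hH'.trans (hle.trans h.le)
  have good : Good S H' P' N := by
    constructor
    · exact hG
    · exact nd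
    · exact len
    · refine isChain_iff_edgesL.2 fun d hd => ?_
      have := isChain_iff_edgesL.1 chain d hd
      induction d with | _ x y
      have hm := mem_of_mem_edgesL hd
      exact ⟨this, hPD x hm.1, hPD y hm.2, Or.inl hm⟩
    · exact fun v hv => (out v hv).mono hH'
    · intro v hv; rw [N1 v (Or.inr hv)]; simp
    · intro v
      by_cases hv : v ∈ D ∨ v ∈ P'
      · rw [N1 v hv]; simp
      · push Not at hv
        rw [N2 v hv.1 hv.2]
        by_cases hd : ∃ d ∈ D, H₀.Adj d v
        · obtain ⟨d, -, hdv⟩ := hd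
          exact Finset.card_pos.1 (by have := two v hv.1 hv.2 d hdv.symm; omega)
        · push Not at hd
          rw [trim_eq hd]; exact hpos v
    · intro u v huv
      refine le_trans (Finset.card_le_card ?_) (h.sep u v (hle (hH' huv)))
      exact Finset.inter_subset_inter ((NM u).trans (hM u)) ((NM v).trans (hM v))
    · intro v hv u hvu
      rw [N2 v hvu.2.1 hv]
      exact two v hvu.2.1 hv u hvu.1
    · intro v hv u hvu hc
      by_cases hd : ∃ d ∈ D, H₀.Adj d v
      · obtain ⟨d, hdD, hdv⟩ := hd
        intro z hz hvz w hvw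
        have hdz : d ∉ z := fun hdz => by
          obtain ⟨y, hy⟩ := hz.exists_adj hdz
          exact hy.2.1 hdD
        have hG₀ : H₀ ≤ G := hle.trans h.le
        rw [S.csum_prop (hz.mono hG).closedIn hvz (hG hvw) (hG₀ hdv).symm, Sym2.eq_swap]
        exact outD d hdD z (hz.mono hH') hdz v hdv
      · push Not at hd
        rw [N2 v hvu.2.1 hv, trim_eq hd] at hc
        exact (outM v hvu.2.1 hv u hvu.1 hc).mono hH'
    · intro u v huv hu hv
      have hu' : u ∉ P' := fun h' => by rw [N1 u (Or.inr h')] at hu; simp at hu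
      have hv' : v ∉ P' := fun h' => by rw [N1 v (Or.inr h')] at hv; simp at hv
      rcases huv.2.2.2 with hp | hp
      · exact hu' hp.1
      · rw [N2 u huv.2.1 hu', N2 v huv.2.2.1 hv'] at hp
        rw [N2 u huv.2.1 hu'] at hu
        rw [N2 v huv.2.2.1 hv'] at hv
        exact hp (nn u v huv.1 huv.2.1 huv.2.2.1 hu' hv' hu hv)
    · intro u hu v hv huv
      rw [N1 u (Or.inr hu), N1 v (Or.inr hv), Ne, Finset.singleton_inj]
      exact proper u v huv.1 (Or.inr hu) (Or.inr hv)
    · intro x hx u hu v hv huv hxu hxv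
      have hx' : x ∉ P' := fun h' => by rw [N1 x (Or.inr h')] at hx; simp at hx
      rw [N2 x hxu.2.1 hx'] at hx
      exact noTwo x hxu.2.1 hx' hx u hu v hv huv hxu.1 hxv.1
  have hcol : ColorableWith H' N := by
    refine h.ih H' P' N good ?_
    rcases hlt with ⟨x, y, hxy, h'⟩ | h'
    · refine Or.inl (edgeSet_ncard_lt (hH'.trans hle) hxy fun hc => ?_)
      rcases h' with h' | h' | h'
      · exact h' hc.1
      · exact hc.2.1 h'
      · exact hc.2.2.1 h'
    · have := Set.ncard_le_ncard (SimpleGraph.edgeSet_mono (hH'.trans hle)) (Set.toFinite _)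
      rcases this.lt_or_eq with h1 | h1
      · exact Or.inl h1
      · exact Or.inr ⟨h1, h'⟩
  obtain ⟨φ, h1, h2⟩ := hcol
  have hφ : ∀ v, v ∈ D ∨ v ∈ P' → φ v = ψ v := fun v hv => by
    have := h1 v
    rw [N1 v hv] at this
    simpa using this
  have hD : ∀ u v, H₀.Adj u v → u ∈ D → φ u ≠ φ v := by
    intro u v huv hu
    by_cases hv : v ∈ D ∨ v ∈ P'
    · rw [hφ u (Or.inl hu), hφ v hv]
      exact proper u v huv (Or.inl hu) hv
    · push Not at hv
      have := h1 v
      rw [N2 v hv.1 hv.2, mem_trim] at this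
      rw [hφ u (Or.inl hu)]
      exact this.2 u hu huv
  refine ⟨φ, fun v => NM v (h1 v), fun u v huv => ?_, hφ⟩
  by_cases hu : u ∈ D
  · exact hD u v huv hu
  by_cases hv : v ∈ D
  · exact (hD v u huv.symm hv).symm
  by_cases hd : Disjoint (N u) (N v)
  · exact fun he => Finset.disjoint_left.1 hd (h1 u) (he ▸ h1 v)
  · exact h2 ⟨huv, hu, hv, Or.inr hd⟩

/-- `MC.extend` without deleted vertices. -/
theorem MC.restrict [Finite V] {S : ParSys G} {H : SimpleGraph V} {P : List V} {L : V → Finset ℕ}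
    (h : MC S H P L) {H₀ : SimpleGraph V} (hle : H₀ ≤ H) (P' : List V) (ψ : V → ℕ)
    (hlt : (∃ x y, H.Adj x y ∧ ¬ H₀.Adj x y) ∨ P.length < P'.length)
    (nd : P'.Nodup) (len : P'.length ≤ 3) (chain : P'.IsChain H₀.Adj)
    (out : ∀ v ∈ P', Outer S H₀ v) (hψ : ∀ v ∈ P', ψ v ∈ L v)
    (proper : ∀ u v, H₀.Adj u v → u ∈ P' → v ∈ P' → ψ u ≠ ψ v)
    (hP : ∀ v ∈ P, v ∉ P' → ∀ u, ¬ H₀.Adj v u)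
    (noTwo : ∀ v, v ∉ P' → (L v).card = 2 → ∀ p ∈ P', ∀ q ∈ P', p ≠ q →
      H₀.Adj v p → H₀.Adj v q → False) :
    ∃ φ : V → ℕ, (∀ v, φ v ∈ L v) ∧ (∀ u v, H₀.Adj u v → φ u ≠ φ v) ∧ ∀ v ∈ P', φ v = ψ v := by
  have t : ∀ v, trim H₀ ∅ ψ L v = L v := fun v => trim_eq (by simp)
  have hPn : ∀ v, v ∉ P' → ∀ u, H₀.Adj v u → v ∉ P := fun v hv u hvu hvP => hP v hvP hv u hvu
  obtain ⟨φ, h1, h2, h3⟩ := h.extend hle ∅ P' L ψ (fun _ => Finset.Subset.refl _) h.pos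
    (hlt.imp (fun ⟨x, y, h1, h2⟩ => ⟨x, y, h1, Or.inl h2⟩) id) nd len chain out (by simp)
    (by simpa using hψ) (by simpa using fun u v huv hu hv => proper u v huv hu hv) (by simp)
    (fun v _ hv u hvu hc => (h.twoOuter v (hPn v hv u hvu) u (hle hvu) hc).mono hle)
    (fun v _ hv u hvu => by rw [t]; exact h.two v (hPn v hv u hvu) u (hle hvu))
    (fun u v huv _ _ _ _ hu hv => by rw [t] at hu hv; exact absurd hv (h.nn u v (hle huv) hu))
    (fun v _ hv hc => by rw [t] at hc; exact noTwo v hv hc)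
  exact ⟨φ, h1, h2, fun v hv => h3 v (Or.inr hv)⟩

theorem MC.exists_col {S : ParSys G} {H : SimpleGraph V} {P : List V} {L : V → Finset ℕ}
    (h : MC S H P L) : ∃ c : V → ℕ, (∀ v, c v ∈ L v) ∧ ∀ v ∈ P, L v = {c v} := by
  choose c hc using h.pos
  refine ⟨c, hc, fun v hv => ?_⟩
  obtain ⟨a, ha⟩ := Finset.card_eq_one.1 (h.one v hv)
  have := hc v
  rw [ha, Finset.mem_singleton] at this
  rw [ha, this]

theorem MC.glue {S : ParSys G} {H : SimpleGraph V} {P : List V} {L : V → Finset ℕ}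
    (h : MC S H P L) (K : Set V) {φ₁ φ₂ : V → ℕ} (h₁ : ∀ v, φ₁ v ∈ L v) (h₂ : ∀ v, φ₂ v ∈ L v)
    (p₁ : ∀ x y, H.Adj x y → x ∉ K → y ∉ K → φ₁ x ≠ φ₁ y)
    (p₂ : ∀ x y, H.Adj x y → x ∈ K → φ₂ x ≠ φ₂ y)
    (agree : ∀ x y, H.Adj x y → x ∈ K → y ∉ K → φ₂ y = φ₁ y) : False := by
  classical
  refine h.nc ⟨fun v => if v ∈ K then φ₂ v else φ₁ v, fun v => ?_, fun u v huv => ?_⟩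
  · dsimp only; split_ifs
    · exact h₂ v
    · exact h₁ v
  · dsimp only; split_ifs with hu hv hv
    · exact p₂ u v huv hu
    · rw [← agree u v huv hu hv]; exact p₂ u v huv hu
    · rw [← agree v u huv.symm hv hu]; exact (p₂ v u huv.symm hv).symm
    · exact p₁ u v huv hu hv

theorem MC.norm [Finite V] {S : ParSys G} {H : SimpleGraph V} {P : List V} {L : V → Finset ℕ}
    (h : MC S H P L) {u v : V} (huv : H.Adj u v) (hP : s(u, v) ∉ edgesL P) :
    ¬ Disjoint (L u) (L v) := by
  intro hd
  obtain ⟨c, hc, hcP⟩ := h.exists_col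
  have hle : H.deleteEdges {s(u, v)} ≤ H := SimpleGraph.deleteEdges_le _
  obtain ⟨φ, h1, h2, -⟩ := h.restrict hle P c (Or.inl ⟨u, v, huv, by simp⟩) h.nd h.len
    (isChain_iff_edgesL.2 fun d hd => by
      rw [SimpleGraph.edgeSet_deleteEdges]
      exact ⟨isChain_iff_edgesL.1 h.chain d hd, by rintro rfl; exact hP hd⟩)
    (fun v hv => (h.out v hv).mono hle) (fun v _ => hc v)
    (fun a b hab ha hb he => h.proper a ha b hb (hle hab) (by rw [hcP a ha, hcP b hb, he]))
    (fun v hv hv' => absurd hv hv')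
    (fun v _ hv p hp q hq hpq h1 h2 => h.noTwo v hv p hp q hq hpq (hle h1) (hle h2))
  refine h.nc ⟨φ, h1, fun a b hab he => ?_⟩
  by_cases hs : s(a, b) = s(u, v)
  · have hda : Disjoint (L a) (L b) := by
      rcases Sym2.eq_iff.1 hs with ⟨rfl, rfl⟩ | ⟨rfl, rfl⟩
      · exact hd
      · exact hd.symm
    exact Finset.disjoint_left.1 hda (h1 a) (he ▸ h1 b)
  · exact h2 a b (by rw [SimpleGraph.deleteEdges_adj]; exact ⟨hab, hs⟩) he

/-- The subgraph of the edges that avoid `K`. -/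
def outside (H : SimpleGraph V) (K : Set V) : SimpleGraph V where
  Adj x y := H.Adj x y ∧ x ∉ K ∧ y ∉ K
  symm := ⟨fun _ _ h => ⟨h.1.symm, h.2.2, h.2.1⟩⟩
  loopless := ⟨fun x h => H.loopless.irrefl x h.1⟩

theorem outside_le (H : SimpleGraph V) (K : Set V) : outside H K ≤ H := fun _ _ h => h.1

theorem mem_of_isChain {H : SimpleGraph V} {X : Set V} (hX : ∀ x ∈ X, ∀ y, H.Adj x y → y ∈ X)
    {P : List V} (hP : P.IsChain H.Adj) {p : V} (hp : p ∈ P) (hpX : p ∈ X) : ∀ q ∈ P, q ∈ X := by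
  induction P generalizing p with
  | nil => simp
  | cons a t ih =>
    cases t with
    | nil => simp at hp ⊢; exact hp ▸ hpX
    | cons b t =>
      rw [List.isChain_cons_cons] at hP
      have key : b ∈ X → ∀ q ∈ a :: b :: t, q ∈ X := fun hb q hq => by
        rcases List.mem_cons.1 hq with rfl | hq
        · exact hX b hb _ hP.1.symm
        · exact ih hP.2 (p := b) (by simp) hb q hq
      rcases List.mem_cons.1 hp with rfl | hp
      · exact key (hX _ hpX _ hP.1)
      · exact key (ih hP.2 hp hpX b (by simp))

theorem exists_mid {R : V → V → Prop} {P : List V} (hP : P.IsChain R) (hlen : P.length ≤ 3)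
    {A B : Set V} (hAB : ∀ x ∈ A, x ∉ B)
    (hR : ∀ x y, R x y → (x ∈ A → y ∈ B → False) ∧ (x ∈ B → y ∈ A → False)) {u v : V}
    (hu : u ∈ P) (huA : u ∈ A) (hv : v ∈ P) (hvB : v ∈ B) :
    ∃ a c b, P = [a, c, b] ∧ c ∉ A ∧ c ∉ B ∧ (a ∈ A ∧ b ∈ B ∨ a ∈ B ∧ b ∈ A) := by
  match P, hP, hlen with
  | [p], _, _ =>
    simp at hu hv
    subst hu hv
    exact absurd hvB (hAB _ huA)
  | [p, q], hP, _ =>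
    simp at hu hv hP
    have h1 := hR p q hP
    have h2 := hAB u huA
    rcases hu with rfl | rfl <;> rcases hv with rfl | rfl <;> tauto
  | [p, q, r], hP, _ =>
    simp at hu hv hP
    have h1 := hR p q hP.1
    have h2 := hR q r hP.2
    have h3 := hAB u huA
    refine ⟨p, q, r, rfl, ?_⟩
    clear hlen hP hAB hR
    rcases hu with rfl | rfl | rfl <;> rcases hv with rfl | rfl | rfl <;> tauto

/-- Color a proper subgraph with part of the precolored path. -/
theorem MC.restrict_sub [Finite V] {S : ParSys G} {H : SimpleGraph V} {P : List V}
    {L : V → Finset ℕ} (h : MC S H P L) {H₀ : SimpleGraph V} (hle : H₀ ≤ H) (P' : List V)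
    (hlt : ∃ x y, H.Adj x y ∧ ¬ H₀.Adj x y) (hsub : P'.Sublist P) (chain : P'.IsChain H₀.Adj)
    (hP : ∀ v ∈ P, v ∉ P' → ∀ u, ¬ H₀.Adj v u) :
    ∃ φ : V → ℕ, (∀ v, φ v ∈ L v) ∧ ∀ u v, H₀.Adj u v → φ u ≠ φ v := by
  obtain ⟨c, hc, hcP⟩ := h.exists_col
  have hs : ∀ v ∈ P', v ∈ P := fun v hv => hsub.subset hv
  obtain ⟨φ, h1, h2, -⟩ := h.restrict hle P' c (Or.inl hlt) (h.nd.sublist hsub)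
    (hsub.length_le.trans h.len) chain
    (fun v hv => (h.out v (hs v hv)).mono hle) (fun v _ => hc v)
    (fun a b hab ha hb he => h.proper a (hs a ha) b (hs b hb) (hle hab)
      (by rw [hcP a (hs a ha), hcP b (hs b hb), he])) hP
    (fun v _ hv p hp q hq hpq h1 h2 =>
      h.noTwo v hv p (hs p hp) q (hs q hq) hpq (hle h1) (hle h2))
  exact ⟨φ, h1, h2⟩

theorem MC.eq_of_mem {S : ParSys G} {H : SimpleGraph V} {P : List V} {L : V → Finset ℕ}
    (h : MC S H P L) {v : V} (hv : v ∈ P) {a b : ℕ} (ha : a ∈ L v) (hb : b ∈ L v) : a = b :=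
  Finset.card_le_one.1 (h.one v hv).le a ha b hb

theorem MC.closed [Finite V] {S : ParSys G} {H : SimpleGraph V} {P : List V} {L : V → Finset ℕ}
    (h : MC S H P L) {X : Set V} (hX : ∀ x ∈ X, ∀ y, H.Adj x y → y ∈ X) {p : V} (hp : p ∈ P)
    (hpX : p ∈ X) : ∀ x y, H.Adj x y → x ∈ X := by
  by_contra hcon
  push Not at hcon
  obtain ⟨x, y, hxy, hx⟩ := hcon
  have hPX := mem_of_isChain hX h.chain hp hpX
  have hy : y ∉ X := fun hy => hx (hX y hy x hxy.symm)
  obtain ⟨φ₁, a₁, b₁⟩ := h.restrict_sub (inside_le H X []) P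
    ⟨x, y, hxy, fun h' => by simpa [hx, hy] using h'.2⟩ (List.Sublist.refl _)
    (isChain_iff_edgesL.2 fun d hd => by
      have := isChain_iff_edgesL.1 h.chain d hd
      induction d with | _ a b
      exact ⟨this, Or.inl (hPX a (mem_of_mem_edgesL hd).1)⟩)
    (fun v hv hv' => absurd hv hv')
  obtain ⟨p', hp', y', hy'⟩ := h.ex
  obtain ⟨φ₂, a₂, b₂⟩ := h.restrict_sub (outside_le H X) []
    ⟨p', y', hy', fun h' => h'.2.1 (hPX p' hp')⟩ (List.nil_sublist _) List.isChain_nil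
    (fun v hv _ u hu => hu.2.1 (hPX v hv))
  exact h.glue X a₂ a₁ (fun x y hxy hx hy => b₂ x y ⟨hxy, hx, hy⟩)
    (fun x y hxy hx => b₁ x y ⟨hxy, Or.inl hx⟩) (fun x y hxy hx hy => absurd (hX x hx y hxy) hy)

theorem MC.not_sep_off [Finite V] {S : ParSys G} {H : SimpleGraph V} {P : List V}
    {L : V → Finset ℕ} (h : MC S H P L) {K : Set V} {c : V} (hc : c ∉ K)
    (hK : ∀ x ∈ K, ∀ y, H.Adj x y → y ∈ K ∨ y = c) (h1 : ∃ x ∈ K, ∃ y, H.Adj x y)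
    (h2 : ∃ x y, H.Adj x y ∧ x ∉ K ∧ y ∉ K) (hP : ∀ p ∈ P, p ∉ K) : False := by
  obtain ⟨x₁, hx₁, y₁, hxy₁⟩ := h1
  obtain ⟨x₂, y₂, hxy₂, hx₂, hy₂⟩ := h2
  obtain ⟨φ₁, a₁, b₁⟩ := h.restrict_sub (outside_le H K) P
    ⟨x₁, y₁, hxy₁, fun h' => h'.2.1 hx₁⟩ (List.Sublist.refl _)
    (isChain_iff_edgesL.2 fun d hd => by
      have := isChain_iff_edgesL.1 h.chain d hd
      induction d with | _ a b
      have hm := mem_of_mem_edgesL hd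
      exact ⟨this, hP _ hm.1, hP _ hm.2⟩)
    (fun v hv hv' => absurd hv hv')
  have hadj : ∀ {x y}, (inside H K []).Adj x y ↔ H.Adj x y ∧ (x ∈ K ∨ y ∈ K) := by
    intro x y; simp [inside]
  have hPc : ∀ v ∈ P, ∀ u, (inside H K []).Adj v u → v = c := by
    intro v hv u hvu
    rw [hadj] at hvu
    rcases hvu.2 with h' | h'
    · exact absurd h' (hP v hv)
    · exact (hK u h' v hvu.1.symm).resolve_left (hP v hv)
  have hout : Outer S (inside H K []) c := by
    by_cases hcP : c ∈ P
    · exact (h.out c hcP).mono (inside_le _ _ _)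
    intro z hz hcz u hcu
    by_contra hcon
    have hzH := hz.mono (inside_le _ _ _)
    have hzG := (hzH.mono h.le).closedIn
    have hzK : ∀ y ∈ z, y ∈ K := by
      intro y hy
      obtain ⟨w, hw⟩ := hz.exists_adj hy
      rw [hadj] at hw
      by_contra hyK
      refine hcz ((hK w (hw.2.resolve_left hyK) y hw.1.symm).resolve_left hyK ▸ hy)
    obtain ⟨p, hp, y, hpy⟩ := h.ex
    have := h.closed (X := {y | y ∉ K ∧ ∀ u, H.Adj y u → csum S.w z s(y, u) = 0}) (p := p) ?_ hp
      ⟨hP p hp, h.out p hp z hzH fun hpz => hP p hp (hzK p hpz)⟩ x₁ y₁ hxy₁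
    · exact this.1 hx₁
    · rintro y ⟨hy, hyz⟩ w hyw
      have hwK : w ∉ K := fun hw => by
        obtain rfl := (hK w hw y hyw.symm).resolve_left hy
        exact hcon (hyz u (hadj.1 hcu).1)
      refine ⟨hwK, fun u hwu => ?_⟩
      rw [S.csum_prop hzG (b := y) (fun h => hwK (hzK w h)) (h.le hwu) (h.le hyw.symm),
        Sym2.eq_swap]
      exact hyz w hyw
  obtain ⟨φ₂, a₂, b₂, c₂⟩ := h.restrict (inside_le H K []) [c] φ₁
    (Or.inl ⟨x₂, y₂, hxy₂, fun h' => by simpa [hx₂, hy₂] using (hadj.1 h').2⟩)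
    (by simp) (by simp) (by simp) (by simpa using hout) (by simpa using a₁ c)
    (by simpa using fun u v huv hu hv => absurd (hu.trans hv.symm) (SimpleGraph.ne_of_adj _ huv))
    (fun v hv hv' u hvu => hv' (by simp [hPc v hv u hvu]))
    (fun v _ _ p hp q hq hpq => by simp at hp hq; exact absurd (hp.trans hq.symm) hpq)
  refine h.glue K a₁ a₂ (fun x y hxy hx hy => b₁ x y ⟨hxy, hx, hy⟩)
    (fun x y hxy hx => b₂ x y (hadj.2 ⟨hxy, Or.inl hx⟩)) (fun x y hxy hx hy => ?_)
  obtain rfl := (hK x hx y hxy).resolve_left hy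
  exact c₂ y (by simp)

/-- A cut vertex cannot be the middle of the precolored path. -/
theorem MC.not_sep_mid [Finite V] {S : ParSys G} {H : SimpleGraph V} {P : List V}
    {L : V → Finset ℕ} (h : MC S H P L) {K : Set V} {c a b : V}
    (hK : ∀ x ∈ K, ∀ y, H.Adj x y → y ∈ K ∨ y = c) (hc : c ∉ K)
    (hPab : P = [a, c, b]) (ha : a ∈ K) (hb : b ∉ K) : False := by
  subst hPab
  have hch := h.chain
  simp only [List.isChain_cons_cons, List.isChain_singleton, and_true] at hch
  obtain ⟨φ₁, a₁, b₁⟩ := h.restrict_sub (outside_le H K) [c, b]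
    ⟨a, c, hch.1, fun h' => h'.2.1 ha⟩ (by simp)
    (by simpa using ⟨hch.2, hc, hb⟩) (fun v hv hv' u hvu => by
      simp at hv hv'
      obtain rfl : v = a := by tauto
      exact hvu.2.1 ha)
  have hadj : ∀ {x y}, (inside H K []).Adj x y ↔ H.Adj x y ∧ (x ∈ K ∨ y ∈ K) := by
    intro x y; simp [inside]
  obtain ⟨φ₂, a₂, b₂⟩ := h.restrict_sub (inside_le H K []) [a, c]
    ⟨c, b, hch.2, fun h' => by simpa [hc, hb] using (hadj.1 h').2⟩ (by simp)
    (by simpa using hadj.2 ⟨hch.1, Or.inl ha⟩) (fun v hv hv' u hvu => by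
      simp at hv hv'
      obtain rfl : v = b := by tauto
      rcases (hadj.1 hvu).2 with h' | h'
      · exact hb h'
      · rcases hK u h' v (hadj.1 hvu).1.symm with h | h
        · exact hb h
        · exact hv'.2 h)
  refine h.glue K a₁ a₂ (fun x y hxy hx hy => b₁ x y ⟨hxy, hx, hy⟩)
    (fun x y hxy hx => b₂ x y (hadj.2 ⟨hxy, Or.inl hx⟩)) (fun x y hxy hx hy => ?_)
  obtain rfl := (hK x hx y hxy).resolve_left hy
  exact h.eq_of_mem (v := y) (by simp) (a₂ y) (a₁ y)

theorem MC.noSep [Finite V] {S : ParSys G} {H : SimpleGraph V} {P : List V} {L : V → Finset ℕ}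
    (h : MC S H P L) : NoSep H := by
  intro K c hc hK h1 h2
  have hK' : ∀ x ∈ {x | x ∉ K ∧ x ≠ c}, ∀ y, H.Adj x y → y ∈ {x | x ∉ K ∧ x ≠ c} ∨ y = c := by
    rintro x ⟨hx, hxc⟩ y hxy
    by_cases hyc : y = c
    · exact Or.inr hyc
    · refine Or.inl ⟨fun hy => ?_, hyc⟩
      rcases hK y hy x hxy.symm with h | h
      · exact hx h
      · exact hxc h
  by_cases hPK : ∀ p ∈ P, p ∉ K
  · exact h.not_sep_off hc hK h1 h2 hPK
  by_cases hPK' : ∀ p ∈ P, p ∉ {x | x ∉ K ∧ x ≠ c}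
  · refine h.not_sep_off (c := c) (by simp) hK' ?_ ?_ hPK'
    · obtain ⟨x, y, hxy, hx, hy⟩ := h2
      by_cases hxc : x = c
      · exact ⟨y, ⟨hy, fun hyc => hxy.ne (hxc.trans hyc.symm)⟩, x, hxy.symm⟩
      · exact ⟨x, ⟨hx, hxc⟩, y, hxy⟩
    · obtain ⟨x, hx, y, hxy⟩ := h1
      refine ⟨x, y, hxy, fun h => h.1 hx, fun h => ?_⟩
      rcases hK x hx y hxy with h' | h'
      · exact h.1 h'
      · exact h.2 h'
  push Not at hPK hPK'
  obtain ⟨u, hu, huK⟩ := hPK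
  obtain ⟨v, hv, hvK⟩ := hPK'
  have key : ∀ x y, H.Adj x y → x ∈ K → y ∈ {x | x ∉ K ∧ x ≠ c} → False := by
    rintro x y hxy hx ⟨hy, hyc⟩
    exact (hK x hx y hxy).elim hy hyc
  obtain ⟨a, m, b, hPab, hmK, hmK', hab⟩ := exists_mid h.chain h.len
    (A := K) (B := {x | x ∉ K ∧ x ≠ c}) (fun x hx hx' => hx'.1 hx)
    (fun x y hxy => ⟨key x y hxy, fun hx hy => key y x hxy.symm hy hx⟩) hu huK hv hvK
  obtain rfl : m = c := by
    by_contra hmc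
    exact hmK' ⟨hmK, hmc⟩
  rcases hab with ⟨ha, hb⟩ | ⟨ha, hb⟩
  · exact h.not_sep_mid hK hc hPab ha hb.1
  · exact h.not_sep_mid hK' (by simp) hPab ha fun h' => h'.1 hb

theorem MC.exists_adj {S : ParSys G} {H : SimpleGraph V} {P : List V} {L : V → Finset ℕ}
    (h : MC S H P L) {v : V} (hv : v ∈ P) : ∃ y, H.Adj v y := by
  obtain ⟨p, hp, hpy⟩ := h.ex
  exact mem_of_isChain (X := {x | ∃ y, H.Adj x y}) (fun x _ y hxy => ⟨x, hxy.symm⟩) h.chain hp hpy v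
    hv

theorem MC.exists_bd [Finite V] {S : ParSys G} {H : SimpleGraph V} {P : List V} {L : V → Finset ℕ}
    (h : MC S H P L) : ∃ C, Bd S H C := by
  classical
  refine ChoosSep.exists_bd S h.le h.noSep ?_
  obtain ⟨p, hp, y, hpy⟩ := h.ex
  by_contra hcyc
  have huniq : ∀ u v, H.Adj u v → s(u, v) = s(p, y) := by
    intro u v huv
    by_contra hne
    exact hcyc (exists_isCyc h.noSep (e := s(p, y)) (e' := s(u, v)) hpy huv hne)
  obtain ⟨c, hc, hcP⟩ := h.exists_col
  obtain ⟨γ, hγ, hγp⟩ : ∃ γ ∈ L y, γ ≠ c p := by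
    by_cases hy : y ∈ P
    · refine ⟨c y, hc y, fun he => h.proper p hp y hy hpy ?_⟩
      rw [hcP p hp, hcP y hy, he]
    · exact Finset.exists_mem_ne (h.two y hy p hpy.symm) _
  refine h.nc ⟨Function.update c y γ, fun v => ?_, fun u v huv => ?_⟩
  · by_cases hv : v = y
    · subst hv; simpa using hγ
    · simpa [hv] using hc v
  · rcases Sym2.eq_iff.1 (huniq u v huv) with ⟨rfl, rfl⟩ | ⟨rfl, rfl⟩
    · rw [Function.update_self, Function.update_of_ne hpy.ne]; exact hγp.symm
    · rw [Function.update_self, Function.update_of_ne hpy.ne]; exact hγp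

theorem Bd.mem {S : ParSys G} {H : SimpleGraph V} {C : List V} (hB : Bd S H C) {v u : V}
    (hvu : H.Adj v u) (hv : Outer S H v) : v ∈ C := by
  by_contra hvC
  have := hv C hB.1 hvC u hvu
  rw [hB.2 s(v, u) hvu fun h => hvC (mem_of_mem_cedges h).1] at this
  simp at this

theorem MC.mem {S : ParSys G} {H : SimpleGraph V} {P : List V} {L : V → Finset ℕ}
    (h : MC S H P L) {C : List V} (hB : Bd S H C) {v : V} (hv : v ∈ P) : v ∈ C := by
  obtain ⟨y, hy⟩ := h.exists_adj hv
  exact hB.mem hy (h.out v hv)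

theorem MC.notMem {S : ParSys G} {H : SimpleGraph V} {P : List V} {L : V → Finset ℕ}
    (h : MC S H P L) {v : V} (hv : 2 ≤ (L v).card) : v ∉ P := fun hP => by
  have := h.one v hP; omega

theorem MC.mem_of_two {S : ParSys G} {H : SimpleGraph V} {P : List V} {L : V → Finset ℕ}
    (h : MC S H P L) {C : List V} (hB : Bd S H C) {v u : V} (hv : (L v).card = 2)
    (hvu : H.Adj v u) : v ∈ C :=
  hB.mem hvu (h.twoOuter v (h.notMem hv.ge) u hvu hv)

theorem MC.three {S : ParSys G} {H : SimpleGraph V} {P : List V} {L : V → Finset ℕ}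
    (h : MC S H P L) {C : List V} (hB : Bd S H C) {v u : V} (hv : v ∉ C)
    (hvu : H.Adj v u) : 3 ≤ (L v).card := by
  have h1 := h.two v (fun hP => hv (h.mem hB hP)) u hvu
  have h2 : (L v).card ≠ 2 := fun h2 => hv (h.mem_of_two hB h2 hvu)
  omega

theorem MC.exists_two [Finite V] {S : ParSys G} {H : SimpleGraph V} {P : List V}
    {L : V → Finset ℕ} (h : MC S H P L) {b b' : V} {a₁ a₂ q : List V}
    (hB : Bd S H (cyc2 b b' a₁ a₂)) (ha : a₁ ≠ []) (h1q : TwoPaths b b' a₁ q)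
    (h2q : TwoPaths b b' a₂ q) (hq : (b :: (q ++ [b'])).IsChain H.Adj) (hq1 : q.length ≤ 1)
    (hP : ∀ p ∈ P, p ∉ a₁) :
    ∃ s ∈ a₁, (L s).card = 2 ∧ ∃ u ∈ b :: (q ++ [b']), ∃ v ∈ b :: (q ++ [b']), u ≠ v ∧
      H.Adj s u ∧ H.Adj s v := by
  have nq : q.Nodup := by
    match q, hq1 with
    | [], _ => simp
    | [x], _ => simp
  obtain ⟨K, k1, k2, kb, kb', kq, kcl, kout⟩ := hB.split h.le ha h1q h2q hq nq
  by_contra hcon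
  have kQ : ∀ v ∈ b :: (q ++ [b']), v ∉ K := by
    intro v hv
    simp only [List.mem_cons, List.mem_append, List.not_mem_nil, or_false] at hv
    rcases hv with rfl | hv | rfl
    exacts [kb, kq v hv, kb']
  have kC : ∀ v ∈ cyc2 b b' a₁ a₂, v ∈ K → v ∈ a₁ := by
    intro v hv hvK
    rcases mem_cyc2.1 hv with rfl | rfl | hv | hv
    exacts [absurd hvK kb, absurd hvK kb', hv, absurd hvK (k2 v hv)]
  have kP : ∀ v ∈ P, v ∉ K := fun v hv hvK => hP v hv (kC v (h.mem hB hv) hvK)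
  have kcl' : ∀ x ∈ K, ∀ y, H.Adj x y → y ∉ K → y ∈ b :: (q ++ [b']) := by
    intro x hx y hxy hy
    have := kcl x hx y hxy
    simp only [List.mem_cons, List.mem_append, List.not_mem_nil, or_false]
    tauto
  obtain ⟨x, hx⟩ := List.exists_mem_of_ne_nil _ ha
  obtain ⟨y, hxy⟩ := hB.1.exists_adj (x := x) (mem_cyc2.2 (by tauto))
  obtain ⟨φ₁, a₁', b₁⟩ := h.restrict_sub (outside_le H K) P
    ⟨x, y, hxy, fun h' => h'.2.1 (k1 x hx)⟩ (List.Sublist.refl _)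
    (isChain_iff_edgesL.2 fun d hd => by
      have := isChain_iff_edgesL.1 h.chain d hd
      induction d with | _ a b
      have hm := mem_of_mem_edgesL hd
      exact ⟨this, kP _ hm.1, kP _ hm.2⟩)
    (fun v hv hv' => absurd hv hv')
  have hd := head_mem_edgesL b b' a₂
  obtain ⟨φ₂, a₂', b₂, c₂⟩ := h.restrict (inside_le H K (edgesL (b :: (q ++ [b']))))
    (b :: (q ++ [b'])) φ₁
    (Or.inl ⟨b, a₂.headD b', hB.1.closedIn _ (mem_cedges_cyc2.2 (Or.inr hd)), fun h' => by
      rcases h'.2 with h' | h' | h'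
      · exact kb h'
      · cases a₂ with
        | nil => exact kb' h'
        | cons z a₂ => exact k2 z (by simp) h'
      · exact h2q.symm.edges_disj hq h' hd⟩)
    (by
      have := h1q.ne
      have := h1q.b₂
      have := h1q.b₂'
      simp [List.nodup_append]
      refine ⟨by tauto, nq, ?_⟩
      rintro z hz rfl; tauto)
    (by simp; omega)
    (isChain_iff_edgesL.2 fun d hd => by
      have := isChain_iff_edgesL.1 hq d hd
      induction d with | _ a b
      exact ⟨this, Or.inr (Or.inr hd)⟩)
    (fun v hv => kout v (by
      simp only [List.mem_cons, List.mem_append, List.not_mem_nil, or_false] at hv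
      rw [mem_cyc2]; tauto))
    (fun v _ => a₁' v)
    (fun u v huv hu hv => b₁ u v ⟨huv.1, kQ u hu, kQ v hv⟩)
    (fun v hv hvQ u hvu => by
      rcases hvu.2 with h' | h' | h'
      · exact kP v hv h'
      · exact hvQ (kcl' u h' v hvu.1.symm (kP v hv))
      · exact hvQ (mem_of_mem_edgesL h').1)
    (fun v hvQ hv p hp r hr hpr hvp hvr => by
      refine hcon ⟨v, ?_, hv, p, hp, r, hr, hpr, hvp.1, hvr.1⟩
      refine kC v (h.mem_of_two hB hv hvp.1) ?_
      rcases hvp.2 with h' | h' | h'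
      · exact h'
      · exact absurd h' (kQ p hp)
      · exact absurd (mem_of_mem_edgesL h').1 hvQ)
  exact h.glue K a₁' a₂' (fun x y hxy hx hy => b₁ x y ⟨hxy, hx, hy⟩)
    (fun x y hxy hx => b₂ x y ⟨hxy, Or.inl hx⟩)
    (fun x y hxy hx hy => c₂ y (kcl' x hx y hxy hy))

theorem cyc2_reverse (b b' : V) (a r : List V) : cyc2 b b' a r.reverse = b :: (a ++ b' :: r) := by
  rw [cyc2, List.reverse_reverse]

/-- A chord that cuts off an arc without precolored vertices. -/
theorem MC.chord [Finite V] {S : ParSys G} {H : SimpleGraph V} {P : List V} {L : V → Finset ℕ}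
    (h : MC S H P L) {C : List V} (hB : Bd S H C) {b b' : V} {a r : List V}
    (hr : C ~r (b :: (a ++ b' :: r))) (ha : a ≠ []) (hr0 : r ≠ []) (hbb : H.Adj b b')
    (hP : ∀ p ∈ P, p ∉ a) : ∃ s ∈ a, (L s).card = 2 ∧ H.Adj s b ∧ H.Adj s b' := by
  replace hB := hB.isRotated hr
  rw [← cyc2_reverse] at hB
  have h12 := hB.1.twoPaths
  obtain ⟨s, hs, hs2, u, hu, v, hv, huv, hsu, hsv⟩ := h.exists_two hB ha (q := [])
    ⟨h12.ne, h12.b₁, by simp, h12.b₁', by simp, by simp, by tauto⟩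
    ⟨h12.ne, h12.b₂, by simp, h12.b₂', by simp, by simp, by simp [hr0]⟩ (by simpa using hbb)
    (by simp) hP
  simp at hu hv
  refine ⟨s, hs, hs2, ?_⟩
  rcases hu with rfl | rfl <;> rcases hv with rfl | rfl
  exacts [absurd rfl huv, ⟨hsu, hsv⟩, ⟨hsv, hsu⟩, absurd rfl huv]

/-- A path of length two that cuts off an arc without precolored vertices. -/
theorem MC.ear [Finite V] {S : ParSys G} {H : SimpleGraph V} {P : List V} {L : V → Finset ℕ}
    (h : MC S H P L) {C : List V} (hB : Bd S H C) {b b' n : V} {a r : List V}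
    (hr : C ~r (b :: (a ++ b' :: r))) (ha : a ≠ []) (hn : n ∉ C) (hb : H.Adj n b)
    (hb' : H.Adj n b') (hP : ∀ p ∈ P, p ∉ a) :
    ∃ s ∈ a, (L s).card = 2 ∧ H.Adj s n ∧ (H.Adj s b ∨ H.Adj s b') := by
  have hn' : n ∉ cyc2 b b' a r.reverse := by
    rw [cyc2_reverse]; exact fun h => hn (hr.perm.mem_iff.2 h)
  replace hB := hB.isRotated hr
  rw [← cyc2_reverse] at hB
  have h12 := hB.1.twoPaths
  rw [mem_cyc2] at hn'
  push Not at hn'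
  obtain ⟨s, hs, hs2, u, hu, v, hv, huv, hsu, hsv⟩ := h.exists_two hB ha (q := [n])
    ⟨h12.ne, h12.b₁, by simpa using hn'.1.symm, h12.b₁', by simpa using hn'.2.1.symm, by
      rintro x hx hxn; simp at hxn; exact hn'.2.2.1 (hxn ▸ hx), by simp⟩
    ⟨h12.ne, h12.b₂, by simpa using hn'.1.symm, h12.b₂', by simpa using hn'.2.1.symm, by
      rintro x hx hxn; simp only [List.mem_singleton] at hxn; exact hn'.2.2.2 (hxn ▸ hx), by simp⟩
    (by simpa using ⟨hb.symm, hb'⟩) (by simp) hP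
  have hsn : s ≠ n := fun hsn => hn'.2.2.1 (hsn ▸ hs)
  have hc : ¬ (H.Adj s b ∧ H.Adj s b') := fun hc =>
    h.c4 s b n b' (h.le hc.1) (h.le hb.symm) (h.le hb') (h.le hc.2.symm) hsn h12.ne
  simp at hu hv
  refine ⟨s, hs, hs2, ?_⟩
  rcases hu with rfl | rfl | rfl <;> rcases hv with rfl | rfl | rfl <;> tauto

theorem eq_of_mem_cedges_mid {l₁ l₂ : List V} {x y z w : V}
    (hnd : (l₁ ++ x :: y :: z :: l₂).Nodup) (h : s(y, w) ∈ cedges (l₁ ++ x :: y :: z :: l₂)) :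
    w = x ∨ w = z := by
  have hr : (l₁ ++ x :: y :: z :: l₂) ~r (y :: z :: (l₂ ++ l₁ ++ [x])) := by
    have e1 : l₁ ++ x :: y :: z :: l₂ = (l₁ ++ [x]) ++ (y :: z :: l₂) := by simp
    have e2 : y :: z :: (l₂ ++ l₁ ++ [x]) = (y :: z :: l₂) ++ (l₁ ++ [x]) := by simp
    rw [e1, e2]
    exact List.isRotated_append
  have hn := hr.perm.nodup_iff.1 hnd
  rw [mem_cedges_of_isRotated hr] at h
  have e3 : cedges (y :: z :: (l₂ ++ l₁ ++ [x])) =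
      edgesL ([y] ++ z :: ((l₂ ++ l₁) ++ x :: [y])) := by simp [cedges]
  have e4 : edgesL (z :: ((l₂ ++ l₁) ++ x :: [y])) =
      edgesL ((z :: (l₂ ++ l₁)) ++ [x]) ++ edgesL (x :: [y]) := by
    rw [← edgesL_append]; rfl
  rw [e3, edgesL_append, e4, List.mem_append, List.mem_append] at h
  rw [List.nodup_cons] at hn
  rcases h with h | h | h
  · have h : s(y, w) = s(y, z) := by simpa using h
    exact Or.inr (Sym2.congr_right.1 h)
  · exact absurd (mem_of_mem_edgesL h).1 hn.1
  · have h : s(y, w) = s(x, y) := by simpa using h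
    rw [Sym2.eq_swap] at h
    exact Or.inl (Sym2.congr_left.1 h)

theorem mem_cedges_of_append (l₁ l₂ : List V) (x y : V) : s(x, y) ∈ cedges (l₁ ++ x :: y :: l₂) := by
  have hr : (l₁ ++ x :: y :: l₂) ~r (x :: y :: (l₂ ++ l₁)) := by
    have := List.isRotated_append (l := l₁) (l' := x :: y :: l₂)
    simpa using this
  rw [mem_cedges_of_isRotated hr]
  simp [cedges]

/-- An edge between vertices of a cycle either is an edge of the cycle or splits it. -/
theorem mem_cedges_or_split {C : List V} {b b' : V} (hb : b ∈ C) (hb' : b' ∈ C)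
    (hne : b ≠ b') : s(b, b') ∈ cedges C ∨ ∃ a r, C ~r (b :: (a ++ b' :: r)) ∧ a ≠ [] ∧ r ≠ [] := by
  obtain ⟨a₁, a₂, hr⟩ := exists_isRotated_cyc2 hb hb' hne
  rw [mem_cedges_of_isRotated hr]
  by_cases h1 : a₁ = []
  · subst h1; left; simp [mem_cedges_cyc2]
  by_cases h2 : a₂ = []
  · subst h2; left; simp [mem_cedges_cyc2]
  exact Or.inr ⟨a₁, a₂.reverse, by rwa [← cyc2_reverse, List.reverse_reverse], h1, by simpa⟩

section Extension

variable {S : ParSys G} {H : SimpleGraph V} {P : List V} {L : V → Finset ℕ}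

theorem isRotated_arcs (b b' : V) (a r : List V) :
    (b :: (a ++ b' :: r)) ~r (b' :: (r ++ b :: a)) := by
  have := List.isRotated_append (l := b :: a) (l' := b' :: r)
  simpa using this

theorem not_mem_cedges_arcs {b b' x y : V} {a r : List V} (hnd : (b :: (a ++ b' :: r)).Nodup)
    (hx : x ∈ a) (hy : y ∈ r) : s(x, y) ∉ cedges (b :: (a ++ b' :: r)) := by
  intro h
  rw [← cyc2_reverse, mem_cedges_cyc2] at h
  simp [List.nodup_append] at hnd
  rcases h with h | h <;> have := mem_of_mem_edgesL h <;> simp at this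
  · grind
  · grind

theorem MC.edge_mem_cedges [Finite V] (h : MC S H P L) {C : List V} (hB : Bd S H C) {x y : V}
    (hx : x ∈ P) (hy : y ∈ P) (hxy : H.Adj x y) : s(x, y) ∈ cedges C := by
  refine (mem_cedges_or_split (h.mem hB hx) (h.mem hB hy) hxy.ne).resolve_right ?_
  rintro ⟨a, r, hr, ha, hr0⟩
  have hnd := hr.perm.nodup_iff.1 (isCyc_iff.1 hB.1).1
  have key : (∀ p ∈ P, p ∉ a) ∨ ∀ p ∈ P, p ∉ r := by
    by_contra hcon
    push Not at hcon
    obtain ⟨⟨p, hp, hpa⟩, q, hq, hqr⟩ := hcon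
    have : [x, y, p, q].Subperm P := by
      refine List.subperm_of_subset ?_ ?_
      · simp [List.nodup_append] at hnd ⊢
        grind
      · intro z hz; simp at hz; grind
    have := this.length_le.trans h.len
    simp at this
  rcases key with hP | hP
  · obtain ⟨s, -, hs, hsx, hsy⟩ := h.chord hB hr ha hr0 hxy hP
    exact h.noTwo s hs x hx y hy hxy.ne hsx hsy
  · obtain ⟨s, -, hs, hsx, hsy⟩ := h.chord hB (hr.trans (isRotated_arcs _ _ _ _)) hr0 ha hxy.symm hP
    exact h.noTwo s hs x hx y hy hxy.ne hsy hsx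

theorem MC.isChain_cedges [Finite V] (h : MC S H P L) {C : List V} (hB : Bd S H C) :
    P.IsChain fun x y => s(x, y) ∈ cedges C := by
  have key : ∀ l : List V, (∀ x ∈ l, x ∈ P) → l.IsChain H.Adj →
      l.IsChain fun x y => s(x, y) ∈ cedges C := by
    intro l
    induction l with
    | nil => simp
    | cons x l ih =>
      cases l with
      | nil => simp
      | cons y l =>
        intro hl hc
        rw [List.isChain_cons_cons] at hc ⊢
        exact ⟨h.edge_mem_cedges hB (hl x (by simp)) (hl y (by simp)) hc.1,
          ih (fun z hz => hl z (by simp [List.mem_cons.1 hz])) hc.2⟩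
  exact key P (fun _ hx => hx) h.chain

/-- A vertex with two colors has chords only to the middle precolored vertex. -/
theorem MC.two_nbr [Finite V] (h : MC S H P L) {C : List V} (hB : Bd S H C) {w x : V}
    (hw : (L w).card = 2) (hwx : H.Adj w x) (hx : x ∈ C) :
    s(w, x) ∈ cedges C ∨ ∃ p p', P = [p, x, p'] := by
  refine or_iff_not_imp_left.2 fun hcon => ?_
  obtain ⟨a, r, hr, ha, hr0⟩ := (mem_cedges_or_split (h.mem_of_two hB hw hwx) hx hwx.ne).resolve_left
    hcon
  have hnd := hr.perm.nodup_iff.1 (isCyc_iff.1 hB.1).1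
  by_cases h1 : ∀ p ∈ P, p ∉ a
  · obtain ⟨s, -, hs, hsw, -⟩ := h.chord hB hr ha hr0 hwx h1
    exact absurd hw (h.nn s w hsw hs)
  by_cases h2 : ∀ p ∈ P, p ∉ r
  · obtain ⟨s, -, hs, -, hsw⟩ := h.chord hB (hr.trans (isRotated_arcs _ _ _ _)) hr0 ha hwx.symm h2
    exact absurd hw (h.nn s w hsw hs)
  push Not at h1 h2
  obtain ⟨u, huP, hu⟩ := h1
  obtain ⟨v, hvP, hv⟩ := h2
  obtain ⟨p, c, p', rfl, hca, hcr, -⟩ := exists_mid (A := {x | x ∈ a}) (B := {x | x ∈ r})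
    (h.isChain_cedges hB) h.len (fun z hz hz' => by
      simp [List.nodup_append] at hnd hz hz'; grind)
    (fun y z hyz => by
      rw [mem_cedges_of_isRotated hr] at hyz
      exact ⟨fun hy hz => not_mem_cedges_arcs hnd hy hz hyz,
        fun hy hz => not_mem_cedges_arcs hnd hz hy (by rwa [Sym2.eq_swap])⟩) huP hu hvP hv
  have hc := hr.perm.mem_iff.1 (h.mem hB (v := c) (by simp))
  simp at hc hca hcr
  rcases hc with rfl | hc | rfl | hc
  · exact absurd (by simp) (h.notMem hw.ge)
  · exact absurd hc hca
  · exact ⟨p, p', rfl⟩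
  · exact absurd hc hcr

theorem exists_nbrs {C : List V} (hnd : C.Nodup) (h3 : 3 ≤ C.length) {p : V} (hp : p ∈ C) :
    ∃ x y l, C ~r (p :: x :: (l ++ [y])) ∧ x ≠ y ∧ s(p, x) ∈ cedges C ∧ s(p, y) ∈ cedges C ∧
      ∀ w, s(p, w) ∈ cedges C → w = x ∨ w = y := by
  obtain ⟨t, hr⟩ := exists_isRotated_cons hp
  have hlen := hr.perm.length_eq
  match t with
  | [] => simp at hlen; omega
  | [x] => simp at hlen; omega
  | x :: z :: t =>
    obtain ⟨l, y, hl⟩ := List.eq_nil_or_concat' (z :: t) |>.resolve_left (by simp)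
    rw [hl] at hr
    have hr2 : C ~r ([] ++ y :: p :: x :: l) := by
      refine hr.trans ?_
      have := List.isRotated_append (l := p :: x :: l) (l' := [y])
      simpa using this
    have hn2 := hr2.perm.nodup_iff.1 hnd
    refine ⟨x, y, l, hr, ?_, ?_, ?_, fun w hw => ?_⟩
    · rintro rfl; simp at hn2
    · rw [mem_cedges_of_isRotated hr2]; exact mem_cedges_of_append [y] l p x
    · rw [mem_cedges_of_isRotated hr2, Sym2.eq_swap]; exact mem_cedges_of_append [] (x :: l) y p
    · rw [mem_cedges_of_isRotated hr2] at hw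
      exact (eq_of_mem_cedges_mid hn2 hw).symm

theorem MC.length_ne_one [Finite V] (h : MC S H P L) : P.length ≠ 1 := by
  intro hlen
  obtain ⟨p, rfl⟩ := List.length_eq_one_iff.1 hlen
  obtain ⟨C, hB⟩ := h.exists_bd
  have hcyc := isCyc_iff.1 hB.1
  obtain ⟨x, y, l, -, hxy, hpx, hpy, hall⟩ := exists_nbrs hcyc.1 hcyc.2.1 (h.mem hB (v := p) (by simp))
  have key : ∀ x, s(p, x) ∈ cedges C → ∃ w, (L w).card = 2 ∧ s(p, w) ∈ cedges C ∧ w ≠ x ∧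
      H.Adj w x := by
    intro x hx
    have hpx : H.Adj p x := hB.1.closedIn _ hx
    obtain ⟨c, hc, hcP⟩ := h.exists_col
    obtain ⟨γ, hγ, hγp⟩ := Finset.exists_mem_ne (h.two x (by simp [hpx.ne']) p hpx.symm) (c p)
    by_contra hcon
    classical
    obtain ⟨φ, h1, h2, -⟩ := h.restrict le_rfl [p, x] (Function.update c x γ) (Or.inr (by simp))
      (by simp [hpx.ne]) (by simp) (by simpa using hpx)
      (by simpa using ⟨h.out p (by simp), hB.outer h.le (mem_of_mem_cedges hx).2⟩)
      (by simp [hpx.ne, hγ, hc])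
      (by
        intro u v huv hu hv
        simp at hu hv
        rcases hu with rfl | rfl <;> rcases hv with rfl | rfl <;>
          simp_all [hpx.ne, hγp.symm])
      (by simp)
      (by
        intro v hv hv2 a ha b hb hab hva hvb
        apply hcon
        simp at ha hb hv
        have hvp : H.Adj v p := by rcases ha with rfl | rfl <;> rcases hb with rfl | rfl <;> tauto
        have hvx : H.Adj v x := by rcases ha with rfl | rfl <;> rcases hb with rfl | rfl <;> tauto
        refine ⟨v, hv2, ?_, hv.2, hvx⟩
        rw [Sym2.eq_swap]
        refine (h.two_nbr hB hv2 hvp (h.mem hB (by simp))).resolve_right ?_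
        rintro ⟨_, _, h'⟩
        simp at h')
    exact h.nc ⟨φ, h1, h2⟩
  obtain ⟨w, hw, hpw, hwx, hwx'⟩ := key x hpx
  obtain ⟨w', hw', hpw', hwy, -⟩ := key y hpy
  obtain rfl : w = y := (hall w hpw).resolve_left hwx
  obtain rfl : w' = x := (hall w' hpw').resolve_right hwy
  exact h.nn w w' hwx' hw hw'

theorem MC.length_ne_two [Finite V] (h : MC S H P L) : P.length ≠ 2 := by
  intro hlen
  obtain ⟨p', p, rfl⟩ := List.length_eq_two.1 hlen
  obtain ⟨C, hB⟩ := h.exists_bd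
  have hcyc := isCyc_iff.1 hB.1
  have hpp : H.Adj p' p := by simpa using h.chain
  have hpp' := h.edge_mem_cedges hB (by simp) (by simp) hpp
  obtain ⟨x, hpx, hxp', hall⟩ : ∃ x, s(p, x) ∈ cedges C ∧ x ≠ p' ∧
      ∀ w, s(p, w) ∈ cedges C → w = x ∨ w = p' := by
    obtain ⟨x, y, l, -, hxy, hpx, hpy, hall⟩ := exists_nbrs hcyc.1 hcyc.2.1
      (h.mem hB (v := p) (by simp))
    rcases hall p' (by rwa [Sym2.eq_swap]) with rfl | rfl
    · exact ⟨y, hpy, hxy.symm, fun w hw => (hall w hw).symm⟩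
    · exact ⟨x, hpx, hxy, hall⟩
  have hpx' : H.Adj p x := hB.1.closedIn _ hpx
  have hxP : x ∉ [p', p] := by simp [hxp', hpx'.ne']
  obtain ⟨c, hc, hcP⟩ := h.exists_col
  obtain ⟨γ, hγ, hγp, hγp'⟩ : ∃ γ ∈ L x, γ ≠ c p ∧ (H.Adj x p' → γ ≠ c p') := by
    by_cases hx : H.Adj x p'
    · have h2 := h.two x hxP p hpx'.symm
      have h3 : (L x).card ≠ 2 := fun h3 => h.noTwo x h3 p' (by simp) p (by simp) hpp.ne hx hpx'.symm
      obtain ⟨γ, hγ, h1⟩ := Finset.exists_mem_notMem_of_card_lt_card (s := {c p, c p'}) (t := L x)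
        (lt_of_le_of_lt Finset.card_le_two (by omega))
      simp at h1
      exact ⟨γ, hγ, h1.1, fun _ => h1.2⟩
    · obtain ⟨γ, hγ, hγp⟩ := Finset.exists_mem_ne (h.two x hxP p hpx'.symm) (c p)
      exact ⟨γ, hγ, hγp, fun h' => absurd h' hx⟩
  have hcpp : c p' ≠ c p := fun he => h.proper p' (by simp) p (by simp) hpp
    (by rw [hcP p' (by simp), hcP p (by simp), he])
  classical
  obtain ⟨φ, h1, h2, -⟩ := h.restrict le_rfl [p', p, x] (Function.update c x γ) (Or.inr (by simp))
    (by simp [hpx'.ne, hpp.ne, hxp'.symm]) (by simp) (by simpa using ⟨hpp, hpx'⟩)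
    (by simpa using ⟨h.out p' (by simp), h.out p (by simp),
      hB.outer h.le (mem_of_mem_cedges hpx).2⟩)
    (by simp [hpx'.ne, hxp'.symm, hγ, hc])
    (by
      intro u v huv hu hv
      have e1 : Function.update c x γ p = c p := Function.update_of_ne hpx'.ne _ _
      have e2 : Function.update c x γ p' = c p' := Function.update_of_ne hxp'.symm _ _
      have e3 : Function.update c x γ x = γ := Function.update_self _ _ _
      have := huv.symm
      simp only [List.mem_cons, List.not_mem_nil, or_false] at hu hv
      rcases hu with rfl | rfl | rfl <;> rcases hv with rfl | rfl | rfl <;>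
        simp only [e1, e2, e3] <;> first | exact absurd rfl huv.ne | grind)
    (by simp)
    (by
      intro w hw hw2 a ha b hb hab hwa hwb
      simp only [List.mem_cons, List.not_mem_nil, or_false] at ha hb hw
      have nbr : ∀ z ∈ C, H.Adj w z → s(w, z) ∈ cedges C := fun z hz hwz =>
        (h.two_nbr hB hw2 hwz hz).resolve_right (by rintro ⟨_, _, h'⟩; simp at h')
      have hwp : ¬ H.Adj w p := fun hwp => by
        have := nbr p (h.mem hB (by simp)) hwp
        rw [Sym2.eq_swap] at this
        have := hall w this
        tauto
      have hx : H.Adj w x ∧ H.Adj w p' := by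
        rcases ha with rfl | rfl | rfl <;> rcases hb with rfl | rfl | rfl <;> tauto
      exact h.c4 p' p x w (h.le hpp) (h.le hpx') (h.le hx.1.symm) (h.le hx.2) hxp'.symm
        fun h' => hw (Or.inr (Or.inl h'.symm)))
  exact h.nc ⟨φ, h1, h2⟩

/-- A minimal counterexample whose boundary is `p, vs, p₁, p₂`, with `p, p₂, p₁` precolored. -/
structure Cfg (S : ParSys G) (H : SimpleGraph V) (L : V → Finset ℕ) (p p₂ p₁ : V) (vs : List V) :
    Prop where
  mc : MC S H [p, p₂, p₁] L
  bd : Bd S H (p :: (vs ++ [p₁, p₂]))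

theorem MC.length_eq [Finite V] (h : MC S H P L) : P.length = 3 := by
  have h1 := h.length_ne_one
  have h2 := h.length_ne_two
  have h3 := h.len
  have h4 : P.length ≠ 0 := fun h4 => by
    obtain ⟨p, hp, -⟩ := h.ex
    exact List.ne_nil_of_mem hp (List.length_eq_zero_iff.1 h4)
  omega

theorem MC.exists_cfg [Finite V] (h : MC S H P L) : ∃ p p₂ p₁ vs, Cfg S H L p p₂ p₁ vs := by
  obtain ⟨p, p₂, p₁, rfl⟩ := List.length_eq_three.1 h.length_eq
  obtain ⟨C, hB⟩ := h.exists_bd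
  have hcyc := isCyc_iff.1 hB.1
  have hc := h.isChain_cedges hB
  simp only [List.isChain_cons_cons] at hc
  obtain ⟨x, y, l, hr, hxy, hpx, hpy, hall⟩ := exists_nbrs hcyc.1 hcyc.2.1
    (h.mem hB (v := p₂) (by simp))
  have hne : p ≠ p₁ := by have := h.nd; simp at this; tauto
  have h1 := hall p (by rw [Sym2.eq_swap]; exact hc.1)
  have h2 := hall p₁ hc.2.1
  rcases h1 with rfl | rfl
  · obtain rfl := h2.resolve_left hne.symm
    refine ⟨p, p₂, p₁, l, h, hB.isRotated (hr.trans ?_)⟩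
    have := List.isRotated_append (l := [p₂]) (l' := p :: (l ++ [p₁]))
    simpa using this
  · obtain rfl := h2.resolve_right hne.symm
    refine ⟨p, p₂, p₁, l.reverse, h, ?_⟩
    have := (hB.isRotated hr).reverse
    simpa using this

theorem Cfg.symm {p p₂ p₁ : V} {vs : List V} (h : Cfg S H L p p₂ p₁ vs) :
    Cfg S H L p₁ p₂ p vs.reverse := by
  have hm : ∀ {x}, x ∈ [p₁, p₂, p] ↔ x ∈ [p, p₂, p₁] := by intro x; simp; tauto
  constructor
  · have m := h.mc
    constructor
    · constructor
      · exact m.le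
      · have := m.nd; simp at this ⊢; tauto
      · simp
      · have := m.chain
        simp at this ⊢
        exact ⟨this.2.symm, this.1.symm⟩
      · exact fun v hv => m.out v (hm.1 hv)
      · exact fun v hv => m.one v (hm.1 hv)
      · exact m.pos
      · exact m.sep
      · exact fun v hv => m.two v (fun h => hv (hm.2 h))
      · exact fun v hv => m.twoOuter v (fun h => hv (hm.2 h))
      · exact m.nn
      · exact fun u hu v hv => m.proper u (hm.1 hu) v (hm.1 hv)
      · exact fun x hx u hu v hv => m.noTwo x hx u (hm.1 hu) v (hm.1 hv)
    · exact m.c4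
    · exact m.nc
    · exact fun H' P' L' hg hl => m.ih H' P' L' hg (by simpa using hl)
    · obtain ⟨q, hq, hy⟩ := m.ex
      exact ⟨q, hm.2 hq, hy⟩
  · have := h.bd.reverse
    refine this.isRotated ?_
    have := List.isRotated_append (l := [p₂]) (l' := p₁ :: (vs.reverse ++ [p]))
    simp at this ⊢
    have e := List.isRotated_append (l := [p₂]) (l' := p₁ :: (vs.reverse ++ [p]))
    simpa using e

variable {p p₂ p₁ : V} {vs : List V}

theorem Cfg.adj (h : Cfg S H L p p₂ p₁ vs) : H.Adj p p₂ := by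
  have := h.mc.chain; simp at this; exact this.1

theorem Cfg.nodup (h : Cfg S H L p p₂ p₁ vs) : (p :: (vs ++ [p₁, p₂])).Nodup :=
  (isCyc_iff.1 h.bd.1).1

theorem Cfg.notMem (h : Cfg S H L p p₂ p₁ vs) {v : V} (hv : v ∈ vs) : v ∉ [p, p₂, p₁] := by
  have := h.nodup
  simp [List.nodup_append] at this ⊢
  grind

theorem Cfg.two_le (h : Cfg S H L p p₂ p₁ vs) {v : V} (hv : v ∈ vs) : 2 ≤ (L v).card := by
  obtain ⟨u, hu⟩ := h.bd.1.exists_adj (x := v) (by simp [hv])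
  exact h.mc.two v (h.notMem hv) u hu

theorem Cfg.mem_vs (h : Cfg S H L p p₂ p₁ vs) {v u : V} (hv : (L v).card = 2) (hvu : H.Adj v u) :
    v ∈ vs := by
  have h1 := h.mc.mem_of_two h.bd hv hvu
  have h2 := h.mc.notMem hv.ge
  simp at h1 h2
  tauto

theorem Cfg.not_adj [Finite V] (h : Cfg S H L p p₂ p₁ vs) : ¬ H.Adj p p₁ := by
  intro hpp
  have hn := h.nodup
  simp at hn
  refine h.mc.norm hpp (by simp; grind) ?_
  obtain ⟨c, hc, hcP⟩ := h.mc.exists_col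
  have := h.mc.proper p (by simp) p₁ (by simp) hpp
  rw [hcP p (by simp), hcP p₁ (by simp)] at this ⊢
  simpa using this

theorem Cfg.ne_nil [Finite V] (h : Cfg S H L p p₂ p₁ vs) : vs ≠ [] := by
  rintro rfl
  exact h.not_adj (h.bd.1.closedIn s(p, p₁) (by simp [cedges]))

theorem Cfg.c4 (h : Cfg S H L p p₂ p₁ vs) {a b c d : V} (h1 : H.Adj a b) (h2 : H.Adj b c)
    (h3 : H.Adj c d) (h4 : H.Adj d a) (hac : a ≠ c) (hbd : b ≠ d) : False :=
  h.mc.c4 a b c d (h.mc.le h1) (h.mc.le h2) (h.mc.le h3) (h.mc.le h4) hac hbd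

set_option maxHeartbeats 1600000 in
/-- Only `p` and `p₁` are adjacent to `p₂` on the boundary. -/
theorem Cfg.not_adj_mid [Finite V] (h : Cfg S H L p p₂ p₁ vs) {v : V} (hv : v ∈ vs) :
    ¬ H.Adj p₂ v := by
  intro hpv
  obtain ⟨x₁, y₁, rfl⟩ := List.append_of_mem hv
  have hpp := h.adj
  have hpp₁ := h.symm.adj
  have hvP := h.notMem hv
  have hn := h.nodup
  have hne : p ≠ p₁ := by simp at hn; tauto
  simp only [List.mem_cons, List.not_mem_nil, or_false, not_or] at hvP
  obtain ⟨hvp, hvp₂, hvp₁⟩ := hvP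
  have hr : (p :: (x₁ ++ v :: y₁ ++ [p₁, p₂])) ~r cyc2 p₂ v (p :: x₁) (y₁ ++ [p₁]).reverse := by
    rw [cyc2_reverse]
    have := List.isRotated_append (l' := [p₂]) (l := p :: (x₁ ++ v :: y₁ ++ [p₁]))
    simpa using this
  have hB := h.bd.isRotated hr
  have h12 := hB.1.twoPaths
  have ht : edgesL (p₂ :: (([] : List V) ++ [v])) = [s(p₂, v)] := by simp
  obtain ⟨K, k1, k2, kb, kb', -, kcl, kout⟩ := hB.split h.mc.le (q := []) (by simp)
    ⟨h12.ne, h12.b₁, by simp, h12.b₁', by simp, by simp, by simp⟩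
    ⟨h12.ne, h12.b₂, by simp, h12.b₂', by simp, by simp, by simp⟩ (by simpa using hpv) (by simp)
  rw [ht] at kout
  simp only [List.not_mem_nil, or_false] at kcl
  have kp : p ∈ K := k1 p (by simp)
  have kp₁ : p₁ ∉ K := k2 p₁ (by simp)
  obtain ⟨c, hc, hcP⟩ := h.mc.exists_col
  have hcpp : c p ≠ c p₂ := fun he => h.mc.proper p (by simp) p₂ (by simp) hpp
    (by rw [hcP p (by simp), hcP p₂ (by simp), he])
  have hcpp₁ : c p₁ ≠ c p₂ := fun he => h.mc.proper p₁ (by simp) p₂ (by simp) hpp₁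
    (by rw [hcP p₁ (by simp), hcP p₂ (by simp), he])
  have i₁ : ¬ (inside H K [s(p₂, v)]).Adj p₂ p₁ := fun h' => by
    rcases h'.2 with h' | h' | h'
    · exact kb h'
    · exact kp₁ h'
    · exact hvp₁ (Sym2.congr_right.1 (List.mem_singleton.1 h')).symm
  have hw0 : ∀ w, (L w).card = 2 → ∀ a ∈ [v, p₂, p], ∀ b ∈ [v, p₂, p], a ≠ b → H.Adj w a →
      H.Adj w b → H.Adj w v ∧ H.Adj w p₂ := by
    intro w hw a ha b hb hab hwa hwb
    have h1 : ¬ (H.Adj w p ∧ H.Adj w p₂) := fun h' =>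
      h.mc.noTwo w hw p (by simp) p₂ (by simp) hpp.ne h'.1 h'.2
    have h2 : ¬ (H.Adj w p ∧ H.Adj w v) := fun h' =>
      h.c4 hpp hpv h'.2.symm h'.1 (Ne.symm hvp) fun h' => h.mc.notMem hw.ge (by simp [h'])
    simp only [List.mem_cons, List.not_mem_nil, or_false] at ha hb
    rcases ha with rfl | rfl | rfl <;> rcases hb with rfl | rfl | rfl <;> tauto
  have hw1 : ∀ w, (L w).card = 2 → ∀ a ∈ [v, p₂, p₁], ∀ b ∈ [v, p₂, p₁], a ≠ b → H.Adj w a →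
      H.Adj w b → H.Adj w v ∧ H.Adj w p₂ := by
    intro w hw a ha b hb hab hwa hwb
    have h1 : ¬ (H.Adj w p₁ ∧ H.Adj w p₂) := fun h' =>
      h.mc.noTwo w hw p₁ (by simp) p₂ (by simp) hpp₁.ne h'.1 h'.2
    have h2 : ¬ (H.Adj w p₁ ∧ H.Adj w v) := fun h' =>
      h.c4 hpp₁ hpv h'.2.symm h'.1 (Ne.symm hvp₁) fun h' => h.mc.notMem hw.ge (by simp [h'])
    simp only [List.mem_cons, List.not_mem_nil, or_false] at ha hb
    rcases ha with rfl | rfl | rfl <;> rcases hb with rfl | rfl | rfl <;> tauto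
  classical
  have e2 : ∀ γ, Function.update c v γ p₂ = c p₂ := fun γ => Function.update_of_ne (Ne.symm hvp₂) _ _
  have e1 : ∀ γ, Function.update c v γ p = c p := fun γ => Function.update_of_ne (Ne.symm hvp) _ _
  have e3 : ∀ γ, Function.update c v γ p₁ = c p₁ := fun γ =>
    Function.update_of_ne (Ne.symm hvp₁) _ _
  have e4 : ∀ γ, Function.update c v γ v = γ := fun γ => Function.update_self _ _ _
  have hin : ∀ γ ∈ L v, γ ≠ c p₂ → (H.Adj v p → γ ≠ c p) →
      (∀ w, (L w).card = 2 → H.Adj w v → H.Adj w p₂ → w ∉ K) →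
      ∃ φ : V → ℕ, (∀ u, φ u ∈ L u) ∧ (∀ x y, H.Adj x y → x ∈ K → φ x ≠ φ y) ∧ φ v = γ := by
    intro γ hγ h2 h1 hw
    obtain ⟨φ, f1, f2, f3⟩ := h.mc.restrict (inside_le H K [s(p₂, v)]) [v, p₂, p]
      (Function.update c v γ) (Or.inl ⟨p₂, p₁, hpp₁.symm, i₁⟩)
      (by simp [hvp, hvp₂, hpp.ne']) (by simp)
      (by
        simp only [List.isChain_cons_cons, List.isChain_singleton, and_true]
        exact ⟨⟨hpv.symm, by simp [Sym2.eq_swap]⟩, hpp.symm, by simp [kp]⟩)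
      (fun u hu => kout u (by simp at hu; rw [mem_cyc2]; simp; tauto))
      (by
        intro u hu
        simp only [List.mem_cons, List.not_mem_nil, or_false] at hu
        rcases hu with rfl | rfl | rfl
        · rw [e4]; exact hγ
        · rw [e2]; exact hc _
        · rw [e1]; exact hc _)
      (by
        intro u u' huv hu hv
        have := huv.1
        have := huv.1.symm
        simp only [List.mem_cons, List.not_mem_nil, or_false] at hu hv
        rcases hu with rfl | rfl | rfl <;> rcases hv with rfl | rfl | rfl <;>
          simp only [e1, e2, e4] <;> first | exact absurd rfl huv.ne | grind)
      (by
        intro u hu hu' z hz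
        simp only [List.mem_cons, List.not_mem_nil, or_false] at hu hu'
        obtain rfl : u = p₁ := by tauto
        rcases hz.2 with h' | h' | h'
        · exact kp₁ h'
        · rcases kcl z h' u hz.1.symm with h' | h' | h'
          · exact kp₁ h'
          · tauto
          · tauto
        · have := mem_of_mem_edgesL (ht ▸ h')
          simp at this
          tauto)
      (by
        intro w hw' hw2 a ha b hb hab hwa hwb
        have h' := hw0 w hw2 a ha b hb hab hwa.1 hwb.1
        have hwK := hw w hw2 h'.1 h'.2
        have hK : ∀ a, (inside H K [s(p₂, v)]).Adj w a → a ∈ K := by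
          intro a hwa
          rcases hwa.2 with h'' | h'' | h''
          · exact absurd h'' hwK
          · exact h''
          · have := mem_of_mem_edgesL (ht ▸ h'')
            simp at this hw'
            tauto
        have haK := hK a hwa
        have hbK := hK b hwb
        simp only [List.mem_cons, List.not_mem_nil, or_false] at ha hb
        rcases ha with rfl | rfl | rfl
        · exact kb' haK
        · exact kb haK
        · rcases hb with rfl | rfl | rfl
          · exact kb' hbK
          · exact kb hbK
          · exact hab rfl)
    exact ⟨φ, f1, fun x y hxy hx => f2 x y ⟨hxy, Or.inl hx⟩, by rw [f3 v (by simp), e4]⟩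
  have hout : ∀ γ ∈ L v, γ ≠ c p₂ → (H.Adj v p₁ → γ ≠ c p₁) →
      (∀ w, (L w).card = 2 → H.Adj w v → H.Adj w p₂ → w ∈ K) →
      ∃ φ : V → ℕ, (∀ u, φ u ∈ L u) ∧ (∀ x y, H.Adj x y → x ∉ K → y ∉ K → φ x ≠ φ y) ∧
        φ v = γ := by
    intro γ hγ h2 h1 hw
    obtain ⟨φ, f1, f2, f3⟩ := h.mc.restrict (outside_le H K) [v, p₂, p₁]
      (Function.update c v γ) (Or.inl ⟨p₂, p, hpp.symm, fun h' => h'.2.2 kp⟩)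
      (by simp [hvp₁, hvp₂, hpp₁.ne']) (by simp)
      (by
        simp only [List.isChain_cons_cons, List.isChain_singleton, and_true]
        exact ⟨⟨hpv.symm, kb', kb⟩, hpp₁.symm, kb, kp₁⟩)
      (fun u hu => (h.bd.outer h.mc.le (v := u) (by simp at hu ⊢; tauto)).mono (outside_le H K))
      (by
        intro u hu
        simp only [List.mem_cons, List.not_mem_nil, or_false] at hu
        rcases hu with rfl | rfl | rfl
        · rw [e4]; exact hγ
        · rw [e2]; exact hc _
        · rw [e3]; exact hc _)
      (by
        intro u u' huv hu hv
        have := huv.1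
        have := huv.1.symm
        simp only [List.mem_cons, List.not_mem_nil, or_false] at hu hv
        rcases hu with rfl | rfl | rfl <;> rcases hv with rfl | rfl | rfl <;>
          simp only [e3, e2, e4] <;> first | exact absurd rfl huv.ne | grind)
      (by
        intro u hu hu' z hz
        simp only [List.mem_cons, List.not_mem_nil, or_false] at hu hu'
        obtain rfl : u = p := by tauto
        exact hz.2.1 kp)
      (by
        intro w hw' hw2 a ha b hb hab hwa hwb
        have h' := hw1 w hw2 a ha b hb hab hwa.1 hwb.1
        exact hwa.2.1 (hw w hw2 h'.1 h'.2))
    exact ⟨φ, f1, fun x y hxy hx hy => f2 x y ⟨hxy, hx, hy⟩, by rw [f3 v (by simp), e4]⟩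
  have fin : ∀ φ₁ φ₂ : V → ℕ, (∀ u, φ₁ u ∈ L u) → (∀ u, φ₂ u ∈ L u) →
      (∀ x y, H.Adj x y → x ∉ K → y ∉ K → φ₁ x ≠ φ₁ y) →
      (∀ x y, H.Adj x y → x ∈ K → φ₂ x ≠ φ₂ y) → φ₂ v = φ₁ v → False := by
    intro φ₁ φ₂ f1 f2 g1 g2 he
    refine h.mc.glue K f1 f2 g1 g2 fun x y hxy hx hy => ?_
    rcases kcl x hx y hxy with h' | rfl | rfl
    · exact absurd h' hy
    · exact h.mc.eq_of_mem (by simp) (f2 _) (f1 _)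
    · exact he
  by_cases hex : ∃ w, (L w).card = 2 ∧ H.Adj w v ∧ H.Adj w p₂
  · obtain ⟨w, hw, hwv, hwp⟩ := hex
    have huniq : ∀ w', H.Adj w' v → H.Adj w' p₂ → w' = w := by
      intro w' h1 h2
      by_contra hne
      exact h.c4 h1 hwv.symm hwp h2.symm hne hvp₂
    have hwP := h.mc.notMem hw.ge
    simp at hwP
    have np : ¬ H.Adj v p := fun hvp' =>
      h.c4 hvp' hpp hwp.symm hwv hvp₂ (Ne.symm hwP.1)
    have np₁ : ¬ H.Adj v p₁ := fun hvp' =>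
      h.c4 hvp' hpp₁ hwp.symm hwv hvp₂ (Ne.symm hwP.2.2)
    by_cases hwK : w ∈ K
    · obtain ⟨φ₂, f2, g2⟩ := h.mc.restrict_sub (inside_le H K [s(p₂, v)]) [p, p₂]
        ⟨p₂, p₁, hpp₁.symm, i₁⟩ (by simp)
        (by
          simp only [List.isChain_cons_cons, List.isChain_singleton, and_true]
          exact ⟨hpp, by simp [kp]⟩)
        (by
          intro u hu hu' z hz
          simp only [List.mem_cons, List.not_mem_nil, or_false] at hu hu'
          obtain rfl : u = p₁ := by tauto
          rcases hz.2 with h' | h' | h'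
          · exact kp₁ h'
          · rcases kcl z h' u hz.1.symm with h' | h' | h'
            · exact kp₁ h'
            · tauto
            · tauto
          · have := mem_of_mem_edgesL (ht ▸ h')
            simp at this
            tauto)
      have e := h.mc.eq_of_mem (v := p₂) (by simp) (f2 p₂) (hc p₂)
      obtain ⟨φ₁, f1, g1, he⟩ := hout (φ₂ v) (f2 v)
        (by rw [← e]; exact (g2 p₂ v ⟨hpv, by simp⟩).symm) (fun h' => absurd h' np₁)
        (fun w' _ h1 h2 => huniq w' h1 h2 ▸ hwK)
      exact fin φ₁ φ₂ f1 f2 g1 (fun x y hxy hx => g2 x y ⟨hxy, Or.inl hx⟩) he.symm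
    · obtain ⟨φ₁, f1, g1⟩ := h.mc.restrict_sub (outside_le H K) [p₂, p₁]
        ⟨p₂, p, hpp.symm, fun h' => h'.2.2 kp⟩ (by simp)
        (by
          simp only [List.isChain_cons_cons, List.isChain_singleton, and_true]
          exact ⟨hpp₁.symm, kb, kp₁⟩)
        (by
          intro u hu hu' z hz
          simp only [List.mem_cons, List.not_mem_nil, or_false] at hu hu'
          obtain rfl : u = p := by tauto
          exact hz.2.1 kp)
      have e := h.mc.eq_of_mem (v := p₂) (by simp) (f1 p₂) (hc p₂)
      obtain ⟨φ₂, f2, g2, he⟩ := hin (φ₁ v) (f1 v)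
        (by rw [← e]; exact (g1 p₂ v ⟨hpv, kb, kb'⟩).symm) (fun h' => absurd h' np)
        (fun w' _ h1 h2 => huniq w' h1 h2 ▸ hwK)
      exact fin φ₁ φ₂ f1 f2 (fun x y hxy hx hy => g1 x y ⟨hxy, hx, hy⟩) g2 he
  · have hnot : ¬ (H.Adj v p ∧ H.Adj v p₁) := fun h' =>
      h.c4 h'.1 hpp hpp₁.symm h'.2.symm hvp₂ hne
    have h2v := h.two_le hv
    obtain ⟨γ, hγ, h1, h2, h3⟩ : ∃ γ ∈ L v, γ ≠ c p₂ ∧ (H.Adj v p → γ ≠ c p) ∧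
        (H.Adj v p₁ → γ ≠ c p₁) := by
      have pick : ∀ z ∈ [p, p₁], z ≠ p₂ → H.Adj v z → ∃ γ ∈ L v, γ ≠ c p₂ ∧ γ ≠ c z := by
        intro z hz hz2 hvz
        have : (L v).card ≠ 2 := fun h2 =>
          h.mc.noTwo v h2 p₂ (by simp) z (by simp at hz ⊢; tauto) hz2.symm hpv.symm hvz
        obtain ⟨γ, hγ, h1⟩ := Finset.exists_mem_notMem_of_card_lt_card (s := {c p₂, c z}) (t := L v)
          (lt_of_le_of_lt Finset.card_le_two (by omega))
        simp at h1
        exact ⟨γ, hγ, h1.1, h1.2⟩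
      by_cases hp : H.Adj v p
      · obtain ⟨γ, hγ, h1, h2⟩ := pick p (by simp) hpp.ne hp
        exact ⟨γ, hγ, h1, fun _ => h2, fun h' => absurd ⟨hp, h'⟩ hnot⟩
      by_cases hp₁ : H.Adj v p₁
      · obtain ⟨γ, hγ, h1, h2⟩ := pick p₁ (by simp) hpp₁.ne hp₁
        exact ⟨γ, hγ, h1, fun h' => absurd h' hp, fun _ => h2⟩
      obtain ⟨γ, hγ, h1⟩ := Finset.exists_mem_ne h2v (c p₂)
      exact ⟨γ, hγ, h1, fun h' => absurd h' hp, fun h' => absurd h' hp₁⟩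
    obtain ⟨φ₁, f1, g1, he₁⟩ := hout γ hγ h1 h3 fun w hw h1 h2 => absurd ⟨w, hw, h1, h2⟩ hex
    obtain ⟨φ₂, f2, g2, he₂⟩ := hin γ hγ h1 h2 fun w hw h1 h2 => absurd ⟨w, hw, h1, h2⟩ hex
    exact fin φ₁ φ₂ f1 f2 g1 g2 (he₂.trans he₁.symm)

theorem bdry_eq {X : List V} (hd : p :: (vs ++ [p₁]) = X) :
    p :: (vs ++ [p₁, p₂]) = X ++ [p₂] := by
  rw [← hd]; simp

theorem Cfg.two_nbr [Finite V] (h : Cfg S H L p p₂ p₁ vs) {w x : V} (hw : (L w).card = 2)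
    (hwx : H.Adj w x) (hx : x ∈ p :: (vs ++ [p₁, p₂])) :
    s(w, x) ∈ cedges (p :: (vs ++ [p₁, p₂])) := by
  refine (h.mc.two_nbr h.bd hw hwx hx).resolve_right ?_
  rintro ⟨a, b, h'⟩
  simp at h'
  obtain ⟨-, rfl, -⟩ := h'
  exact h.not_adj_mid (h.mem_vs hw hwx) hwx.symm

theorem Cfg.eq_or_eq [Finite V] (h : Cfg S H L p p₂ p₁ vs) {X Y : List V} {x y z w : V}
    (hd : p :: (vs ++ [p₁]) = X ++ x :: y :: z :: Y)
    (hw : s(y, w) ∈ cedges (p :: (vs ++ [p₁, p₂]))) : w = x ∨ w = z := by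
  have hn := h.nodup
  rw [bdry_eq hd, List.append_assoc] at hn hw
  exact eq_of_mem_cedges_mid hn hw

theorem Cfg.adj_of_eq (h : Cfg S H L p p₂ p₁ vs) {X Y : List V} {x y : V}
    (hd : p :: (vs ++ [p₁]) = X ++ x :: y :: Y) : H.Adj x y := by
  refine h.bd.1.closedIn s(x, y) ?_
  rw [bdry_eq hd, List.append_assoc]
  exact mem_cedges_of_append _ _ _ _

theorem Cfg.nodup_of_eq (h : Cfg S H L p p₂ p₁ vs) {X : List V}
    (hd : p :: (vs ++ [p₁]) = X) : (X ++ [p₂]).Nodup := by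
  rw [← bdry_eq hd]; exact h.nodup

theorem Cfg.notMem_arc (h : Cfg S H L p p₂ p₁ vs) {X Y a : List V} {b b' : V}
    (hd : p :: (vs ++ [p₁]) = X ++ b :: (a ++ b' :: Y)) {v : V} (hv : v ∈ a) :
    v ∉ [p, p₂, p₁] ∧ v ∈ vs := by
  have hn := h.nodup_of_eq hd
  have hp : p ∈ X ++ [b] := by
    cases X with
    | nil => simp at hd; simp [hd.1]
    | cons z X => simp at hd; simp [hd.1]
  have hp₁ : p₁ ∈ Y.reverse ++ [b'] := by
    have h' := congrArg List.reverse hd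
    simp at h'
    generalize Y.reverse = Z at h' ⊢
    cases Z with
    | nil => simp at h'; simp [h'.1]
    | cons z X => simp at h'; simp [h'.1]
  have hv' : v ∈ p :: (vs ++ [p₁]) := by rw [hd]; simp [hv]
  simp [List.nodup_append] at hn hp hp₁ hv' ⊢
  grind

theorem bdry_reverse {X a Y : List V} {b b' : V}
    (hd : p :: (vs ++ [p₁]) = X ++ b :: (a ++ b' :: Y)) :
    p₁ :: (vs.reverse ++ [p]) = Y.reverse ++ b' :: (a.reverse ++ b :: X.reverse) := by
  have h' := congrArg List.reverse hd
  simpa using h'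

theorem bdry_isRotated {X a Y : List V} {b b' : V}
    (hd : p :: (vs ++ [p₁]) = X ++ b :: (a ++ b' :: Y)) :
    (p :: (vs ++ [p₁, p₂])) ~r (b :: (a ++ b' :: (Y ++ p₂ :: X))) := by
  rw [bdry_eq hd]
  have := List.isRotated_append (l := X) (l' := b :: (a ++ b' :: Y) ++ [p₂])
  simpa using this

theorem Cfg.head_of_adj [Finite V] (h : Cfg S H L p p₂ p₁ vs) {X a Y : List V} {b b' s : V}
    (hd : p :: (vs ++ [p₁]) = X ++ b :: (a ++ b' :: Y)) (hs : s ∈ a) (hs2 : (L s).card = 2)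
    (hsb : H.Adj s b) : ∃ t, a = s :: t := by
  obtain ⟨a₁, a₂, rfl⟩ := List.append_of_mem hs
  rcases List.eq_nil_or_concat' a₁ with rfl | ⟨l, z, rfl⟩
  · exact ⟨a₂, rfl⟩
  have hn := h.nodup_of_eq hd
  obtain ⟨n, Y', hY⟩ : ∃ n Y', a₂ ++ b' :: Y = n :: Y' := by cases a₂ <;> simp
  have hd' : p :: (vs ++ [p₁]) = (X ++ b :: l) ++ z :: s :: n :: Y' := by
    rw [hd, ← hY]; simp
  have hn' := h.nodup_of_eq hd'
  have hb := h.two_nbr hs2 hsb (by rw [bdry_eq hd]; simp)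
  rcases h.eq_or_eq hd' hb with rfl | rfl <;> simp [List.nodup_append] at hn'

theorem Cfg.last_of_adj [Finite V] (h : Cfg S H L p p₂ p₁ vs) {X a Y : List V} {b b' s : V}
    (hd : p :: (vs ++ [p₁]) = X ++ b :: (a ++ b' :: Y)) (hs : s ∈ a) (hs2 : (L s).card = 2)
    (hsb : H.Adj s b') : ∃ t, a = t ++ [s] := by
  obtain ⟨t, ht⟩ := h.symm.head_of_adj (bdry_reverse hd) (List.mem_reverse.2 hs) hs2 hsb
  exact ⟨t.reverse, by have := congrArg List.reverse ht; simpa using this⟩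

/-- A chord of the boundary cuts off a single vertex, with two colors. -/
theorem Cfg.chord [Finite V] (h : Cfg S H L p p₂ p₁ vs) {X a Y : List V} {b b' : V}
    (hd : p :: (vs ++ [p₁]) = X ++ b :: (a ++ b' :: Y)) (ha : a ≠ []) (hbb : H.Adj b b') :
    ∃ s, a = [s] ∧ (L s).card = 2 := by
  obtain ⟨s, hs, hs2, hsb, hsb'⟩ := h.mc.chord h.bd (bdry_isRotated hd) ha (by simp) hbb
    fun q hq hqa => (h.notMem_arc hd hqa).1 hq
  obtain ⟨t, rfl⟩ := h.head_of_adj hd hs hs2 hsb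
  obtain ⟨t', ht'⟩ := h.last_of_adj hd hs hs2 hsb'
  refine ⟨s, ?_, hs2⟩
  have hn := h.nodup_of_eq hd
  cases t' with
  | nil => simpa using ht'
  | cons z t' =>
    simp at ht'
    obtain ⟨rfl, rfl⟩ := ht'
    simp [List.nodup_append] at hn

/-- A path of length two across the boundary. -/
theorem Cfg.ear [Finite V] (h : Cfg S H L p p₂ p₁ vs) {X a Y : List V} {b b' n : V}
    (hd : p :: (vs ++ [p₁]) = X ++ b :: (a ++ b' :: Y)) (ha : a ≠ [])
    (hn : n ∉ p :: (vs ++ [p₁, p₂])) (hb : H.Adj n b) (hb' : H.Adj n b') :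
    ∃ s ∈ a, (L s).card = 2 ∧ H.Adj s n ∧
      ((H.Adj s b ∧ ∃ t, a = s :: t) ∨ (H.Adj s b' ∧ ∃ t, a = t ++ [s])) := by
  obtain ⟨s, hs, hs2, hsn, hsb⟩ := h.mc.ear h.bd (bdry_isRotated hd) ha hn hb hb'
    fun q hq hqa => (h.notMem_arc hd hqa).1 hq
  exact ⟨s, hs, hs2, hsn, hsb.imp (fun h' => ⟨h', h.head_of_adj hd hs hs2 h'⟩)
    fun h' => ⟨h', h.last_of_adj hd hs hs2 h'⟩⟩

theorem MC.tri_notMem [Finite V] (h : MC S H P L) {u x v : V} (hx : x ∉ P) (hv : v ∉ P)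
    (hux : H.Adj u x) (huv : H.Adj u v) (hxv : H.Adj x v) : u ∉ P := by
  intro hu
  have h1 := h.norm hux fun h' => hx (mem_of_mem_edgesL h').2
  have h2 := h.norm huv fun h' => hv (mem_of_mem_edgesL h').2
  obtain ⟨c, hc, hcP⟩ := h.exists_col
  rw [hcP u hu, Finset.disjoint_singleton_left, not_not] at h1 h2
  obtain ⟨φ, f1, f2⟩ := h.restrict_sub (SimpleGraph.deleteEdges_le (G := H) {s(x, v)}) P
    ⟨x, v, hxv, by simp⟩ (List.Sublist.refl _)
    (isChain_iff_edgesL.2 fun d hd => by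
      rw [SimpleGraph.edgeSet_deleteEdges]
      refine ⟨isChain_iff_edgesL.1 h.chain d hd, ?_⟩
      rintro rfl
      exact hx (mem_of_mem_edgesL hd).1)
    (fun v hv hv' => absurd hv hv')
  have hφu : φ u = c u := h.eq_of_mem hu (f1 u) (hc u)
  have key : φ x ≠ φ v := by
    intro he
    have h3 := Finset.card_le_one.1 (h.sep x v hxv) (c u) (by simp [h1, h2]) (φ x)
      (by rw [Finset.mem_inter]; exact ⟨f1 x, he ▸ f1 v⟩)
    refine f2 u x ?_ (hφu.trans h3)
    rw [SimpleGraph.deleteEdges_adj]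
    refine ⟨hux, fun h' => ?_⟩
    rcases Sym2.eq_iff.1 h' with h' | h'
    · exact hux.ne h'.1
    · exact huv.ne h'.1
  refine h.nc ⟨φ, f1, fun a b hab => ?_⟩
  by_cases hs : s(a, b) = s(x, v)
  · rcases Sym2.eq_iff.1 hs with ⟨rfl, rfl⟩ | ⟨rfl, rfl⟩
    exacts [key, key.symm]
  · exact f2 a b (by rw [SimpleGraph.deleteEdges_adj]; exact ⟨hab, hs⟩)

theorem MC.tri_notMem_of_two [Finite V] (h : MC S H P L) {u x v : V} (hx : (L x).card = 2)
    (hux : H.Adj u x) (huv : H.Adj u v) (hxv : H.Adj x v) : u ∉ P ∧ v ∉ P := by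
  have hxP := h.notMem hx.ge
  by_cases hu : u ∈ P <;> by_cases hv : v ∈ P
  · exact (h.noTwo x hx u hu v hv huv.ne hux.symm hxv).elim
  · exact absurd hu (h.tri_notMem hxP hv hux huv hxv)
  · exact absurd hv (h.tri_notMem hxP hu hxv.symm huv.symm hux.symm)
  · exact ⟨hu, hv⟩

/-- A vertex cut off by a chord has degree two. -/
theorem Cfg.deg_two [Finite V] (h : Cfg S H L p p₂ p₁ vs) {X Y : List V} {u x v : V}
    (hd : p :: (vs ++ [p₁]) = X ++ u :: x :: v :: Y) (hx : (L x).card = 2) (huv : H.Adj u v)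
    {y : V} (hxy : H.Adj x y) : y = u ∨ y = v := by
  by_contra hy
  have hux : H.Adj u x := h.adj_of_eq hd
  have hxv : H.Adj x v := h.adj_of_eq (X := X ++ [u]) (Y := Y) (by rw [hd]; simp)
  have hxP := h.mc.notMem hx.ge
  have hr := bdry_isRotated (p₂ := p₂) (X := X) (a := [x]) (Y := Y) (b := u) (b' := v)
    (by simpa using hd)
  replace hr : (p :: (vs ++ [p₁, p₂])) ~r cyc2 u v [x] (Y ++ p₂ :: X).reverse := by rw [cyc2_reverse]; exact hr
  have hB := h.bd.isRotated hr
  have h12 := hB.1.twoPaths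
  have ht : edgesL (u :: (([] : List V) ++ [v])) = [s(u, v)] := by simp
  obtain ⟨K, k1, k2, kb, kb', -, kcl, kout⟩ := hB.split h.mc.le (q := []) (by simp)
    ⟨h12.ne, h12.b₁, by simp, h12.b₁', by simp, by simp, by simp⟩
    ⟨h12.ne, h12.b₂, by simp, h12.b₂', by simp, by simp, by simp⟩ (by simpa using huv) (by simp)
  rw [ht] at kout
  simp only [List.not_mem_nil, or_false] at kcl
  have kx : x ∈ K := k1 x (by simp)
  have kP : ∀ q ∈ [p, p₂, p₁], q ∉ K := by
    intro q hq hqK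
    have := h.mc.mem hB hq
    rw [mem_cyc2] at this
    rcases this with rfl | rfl | h' | h'
    · exact kb hqK
    · exact kb' hqK
    · rw [List.mem_singleton] at h'; exact hxP (h' ▸ hq)
    · exact k2 q h' hqK
  have kp₂ : p₂ ≠ u ∧ p₂ ≠ v := by
    have := h.nodup_of_eq hd
    simp [List.nodup_append] at this
    exact ⟨fun he => by grind, fun he => by grind⟩
  have ky : y ∈ K := by have := kcl x kx y hxy; tauto
  obtain ⟨φ₁, f1, g1⟩ := h.mc.restrict_sub (outside_le H (K \ {x})) [p, p₂, p₁]
    ⟨x, y, hxy, fun h' => h'.2.2 ⟨ky, by simpa using hxy.ne'⟩⟩ (List.Sublist.refl _)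
    (isChain_iff_edgesL.2 fun d hd => by
      have := isChain_iff_edgesL.1 h.mc.chain d hd
      induction d with | _ a b
      have hm := mem_of_mem_edgesL hd
      exact ⟨this, fun h' => kP _ hm.1 h'.1, fun h' => kP _ hm.2 h'.1⟩)
    (fun v hv hv' => absurd hv hv')
  have hpp := h.adj
  obtain ⟨φ₂, f2, g2, e2⟩ := h.mc.restrict (inside_le H K [s(u, v)]) [u, x, v] φ₁
    (Or.inl ⟨p₂, p, hpp.symm, fun h' => by
      rcases h'.2 with h' | h' | h'
      · exact kP p₂ (by simp) h'
      · exact kP p (by simp) h'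
      · have := mem_of_mem_edgesL (ht ▸ h')
        simp at this
        tauto⟩)
    (by simp [hux.ne, hxv.ne, huv.ne]) (by simp)
    (by
      simp only [List.isChain_cons_cons, List.isChain_singleton, and_true]
      exact ⟨⟨hux, by simp [kx]⟩, hxv, by simp [kx]⟩)
    (fun w hw => kout w (by simp at hw; rw [mem_cyc2]; simp; tauto))
    (fun w _ => f1 w)
    (fun w w' hww hw hw' => g1 w w' ⟨hww.1, by
        rintro ⟨h1, h2⟩; simp at hw h2; rcases hw with rfl | rfl | rfl <;> tauto, by
        rintro ⟨h1, h2⟩; simp at hw' h2; rcases hw' with rfl | rfl | rfl <;> tauto⟩)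
    (by
      intro w hw hw' z hz
      rcases hz.2 with h' | h' | h'
      · exact kP w hw h'
      · have := kcl z h' w hz.1.symm
        simp at hw'
        have := kP w hw
        tauto
      · have := mem_of_mem_edgesL (ht ▸ h')
        simp at this hw'
        tauto)
    (by
      intro w hw hw2 a ha b hb hab hwa hwb
      have h1 : ¬ H.Adj w x := fun h' => h.mc.nn w x h' hw2 hx
      have h2 : ¬ (H.Adj w u ∧ H.Adj w v) := fun h' =>
        h.c4 h'.1 hux hxv h'.2.symm (by simp at hw; tauto) huv.ne
      have := hwa.1
      have := hwb.1
      simp only [List.mem_cons, List.not_mem_nil, or_false] at ha hb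
      rcases ha with rfl | rfl | rfl <;> rcases hb with rfl | rfl | rfl <;> tauto)
  refine h.mc.glue (K \ {x}) f1 f2 (fun a b hab ha hb => g1 a b ⟨hab, ha, hb⟩)
    (fun a b hab ha => g2 a b ⟨hab, Or.inl ha.1⟩) fun a b hab ha hb => e2 b ?_
  have := kcl a ha.1 b hab
  simp at hb ⊢
  tauto

/-- Remove a color from the list of a boundary vertex that has no neighbours with two colors. -/
theorem Cfg.shrink [Finite V] (h : Cfg S H L p p₂ p₁ vs) {H₀ : SimpleGraph V} (hle : H₀ ≤ H)
    {x y v : V} (hxy : H.Adj x y) (hxy' : ¬ H₀.Adj x y) (hpp : H₀.Adj p p₂) (hpp₁ : H₀.Adj p₂ p₁)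
    (hvs : v ∈ vs) (hv3 : 3 ≤ (L v).card) (hnn : ∀ w, (L w).card = 2 → ¬ H₀.Adj w v) (β : ℕ) :
    ∃ φ : V → ℕ, (∀ w, φ w ∈ L w) ∧ (∀ a b, H₀.Adj a b → φ a ≠ φ b) ∧ φ v ≠ β := by
  have hvP := h.notMem hvs
  obtain ⟨c, hc, hcP⟩ := h.mc.exists_col
  classical
  let M : V → Finset ℕ := Function.update L v ((L v).erase β)
  have M1 : M v = (L v).erase β := Function.update_self _ _ _
  have M2 : ∀ w, w ≠ v → M w = L w := fun w hw => Function.update_of_ne hw _ _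
  have Mv : 2 ≤ (M v).card := by
    rw [M1]; have := Finset.pred_card_le_card_erase (s := L v) (a := β); omega
  have ML : ∀ w, M w ⊆ L w := fun w => by
    by_cases hw : w = v
    · subst hw; rw [M1]; exact Finset.erase_subset _ _
    · rw [M2 w hw]
  have t : ∀ w, trim H₀ ∅ c M w = M w := fun w => trim_eq (by simp)
  have hpn : ∀ q ∈ [p, p₂, p₁], q ≠ v := by rintro q hq rfl; exact hvP hq
  obtain ⟨φ, f1, f2, f3⟩ := h.mc.extend hle ∅ [p, p₂, p₁] M c ML
    (fun w => by
      by_cases hw : w = v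
      · subst hw; exact Finset.card_pos.1 (by omega)
      · rw [M2 w hw]; exact h.mc.pos w)
    (Or.inl ⟨x, y, hxy, Or.inl hxy'⟩) h.mc.nd h.mc.len
    (by simpa using ⟨hpp, hpp₁⟩)
    (fun q hq => (h.mc.out q hq).mono hle) (by simp)
    (fun q hq => by
      have hq : q ∈ [p, p₂, p₁] := by simpa using hq
      rw [M2 q (hpn q hq)]; exact hc q)
    (fun a b hab ha hb he => h.mc.proper a (by simpa using ha) b (by simpa using hb) (hle hab)
      (by rw [hcP a (by simpa using ha), hcP b (by simpa using hb), he]))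
    (by simp)
    (fun w _ hw z hwz hw2 => by
      by_cases hwv : w = v
      · subst hwv
        exact (h.bd.outer h.mc.le (by simp [hvs])).mono hle
      · rw [M2 w hwv] at hw2
        exact (h.mc.twoOuter w hw z (hle hwz) hw2).mono hle)
    (fun w _ hw z hwz => by
      rw [t]
      by_cases hwv : w = v
      · subst hwv; omega
      · rw [M2 w hwv]; exact h.mc.two w hw z (hle hwz))
    (fun a b hab _ _ _ _ ha hb => by
      rw [t] at ha hb
      have key : ∀ w, H₀.Adj w v → (M w).card = 2 → False := by
        intro w hwv hw
        rw [M2 w hwv.ne] at hw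
        exact hnn w hw hwv
      by_cases hav : a = v
      · subst hav; exact (key b hab.symm hb).elim
      by_cases hbv : b = v
      · subst hbv; exact (key a hab ha).elim
      rw [M2 a hav] at ha
      rw [M2 b hbv] at hb
      exact absurd hb (h.mc.nn a b (hle hab) ha))
    (fun w _ hw hw2 a ha b hb hab hwa hwb => by
      rw [t] at hw2
      by_cases hwv : w = v
      · subst hwv
        have h2 := h.not_adj_mid hvs
        have h3 : ¬ (H.Adj w p ∧ H.Adj w p₁) := fun h' => by
          have hn := h.nodup
          simp at hn hvP
          exact h.c4 h'.1 h.adj h.symm.adj.symm h'.2.symm (by tauto) (by tauto)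
        have := hle hwa
        have := hle hwb
        have := hle hwa.symm
        have := hle hwb.symm
        simp only [List.mem_cons, List.not_mem_nil, or_false] at ha hb
        rcases ha with rfl | rfl | rfl <;> rcases hb with rfl | rfl | rfl <;> tauto
      · rw [M2 w hwv] at hw2
        exact h.mc.noTwo w hw2 a ha b hb hab (hle hwa) (hle hwb))
  refine ⟨φ, fun w => ML w (f1 w), f2, ?_⟩
  have := f1 v
  rw [M1, Finset.mem_erase] at this
  exact this.1

/-- The vertex following a triangle on the boundary has two colors. -/
theorem Cfg.next_two [Finite V] (h : Cfg S H L p p₂ p₁ vs) {X Y : List V} {u x v n : V}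
    (hd : p :: (vs ++ [p₁]) = X ++ u :: x :: v :: n :: Y) (hx : (L x).card = 2)
    (huv : H.Adj u v) : (L n).card = 2 := by
  by_contra hn2
  have hux : H.Adj u x := h.adj_of_eq hd
  have hxv : H.Adj x v := h.adj_of_eq (X := X ++ [u]) (Y := n :: Y) (by rw [hd]; simp)
  have hdeg : ∀ y, H.Adj x y → y = u ∨ y = v := fun y => h.deg_two hd hx huv
  have hvs : v ∈ vs := (h.notMem_arc (X := X) (a := [x, v]) (b := u) (b' := n) (Y := Y)
    (by simpa using hd) (v := v) (by simp)).2
  have hv3 : 3 ≤ (L v).card := by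
    have h1 := h.two_le hvs
    have h2 := h.mc.nn x v hxv hx
    omega
  have hxP := h.mc.notMem hx.ge
  have hxp : p ≠ x ∧ p₂ ≠ x ∧ p₁ ≠ x := by simp at hxP; tauto
  obtain ⟨β, hβ⟩ := Finset.not_disjoint_iff.1 (h.mc.norm hxv fun h' => hxP (mem_of_mem_edgesL h').1)
  have hβu : ∀ γ ∈ L x, γ ∈ L v → γ = β := fun γ h1 h2 =>
    Finset.card_le_one.1 (h.mc.sep x v hxv) γ (by simp [h1, h2]) β (by simp [hβ])
  obtain ⟨φ, f1, f2, f3⟩ := h.shrink (outside_le H {x}) hxv (fun h' => h'.2.1 rfl)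
    ⟨h.adj, hxp.1, hxp.2.1⟩ ⟨h.symm.adj.symm, hxp.2.1, hxp.2.2⟩ hvs hv3
    (fun w hw hwv => by
      have hm := h.two_nbr hw hwv.1 (by simp [hvs])
      rw [Sym2.eq_swap] at hm
      rcases h.eq_or_eq (X := X ++ [u]) (Y := Y) (x := x) (z := n) (by rw [hd]; simp) hm
        with rfl | rfl
      · exact hwv.2.1 rfl
      · exact hn2 hw) β
  obtain ⟨γ, hγ, hγu⟩ := Finset.exists_mem_ne (show 1 < (L x).card by omega) (φ u)
  have hγv : γ ≠ φ v := by
    rintro rfl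
    exact f3 (hβu _ hγ (f1 v))
  have key : ∀ y, H.Adj x y → γ ≠ φ y := fun y hy => by
    rcases hdeg y hy with rfl | rfl
    exacts [hγu, hγv]
  classical
  refine h.mc.nc ⟨Function.update φ x γ, fun w => ?_, fun a b hab => ?_⟩
  · by_cases hw : w = x
    · subst hw; rw [Function.update_self]; exact hγ
    · rw [Function.update_of_ne hw]; exact f1 w
  · by_cases ha : a = x
    · subst ha
      rw [Function.update_self, Function.update_of_ne hab.ne']
      exact key b hab
    by_cases hb : b = x
    · subst hb
      rw [Function.update_self, Function.update_of_ne hab.ne]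
      exact (key a hab.symm).symm
    · rw [Function.update_of_ne ha, Function.update_of_ne hb]
      exact f2 a b ⟨hab, ha, hb⟩

theorem Cfg.prev_two [Finite V] (h : Cfg S H L p p₂ p₁ vs) {X Y : List V} {n u x v : V}
    (hd : p :: (vs ++ [p₁]) = X ++ n :: u :: x :: v :: Y) (hx : (L x).card = 2)
    (huv : H.Adj u v) : (L n).card = 2 := by
  have h' := bdry_reverse (a := [u, x]) (b := n) (b' := v) (X := X) (Y := Y) (by simpa using hd)
  exact h.symm.next_two (X := Y.reverse) (Y := X.reverse) (by simpa using h') hx huv.symm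

/-- The first interior boundary vertex has two colors or is followed by such a vertex. -/
theorem Cfg.first [Finite V] (h : Cfg S H L p p₂ p₁ vs) {v n : V} {Y : List V}
    (hd : p :: (vs ++ [p₁]) = p :: v :: n :: Y) (hv : (L v).card ≠ 2) : (L n).card = 2 := by
  by_contra hn
  have hvs : v ∈ vs := (h.notMem_arc (X := []) (a := [v]) (b := p) (b' := n) (Y := Y)
    (by simpa using hd) (v := v) (by simp)).2
  have hpv : H.Adj p v := h.adj_of_eq (X := []) hd
  have hvP := h.notMem hvs
  simp at hvP
  have h2 := h.two_le hvs
  obtain ⟨c, hc, hcP⟩ := h.mc.exists_col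
  have hne : ∀ a b, a ≠ v → b ≠ v → ({s(p, v)} : Set (Sym2 V)).Mem s(a, b) → False := by
    intro a b ha hb h'
    rcases Sym2.eq_iff.1 h' with h' | h'
    exacts [hb h'.2, ha h'.1]
  obtain ⟨φ, f1, f2, f3⟩ := h.shrink (SimpleGraph.deleteEdges_le (G := H) {s(p, v)}) hpv (by simp)
    (by rw [SimpleGraph.deleteEdges_adj]; exact ⟨h.adj, hne _ _ (by tauto) (by tauto)⟩)
    (by rw [SimpleGraph.deleteEdges_adj]
        exact ⟨h.symm.adj.symm, hne _ _ (by tauto) (by tauto)⟩) hvs (by omega)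
    (fun w hw hwv => by
      rw [SimpleGraph.deleteEdges_adj] at hwv
      have hm := h.two_nbr hw hwv.1 (by simp [hvs])
      rw [Sym2.eq_swap] at hm
      rcases h.eq_or_eq (X := []) (Y := Y) (x := p) (z := n) (by rw [hd]; simp) hm
        with rfl | rfl
      · exact hwv.2 rfl
      · exact hn hw) (c p)
  have hφp : φ p = c p := h.mc.eq_of_mem (by simp) (f1 p) (hc p)
  refine h.mc.nc ⟨φ, f1, fun a b hab => ?_⟩
  by_cases hs : s(a, b) = s(p, v)
  · rcases Sym2.eq_iff.1 hs with ⟨rfl, rfl⟩ | ⟨rfl, rfl⟩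
    · rw [hφp]; exact f3.symm
    · rw [hφp]; exact f3
  · exact f2 a b (by rw [SimpleGraph.deleteEdges_adj]; exact ⟨hab, hs⟩)

/-- The uncolored vertex `w` loses the color of its neighbour `d`. -/
structure Lost (H₀ : SimpleGraph V) (D : Set V) (P' : List V) (ψ : V → ℕ) (L : V → Finset ℕ)
    (d w : V) : Prop where
  d_mem : d ∈ D
  notD : w ∉ D
  notP : w ∉ P'
  adj : H₀.Adj d w
  mem : ψ d ∈ L w

theorem MC.extend_lost [Finite V] (h : MC S H P L) {H₀ : SimpleGraph V} (hle : H₀ ≤ H)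
    (D : Set V) (P' : List V) (ψ : V → ℕ)
    (hlt : (∃ x y, H.Adj x y ∧ (¬ H₀.Adj x y ∨ x ∈ D ∨ y ∈ D)) ∨ P.length < P'.length)
    (nd : P'.Nodup) (len : P'.length ≤ 3) (chain : P'.IsChain H₀.Adj)
    (out : ∀ v ∈ P', Outer S H₀ v) (hPD : ∀ v ∈ P', v ∉ D) (hψ : ∀ v, v ∈ D ∨ v ∈ P' → ψ v ∈ L v)
    (proper : ∀ u v, H₀.Adj u v → u ∈ D ∨ u ∈ P' → v ∈ D ∨ v ∈ P' → ψ u ≠ ψ v)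
    (outD : ∀ v ∈ D, Outer S H₀ v)
    (hP : ∀ v ∈ P, v ∉ P' → v ∉ D → ∀ u, ¬ H₀.Adj v u)
    (noTwo : ∀ v, v ∉ D → v ∉ P' → (L v).card = 2 → ∀ p ∈ P', ∀ q ∈ P', p ≠ q →
      H₀.Adj v p → H₀.Adj v q → False)
    (l3 : ∀ d w, Lost H₀ D P' ψ L d w → 3 ≤ (L w).card)
    (l1 : ∀ d d' w, Lost H₀ D P' ψ L d w → Lost H₀ D P' ψ L d' w → d = d')
    (l2 : ∀ d w v, Lost H₀ D P' ψ L d w → v ∉ D → v ∉ P' → H₀.Adj w v → (L v).card ≠ 2)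
    (lnn : ∀ d d' w w', Lost H₀ D P' ψ L d w → Lost H₀ D P' ψ L d' w' → H₀.Adj w w' → d ≠ d' →
      H.Adj d d')
    (l4 : ∀ d w, Lost H₀ D P' ψ L d w → ∀ q ∈ P', ∀ q' ∈ P', q ≠ q' → H₀.Adj w q →
      H₀.Adj w q' → False) :
    ∃ φ : V → ℕ, (∀ v, φ v ∈ L v) ∧ (∀ u v, H₀.Adj u v → φ u ≠ φ v) ∧
      ∀ v, v ∈ D ∨ v ∈ P' → φ v = ψ v := by
  classical
  have t0 : ∀ w, w ∉ D → w ∉ P' → (∀ d, ¬ Lost H₀ D P' ψ L d w) → trim H₀ D ψ L w = L w := by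
    intro w hD hP hl
    ext c
    rw [mem_trim]
    refine ⟨And.left, fun hc => ⟨hc, fun d hd hdw he => hl d ⟨hd, hD, hP, hdw, he ▸ hc⟩⟩⟩
  have t1 : ∀ d w, Lost H₀ D P' ψ L d w → trim H₀ D ψ L w = (L w).erase (ψ d) := by
    intro d w hl
    ext c
    rw [mem_trim, Finset.mem_erase]
    refine ⟨fun hc => ⟨(hc.2 d hl.d_mem hl.adj).symm, hc.1⟩, fun hc => ⟨hc.2, ?_⟩⟩
    rintro d' hd hdw rfl
    obtain rfl := l1 _ _ _ hl ⟨hd, hl.notD, hl.notP, hdw, hc.2⟩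
    exact hc.1 rfl
  refine h.extend hle D P' L ψ (fun v => Finset.Subset.refl _) h.pos hlt nd len chain out hPD hψ
    proper outD ?_ ?_ ?_ ?_
  · intro v hD hP' u hvu hc
    refine (h.twoOuter v (fun hv => hP v hv hP' hD u hvu) u (hle hvu) hc).mono hle
  · intro v hD hP' u hvu
    by_cases hl : ∃ d, Lost H₀ D P' ψ L d v
    · obtain ⟨d, hl⟩ := hl
      rw [t1 d v hl, Finset.card_erase_of_mem hl.mem]
      have := l3 d v hl
      omega
    · push Not at hl
      rw [t0 v hD hP' hl]
      exact h.two v (fun hv => hP v hv hP' hD u hvu) u (hle hvu)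
  · intro u v huv huD hvD huP hvP hu hv
    by_cases h1 : ∃ d, Lost H₀ D P' ψ L d u <;> by_cases h2 : ∃ d, Lost H₀ D P' ψ L d v
    · obtain ⟨d, h1⟩ := h1
      obtain ⟨d', h2⟩ := h2
      by_cases hdd : d = d'
      · subst hdd
        rw [t1 d u h1, t1 d v h2, Finset.disjoint_left]
        intro c hc hc'
        rw [Finset.mem_erase] at hc hc'
        exact hc.1 (Finset.card_le_one.1 (h.sep u v (hle huv)) c (by simp [hc.2, hc'.2]) (ψ d)
          (by simp [h1.mem, h2.mem]))
      · have hd := lnn d d' u v h1 h2 huv hdd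
        refine (h.c4 d u v d' (h.le (hle h1.adj)) (h.le (hle huv)) (h.le (hle h2.adj.symm)) (h.le hd.symm)
          ?_ ?_).elim
        · rintro rfl; exact hvD h1.d_mem
        · rintro rfl; exact huD h2.d_mem
    · obtain ⟨d, h1⟩ := h1
      push Not at h2
      rw [t0 v hvD hvP h2] at hv
      exact (l2 d u v h1 hvD hvP huv hv).elim
    · obtain ⟨d, h2⟩ := h2
      push Not at h1
      rw [t0 u huD huP h1] at hu
      exact (l2 d v u h2 huD huP huv.symm hu).elim
    · push Not at h1 h2
      rw [t0 v hvD hvP h2] at hv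
      rw [t0 u huD huP h1] at hu
      exact (h.nn u v (hle huv) hu hv).elim
  · intro v hD hP' hc a ha b hb hab hva hvb
    by_cases hl : ∃ d, Lost H₀ D P' ψ L d v
    · obtain ⟨d, hl⟩ := hl
      exact l4 d v hl a ha b hb hab hva hvb
    · push Not at hl
      rw [t0 v hD hP' hl] at hc
      exact noTwo v hD hP' hc a ha b hb hab hva hvb

/-- Coloring a set `D` of boundary vertices first. -/
theorem Cfg.delete [Finite V] (h : Cfg S H L p p₂ p₁ vs) (D : Set V) (ψ : V → ℕ)
    (hD : ∀ v ∈ D, v ∈ vs) (hne : D.Nonempty)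
    (hψ : ∀ v, v ∈ D ∨ v ∈ [p, p₂, p₁] → ψ v ∈ L v)
    (proper : ∀ u ∈ D, ∀ v, H.Adj u v → v ∈ D ∨ v ∈ [p, p₂, p₁] → ψ u ≠ ψ v)
    (l3 : ∀ d w, Lost H D [p, p₂, p₁] ψ L d w → 3 ≤ (L w).card)
    (l1 : ∀ d d' w, Lost H D [p, p₂, p₁] ψ L d w → Lost H D [p, p₂, p₁] ψ L d' w → d = d')
    (l2 : ∀ d w v, Lost H D [p, p₂, p₁] ψ L d w → v ∉ D → H.Adj w v → (L v).card ≠ 2)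
    (lnn : ∀ d d' w w', Lost H D [p, p₂, p₁] ψ L d w → Lost H D [p, p₂, p₁] ψ L d' w' →
      H.Adj w w' → d ≠ d' → H.Adj d d')
    (l4 : ∀ d w, Lost H D [p, p₂, p₁] ψ L d w → (H.Adj w p ∧ H.Adj w p₂) ∨
      (H.Adj w p ∧ H.Adj w p₁) ∨ (H.Adj w p₂ ∧ H.Adj w p₁) → False) : False := by
  obtain ⟨d, hd⟩ := hne
  have hout : ∀ v ∈ D, Outer S H v := fun v hv => h.bd.outer h.mc.le (by simp [hD v hv])
  obtain ⟨u, hu⟩ := h.bd.1.exists_adj (x := d) (by simp [hD d hd])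
  obtain ⟨φ, f1, f2, -⟩ := h.mc.extend_lost le_rfl D [p, p₂, p₁] ψ
    (Or.inl ⟨d, u, hu, Or.inr (Or.inl hd)⟩) h.mc.nd h.mc.len h.mc.chain h.mc.out
    (fun v hv hvD => h.notMem (hD v hvD) hv) hψ
    (fun u v huv hu hv => by
      rcases hu with hu | hu
      · exact proper u hu v huv hv
      rcases hv with hv | hv
      · exact (proper v hv u huv.symm (Or.inr hu)).symm
      intro he
      refine h.mc.proper u hu v hv huv ?_
      obtain ⟨c, hc, hcP⟩ := h.mc.exists_col
      rw [hcP u hu, hcP v hv, h.mc.eq_of_mem hu (hc u) (hψ u (Or.inr hu)),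
        h.mc.eq_of_mem hv (hc v) (hψ v (Or.inr hv)), he])
    hout (fun v hv hv' => absurd hv hv')
    (fun v _ _ hv2 a ha b hb hab => h.mc.noTwo v hv2 a ha b hb hab)
    l3 l1 (fun d w v hl hvD _ => l2 d w v hl hvD) lnn
    (fun d w hl q hq q' hq' hqq hwq hwq' => by
      refine l4 d w hl ?_
      simp only [List.mem_cons, List.not_mem_nil, or_false] at hq hq'
      rcases hq with rfl | rfl | rfl <;> rcases hq' with rfl | rfl | rfl <;> tauto)
  exact h.mc.nc ⟨φ, f1, f2⟩

theorem MC.exists_pick (h : MC S H P L) {u v : V} (hv : 3 ≤ (L v).card) (hvu : H.Adj v u)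
    (c s : ℕ) : ∃ t ∈ L v, t ≠ c ∧ t ≠ s ∧
      ∀ w, H.Adj v w → H.Adj u w → s ∈ L w → t ∉ L w := by
  classical
  have huniq : ∀ w w', H.Adj v w → H.Adj u w → H.Adj v w' → H.Adj u w' → w = w' := by
    intro w w' h1 h2 h3 h4
    by_contra hne
    exact h.c4 v w u w' (h.le h1) (h.le h2.symm) (h.le h4) (h.le h3.symm) hvu.ne hne
  by_cases hs : s ∈ L v
  · have : 0 < (((L v).erase c).erase s).card := by
      have h1 := Finset.pred_card_le_card_erase (s := L v) (a := c)
      have h2 := Finset.pred_card_le_card_erase (s := (L v).erase c) (a := s)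
      omega
    obtain ⟨t, ht⟩ := Finset.card_pos.1 this
    simp only [Finset.mem_erase] at ht
    refine ⟨t, ht.2.2, ht.2.1, ht.1, fun w hvw _ hsw htw => ht.1 ?_⟩
    exact Finset.card_le_one.1 (h.sep v w hvw) t (by simp [ht, htw]) s (by simp [hs, hsw])
  · by_cases hw : ∃ w, H.Adj v w ∧ H.Adj u w
    · obtain ⟨w, hw1, hw2⟩ := hw
      have hsub : 1 ≤ (((L v).erase c) \ (L v ∩ L w)).card := by
        have h1 := Finset.pred_card_le_card_erase (s := L v) (a := c)
        have h2 := Finset.le_card_sdiff (L v ∩ L w) ((L v).erase c)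
        have h3 := h.sep v w hw1
        omega
      obtain ⟨t, ht⟩ := Finset.card_pos.1 hsub
      simp only [Finset.mem_erase, Finset.mem_sdiff, Finset.mem_inter, not_and] at ht
      refine ⟨t, ht.1.2, ht.1.1, fun he => hs (he ▸ ht.1.2), fun w' h1 h2 _ => ?_⟩
      rw [huniq w' w h1 h2 hw1 hw2]
      exact ht.2 ht.1.2
    · obtain ⟨t, ht⟩ := Finset.card_pos.1 (show 0 < ((L v).erase c).card by
        have h1 := Finset.pred_card_le_card_erase (s := L v) (a := c)
        omega)
      rw [Finset.mem_erase] at ht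
      exact ⟨t, ht.2, ht.1, fun he => hs (he ▸ ht.2), fun w h1 h2 => absurd ⟨w, h1, h2⟩ hw⟩

theorem Cfg.fwd [Finite V] (h : Cfg S H L p p₂ p₁ vs) {X Y : List V} {b w : V}
    (hd : p :: (vs ++ [p₁]) = X ++ b :: Y) (hw : w ∈ Y) (hbw : H.Adj b w) :
    (∃ Y', Y = w :: Y') ∨ ∃ s Y', Y = s :: w :: Y' ∧ (L s).card = 2 := by
  obtain ⟨a, Y', rfl⟩ := List.append_of_mem hw
  by_cases ha : a = []
  · subst ha; exact Or.inl ⟨Y', rfl⟩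
  obtain ⟨s, rfl, hs⟩ := h.chord hd ha hbw
  exact Or.inr ⟨s, Y', rfl, hs⟩

theorem Cfg.ear_two [Finite V] (h : Cfg S H L p p₂ p₁ vs) {X Y : List V} {d v w : V}
    (hd : p :: (vs ++ [p₁]) = X ++ d :: Y) (hv : v ∈ Y) (hv2 : (L v).card = 2)
    (hw : w ∉ p :: (vs ++ [p₁, p₂])) (hwd : H.Adj w d) (hwv : H.Adj w v) :
    ∃ s Y', Y = s :: Y' ∧ (L s).card = 2 ∧ H.Adj s w := by
  obtain ⟨a, Y', rfl⟩ := List.append_of_mem hv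
  by_cases ha : a = []
  · subst ha; exact ⟨v, Y', rfl, hv2, hwv.symm⟩
  obtain ⟨s, hs, hs2, hsw, ⟨hsd, t, rfl⟩ | ⟨hsv, -⟩⟩ := h.ear hd ha hw hwd hwv
  · exact ⟨s, t ++ v :: Y', rfl, hs2, hsw⟩
  · exact absurd hv2 (h.mc.nn s v hsv hs2)

theorem Cfg.ear_end [Finite V] (h : Cfg S H L p p₂ p₁ vs) {X Y : List V} {d w : V}
    (hd : p :: (vs ++ [p₁]) = X ++ d :: Y) (hY : Y ≠ [])
    (hw : w ∉ p :: (vs ++ [p₁, p₂])) (hwd : H.Adj w d) (hw₂ : H.Adj w p₂) (hw₁ : H.Adj w p₁) :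
    ∃ s Y', Y = s :: Y' ∧ (L s).card = 2 ∧ H.Adj s w := by
  have hn := h.nodup_of_eq hd
  rcases List.eq_nil_or_concat' Y with rfl | ⟨a, z, rfl⟩
  · exact absurd rfl hY
  have hz : p₁ = z := by
    have h' := congrArg List.reverse hd
    simp at h'
    exact h'.1
  subst hz
  have hwp : w ≠ p₁ := by rintro rfl; simp at hw
  have hdp : d ≠ p₂ := by rintro rfl; simp [List.nodup_append] at hn
  by_cases ha : a = []
  · subst ha
    have hdp₁ : H.Adj d p₁ := h.adj_of_eq (X := X) (Y := []) (by rw [hd]; simp)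
    exact (h.c4 hwd hdp₁ h.symm.adj hw₂.symm hwp hdp).elim
  obtain ⟨s, hs, hs2, hsw, ⟨hsd, t, rfl⟩ | ⟨hsp, -⟩⟩ := h.ear (Y := []) hd ha hw hwd hw₁
  · exact ⟨s, t ++ [p₁], rfl, hs2, hsw⟩
  · refine (h.c4 hsw.symm hsp h.symm.adj hw₂.symm hwp ?_).elim
    rintro rfl
    exact (h.notMem_arc (Y := []) hd hs).1 (by simp)

theorem Cfg.mem_bdry {X : List V} (hd : p :: (vs ++ [p₁]) = X) {w : V}
    (hw : w ∈ p :: (vs ++ [p₁, p₂])) (hP : w ∉ [p, p₂, p₁]) : w ∈ X := by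
  rw [← hd]; simp at hw hP ⊢; tauto

/-- A vertex off the boundary adjacent to `p` has no other neighbour on the path. -/
theorem Cfg.not_both (h : Cfg S H L p p₂ p₁ vs) {v w : V} (hv : v ∉ [p, p₂, p₁]) (hpv : H.Adj p v)
    (hwv : H.Adj w v) (hw : w ∉ [p, p₂, p₁]) : ¬ (H.Adj w p ∧ H.Adj w p₂) := by
  rintro ⟨h1, h2⟩
  simp at hv hw
  exact h.c4 hwv hpv.symm h.adj h2.symm (by tauto) (by tauto)

theorem Cfg.not_ends (h : Cfg S H L p p₂ p₁ vs) {w : V} (hw : w ∉ [p, p₂, p₁]) :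
    ¬ (H.Adj w p ∧ H.Adj w p₁) := by
  rintro ⟨h1, h2⟩
  have hn := h.nodup
  simp at hw hn
  exact h.c4 h1 h.adj h.symm.adj.symm h2.symm (by tauto) (by tauto)

set_option maxHeartbeats 1000000 in
/-- The first interior boundary vertex has two colors. -/
theorem Cfg.card_first [Finite V] (h : Cfg S H L p p₂ p₁ vs) {v₁ v₂ n : V} {Y : List V}
    (hd : p :: (vs ++ [p₁]) = p :: v₁ :: v₂ :: n :: Y) : (L v₁).card = 2 := by
  by_contra hne
  have hd1 : p :: (vs ++ [p₁]) = [p] ++ v₁ :: v₂ :: n :: Y := hd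
  have hd2 : p :: (vs ++ [p₁]) = [p, v₁] ++ v₂ :: n :: Y := hd
  have hv₂ : (L v₂).card = 2 := h.first hd hne
  have m1 := h.notMem_arc (X := []) (a := [v₁]) (b := p) (b' := v₂) hd (v := v₁) (by simp)
  have m2 := h.notMem_arc (X := [p]) (a := [v₂]) (b := v₁) (b' := n) hd (v := v₂) (by simp)
  have a01 : H.Adj p v₁ := h.adj_of_eq (X := []) hd
  have a12 : H.Adj v₁ v₂ := h.adj_of_eq hd1
  have a2n : H.Adj v₂ n := h.adj_of_eq hd2
  have hv3 : 3 ≤ (L v₁).card := by have := h.two_le m1.2; omega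
  have hn2 : (L n).card ≠ 2 := h.mc.nn _ _ a2n hv₂
  obtain ⟨s, hs, hsn⟩ : ∃ s ∈ L v₂, s ∉ L n := by
    by_contra hcon
    push Not at hcon
    have := h.mc.sep _ _ a2n
    rw [Finset.inter_eq_left.2 hcon] at this
    omega
  obtain ⟨c, hc, hcP⟩ := h.mc.exists_col
  obtain ⟨t, ht, htc, hts, hpick⟩ := h.mc.exists_pick hv3 a12 (c p) s
  classical
  have e1 : Function.update (Function.update c v₁ t) v₂ s v₁ = t := by
    rw [Function.update_of_ne a12.ne, Function.update_self]
  have e2 : Function.update (Function.update c v₁ t) v₂ s v₂ = s := Function.update_self _ _ _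
  have e3 : ∀ q ∈ [p, p₂, p₁], Function.update (Function.update c v₁ t) v₂ s q = c q := by
    intro q hq
    rw [Function.update_of_ne, Function.update_of_ne]
    · rintro rfl; exact m1.1 hq
    · rintro rfl; exact m2.1 hq
  generalize hψ : Function.update (Function.update c v₁ t) v₂ s = ψ at e1 e2 e3
  have hpn : (L p).card ≠ 2 := by have := h.mc.one p (by simp); omega
  have vP : ∀ v ∈ vs, ∀ q ∈ [p, p₂, p₁], H.Adj v q → (q = p ∨ q = p₁) := by
    intro v hv q hq hvq
    have := h.not_adj_mid hv
    simp only [List.mem_cons, List.not_mem_nil, or_false] at hq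
    rcases hq with rfl | rfl | rfl
    · simp
    · exact absurd hvq.symm this
    · simp
  have h1p : H.Adj v₁ p₁ → False := fun h' => h.not_ends m1.1 ⟨a01.symm, h'⟩
  have h2p : ¬ H.Adj v₂ p := fun h' => by
    have := h.two_nbr hv₂ h' (by simp)
    rcases h.eq_or_eq hd1 this with h' | h'
    · exact m1.1 (by simp [h'])
    · have := h.nodup_of_eq hd
      simp [h'] at this
  have h2n : ∀ y, H.Adj v₂ y → y ∈ p :: (vs ++ [p₁, p₂]) → y = v₁ ∨ y = n := fun y hy hy' =>
    h.eq_or_eq hd1 (h.two_nbr hv₂ hy hy')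
  have off : ∀ d w, Lost H {v₁, v₂} [p, p₂, p₁] ψ L d w → w ∉ p :: (vs ++ [p₁, p₂]) := by
    intro d w hl hwC
    have hw := Cfg.mem_bdry hd hwC hl.notP
    have hD := hl.notD
    have hP := hl.notP
    have hY : w ∈ n :: Y := by simp at hw hD hP ⊢; tauto
    rcases hl.d_mem with rfl | rfl
    · rcases h.fwd hd1 (List.mem_cons_of_mem _ hY) hl.adj with ⟨Y', hY'⟩ | ⟨s', Y', hY', -⟩
      · simp at hY'; exact hD (by simp [hY'])
      · simp at hY'
        obtain ⟨rfl, rfl, rfl⟩ := hY'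
        exact hpn (h.prev_two (X := []) hd hv₂ hl.adj)
    · rcases h.fwd hd2 hY hl.adj with ⟨Y', hY'⟩ | ⟨s', Y', hY', hs'⟩
      · simp at hY'
        obtain ⟨rfl, rfl⟩ := hY'
        have := hl.mem
        rw [e2] at this
        exact hsn this
      · simp at hY'
        obtain ⟨rfl, -⟩ := hY'
        exact hn2 hs'
  refine h.delete {v₁, v₂} ψ ?_ ⟨v₁, by simp⟩ ?_ ?_ ?_ ?_ ?_ ?_ ?_
  · rintro v (rfl | rfl)
    exacts [m1.2, m2.2]
  · rintro v ((rfl | rfl) | hv)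
    · rw [e1]; exact ht
    · rw [e2]; exact hs
    · rw [e3 v hv]; exact hc v
  · rintro u (rfl | rfl) v huv ((rfl | rfl) | hv)
    · exact (huv.ne rfl).elim
    · rw [e1, e2]; exact hts
    · rw [e1, e3 v hv]
      rcases vP _ m1.2 v hv huv with rfl | rfl
      · exact htc
      · exact (h1p huv).elim
    · rw [e1, e2]; exact hts.symm
    · exact (huv.ne rfl).elim
    · rw [e2, e3 v hv]
      rcases h2n v huv (by simp at hv ⊢; tauto) with rfl | rfl
      · exact absurd hv m1.1
      · exact fun he => hsn (he ▸ hc _)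
  · exact fun d w hl => h.mc.three h.bd (off d w hl) hl.adj.symm
  · have key : ∀ w, Lost H {v₁, v₂} [p, p₂, p₁] ψ L v₁ w → Lost H {v₁, v₂} [p, p₂, p₁] ψ L v₂ w →
        False := by
      intro w l1 l2
      have m1 := l1.mem
      have m2 := l2.mem
      rw [e1] at m1
      rw [e2] at m2
      exact hpick w l1.adj l2.adj m2 m1
    intro d d' w hl hl'
    rcases id hl.d_mem with rfl | rfl <;> rcases id hl'.d_mem with rfl | rfl
    · rfl
    · exact (key w hl hl').elim
    · exact (key w hl' hl).elim
    · rfl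
  · intro d w v hl hvD hwv hv
    have ho := off d w hl
    have hvs := h.mem_vs hv hwv.symm
    have hvP := h.notMem hvs
    have hY : v ∈ n :: Y := by
      have := Cfg.mem_bdry (p₂ := p₂) hd (w := v) (by simp [hvs]) hvP
      simp at this hvP hvD ⊢
      tauto
    have key : ¬ H.Adj w v₂ := by
      intro hw
      obtain ⟨s', Y', hY', hs', -⟩ := h.ear_two hd2 hY hv ho hw hwv
      simp at hY'
      obtain ⟨rfl, -⟩ := hY'
      exact hn2 hs'
    rcases hl.d_mem with rfl | rfl
    · obtain ⟨s', Y', hY', hs', hsw⟩ := h.ear_two hd1 (List.mem_cons_of_mem _ hY) hv ho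
        hl.adj.symm hwv
      simp at hY'
      obtain ⟨rfl, -⟩ := hY'
      exact key hsw.symm
    · exact key hl.adj.symm
  · intro d d' w w' hl hl' hww hdd
    rcases hl.d_mem with rfl | rfl <;> rcases hl'.d_mem with rfl | rfl
    · exact absurd rfl hdd
    · exact a12
    · exact a12.symm
    · exact absurd rfl hdd
  · intro d w hl hor
    have ho := off d w hl
    have hP := hl.notP
    have key : H.Adj w v₂ → H.Adj w p₂ → H.Adj w p₁ → False := by
      intro hw hw₂ hw₁
      obtain ⟨s', Y', hY', hs', -⟩ := h.ear_end hd2 (by simp) ho hw hw₂ hw₁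
      simp at hY'
      obtain ⟨rfl, -⟩ := hY'
      exact hn2 hs'
    rcases hor with ⟨h1, h2⟩ | h2 | ⟨h1, h2⟩
    · rcases hl.d_mem with rfl | rfl
      · exact h.not_both m1.1 a01 hl.adj.symm hP ⟨h1, h2⟩
      · refine h.c4 hl.adj.symm a12.symm a01.symm h1.symm ?_ ?_
        · rintro rfl; exact hl.notD (by simp)
        · rintro rfl; exact m2.1 (by simp)
    · exact h.not_ends hP h2
    · rcases hl.d_mem with rfl | rfl
      · obtain ⟨s', Y', hY', hs', hsw⟩ := h.ear_end hd1 (by simp) ho hl.adj.symm h1 h2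
        simp at hY'
        obtain ⟨rfl, -⟩ := hY'
        exact key hsw.symm h1 h2
      · exact key hl.adj.symm h1 h2

variable {v₁ v₂ n : V} {Y : List V} {c : V → ℕ} {a : ℕ}

/-- The color `a` is forced on the first interior boundary vertex. -/
structure Forced (S : ParSys G) (H : SimpleGraph V) (L : V → Finset ℕ) (p p₂ p₁ : V)
    (vs : List V) (v₁ v₂ n : V) (Y : List V) (c : V → ℕ) (a : ℕ) : Prop
    extends Cfg S H L p p₂ p₁ vs where
  hd : p :: (vs ++ [p₁]) = p :: v₁ :: v₂ :: n :: Y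
  card : (L v₁).card = 2
  col : ∀ v, c v ∈ L v
  mem_left : a ∈ L v₁
  ne : a ≠ c p
  two : ∀ x ∈ L v₁, x ≠ c p → x = a
  use : ∀ y, H.Adj v₁ y → y ≠ p → a ∈ L y

theorem Cfg.forced [Finite V] (h : Cfg S H L p p₂ p₁ vs) :
    ∃ v₁ v₂ n Y c a, Forced S H L p p₂ p₁ vs v₁ v₂ n Y c a := by
  obtain ⟨v₁, v₂, n, Y, hd⟩ : ∃ v₁ v₂ n Y, p :: (vs ++ [p₁]) = p :: v₁ :: v₂ :: n :: Y := by
    rcases vs with _ | ⟨v₁, _ | ⟨v₂, R⟩⟩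
    · exact absurd rfl h.ne_nil
    · exfalso
      have h01 : H.Adj p v₁ := h.adj_of_eq (X := []) (by simp; rfl)
      have h1p : H.Adj v₁ p₁ := h.adj_of_eq (X := [p]) (by simp; rfl)
      by_cases hv : (L v₁).card = 2
      · exact h.not_ends (h.notMem (by simp)) ⟨h01.symm, h1p⟩
      · have h1 := h.first (n := p₁) (Y := []) rfl hv
        have h2 := h.mc.one p₁ (by simp)
        omega
    · obtain ⟨n, Y, hn⟩ : ∃ n Y, R ++ [p₁] = n :: Y := by cases R <;> simp
      exact ⟨v₁, v₂, n, Y, by simp [hn]⟩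
  have hv := h.card_first hd
  have m1 := h.notMem_arc (X := []) (a := [v₁]) (b := p) (b' := v₂) hd (v := v₁) (by simp)
  have h01 : H.Adj p v₁ := h.adj_of_eq (X := []) hd
  obtain ⟨c, hc, hcP⟩ := h.mc.exists_col
  have hcp : c p ∈ L v₁ := by
    have := h.mc.norm h01 fun h' => m1.1 (mem_of_mem_edgesL h').2
    rwa [hcP p (by simp), Finset.disjoint_singleton_left, not_not] at this
  obtain ⟨a, ha, hac⟩ := Finset.exists_mem_ne (show 1 < (L v₁).card by omega) (c p)
  have hL : ∀ x ∈ L v₁, x ≠ c p → x = a := by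
    intro x hx hxc
    by_contra hxa
    have : 2 < (L v₁).card := Finset.two_lt_card.2 ⟨x, hx, a, ha, c p, hcp, hxa, hxc, hac⟩
    omega
  refine ⟨v₁, v₂, n, Y, c, a, h, hd, hv, hc, ha, hac, hL, fun y hy hyp => ?_⟩
  by_contra hay
  obtain ⟨φ, f1, f2⟩ := h.mc.restrict_sub (SimpleGraph.deleteEdges_le (G := H) {s(v₁, y)})
    [p, p₂, p₁] ⟨v₁, y, hy, by simp⟩ (List.Sublist.refl _)
    (isChain_iff_edgesL.2 fun d hd => by
      rw [SimpleGraph.edgeSet_deleteEdges]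
      refine ⟨isChain_iff_edgesL.1 h.mc.chain d hd, ?_⟩
      rintro rfl
      exact m1.1 (mem_of_mem_edgesL hd).1)
    (fun v hv hv' => absurd hv hv')
  have h1 : φ v₁ = a := by
    refine hL _ (f1 _) fun he => ?_
    have h2 := f2 v₁ p (by
      rw [SimpleGraph.deleteEdges_adj]
      refine ⟨h01.symm, fun h' => ?_⟩
      rcases Sym2.eq_iff.1 h' with h' | h'
      · exact hyp h'.2.symm
      · exact h01.ne h'.2)
    exact h2 (he.trans (h.mc.eq_of_mem (by simp) (hc p) (f1 p)))
  have key : φ v₁ ≠ φ y := fun he => hay (h1 ▸ he ▸ f1 y)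
  refine h.mc.nc ⟨φ, f1, fun u v huv => ?_⟩
  by_cases hs : s(u, v) = s(v₁, y)
  · rcases Sym2.eq_iff.1 hs with ⟨rfl, rfl⟩ | ⟨rfl, rfl⟩
    exacts [key, key.symm]
  · exact f2 u v (by rw [SimpleGraph.deleteEdges_adj]; exact ⟨huv, hs⟩)

namespace Forced

theorem hd1 (h : Forced S H L p p₂ p₁ vs v₁ v₂ n Y c a) :
    p :: (vs ++ [p₁]) = [p] ++ v₁ :: v₂ :: n :: Y := h.hd

theorem hd2 (h : Forced S H L p p₂ p₁ vs v₁ v₂ n Y c a) :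
    p :: (vs ++ [p₁]) = [p, v₁] ++ v₂ :: n :: Y := h.hd

theorem hd3 (h : Forced S H L p p₂ p₁ vs v₁ v₂ n Y c a) :
    p :: (vs ++ [p₁]) = [p, v₁, v₂] ++ n :: Y := h.hd

theorem notMem₁ (h : Forced S H L p p₂ p₁ vs v₁ v₂ n Y c a) : v₁ ∉ [p, p₂, p₁] ∧ v₁ ∈ vs :=
  h.notMem_arc (X := []) (a := [v₁]) (b := p) (b' := v₂) h.hd (by simp)

theorem notMem₂ (h : Forced S H L p p₂ p₁ vs v₁ v₂ n Y c a) : v₂ ∉ [p, p₂, p₁] ∧ v₂ ∈ vs :=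
  h.notMem_arc (X := [p]) (a := [v₂]) (b := v₁) (b' := n) h.hd (by simp)

theorem adj₀ (h : Forced S H L p p₂ p₁ vs v₁ v₂ n Y c a) : H.Adj p v₁ :=
  h.adj_of_eq (X := []) h.hd

theorem adj₁ (h : Forced S H L p p₂ p₁ vs v₁ v₂ n Y c a) : H.Adj v₁ v₂ :=
  h.adj_of_eq h.hd1

theorem adj₂ (h : Forced S H L p p₂ p₁ vs v₁ v₂ n Y c a) : H.Adj v₂ n :=
  h.adj_of_eq h.hd2

theorem three₂ (h : Forced S H L p p₂ p₁ vs v₁ v₂ n Y c a) : 3 ≤ (L v₂).card := by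
  have h1 := h.two_le h.notMem₂.2
  have h2 := h.mc.nn _ _ h.adj₁ h.card
  omega

theorem nbr₁ [Finite V] (h : Forced S H L p p₂ p₁ vs v₁ v₂ n Y c a) {w : V} (hw : H.Adj v₁ w)
    (hwC : w ∈ p :: (vs ++ [p₁, p₂])) : w = p ∨ w = v₂ :=
  h.eq_or_eq (X := []) h.hd (h.two_nbr h.card hw hwC)

theorem not_adj₂ [Finite V] (h : Forced S H L p p₂ p₁ vs v₁ v₂ n Y c a) : ¬ H.Adj v₂ p :=
  fun h' => (h.mc.tri_notMem_of_two h.card h.adj₀ h'.symm h.adj₁).1 (by simp)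

/-- A neighbour of `v₁` off the boundary has no other neighbour with two colors. -/
theorem key₁ [Finite V] (h : Forced S H L p p₂ p₁ vs v₁ v₂ n Y c a) {w v : V}
    (hwC : w ∉ p :: (vs ++ [p₁, p₂])) (hw : H.Adj v₁ w) (hv : (L v).card = 2) (hv1 : v ≠ v₁)
    (hwv : H.Adj w v) : False := by
  have hvs := h.mem_vs hv hwv.symm
  have hY : v ∈ v₂ :: n :: Y := by
    have := Cfg.mem_bdry (p₂ := p₂) h.hd (w := v) (by simp [hvs]) (h.notMem hvs)
    have := h.notMem hvs
    simp at *
    tauto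
  obtain ⟨s', Y', hY', hs', -⟩ := h.ear_two h.hd1 hY hv hwC hw.symm hwv
  simp at hY'
  obtain ⟨rfl, -⟩ := hY'
  have := h.three₂
  omega

theorem pair₁ [Finite V] (h : Forced S H L p p₂ p₁ vs v₁ v₂ n Y c a) {w : V}
    (hwC : w ∉ p :: (vs ++ [p₁, p₂])) (hw : H.Adj v₁ w)
    (hor : (H.Adj w p ∧ H.Adj w p₂) ∨ (H.Adj w p ∧ H.Adj w p₁) ∨ (H.Adj w p₂ ∧ H.Adj w p₁)) :
    False := by
  have hwP : w ∉ [p, p₂, p₁] := fun hm => hwC (by simp at hm ⊢; tauto)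
  rcases hor with h1 | h1 | ⟨h1, h2⟩
  · exact h.not_both h.notMem₁.1 h.adj₀ hw.symm hwP h1
  · exact h.not_ends hwP h1
  · obtain ⟨s', Y', hY', hs', -⟩ := h.ear_end h.hd1 (by simp) hwC hw.symm h1 h2
    simp at hY'
    obtain ⟨rfl, -⟩ := hY'
    have := h.three₂
    omega

/-- The third interior boundary vertex has two colors. -/
theorem card₃ [Finite V] (h : Forced S H L p p₂ p₁ vs v₁ v₂ n Y c a) : (L n).card = 2 := by
  by_contra hn2
  classical
  have e1 : Function.update c v₁ a v₁ = a := Function.update_self _ _ _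
  have e3 : ∀ q ∈ [p, p₂, p₁], Function.update c v₁ a q = c q := by
    intro q hq
    rw [Function.update_of_ne]
    rintro rfl; exact h.notMem₁.1 hq
  generalize hψ : Function.update c v₁ a = ψ at e1 e3
  have off : ∀ d w, Lost H {v₁} [p, p₂, p₁] ψ L d w → d = v₁ ∧ H.Adj v₁ w ∧
      (w = v₂ ∨ w ∉ p :: (vs ++ [p₁, p₂])) := by
    intro d w hl
    obtain rfl : d = v₁ := hl.d_mem
    refine ⟨rfl, hl.adj, ?_⟩
    by_cases hw : w ∈ p :: (vs ++ [p₁, p₂])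
    · rcases h.nbr₁ hl.adj hw with rfl | rfl
      · exact (hl.notP (by simp)).elim
      · exact Or.inl rfl
    · exact Or.inr hw
  refine h.delete {v₁} ψ ?_ ⟨v₁, rfl⟩ ?_ ?_ ?_ ?_ ?_ ?_ ?_
  · rintro v rfl; exact h.notMem₁.2
  · rintro v (rfl | hv)
    · rw [e1]; exact h.mem_left
    · rw [e3 v hv]; exact h.col v
  · rintro u rfl v huv (rfl | hv)
    · exact (huv.ne rfl).elim
    · rw [e1, e3 v hv]
      rcases h.nbr₁ huv (by simp at hv ⊢; tauto) with rfl | rfl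
      · exact h.ne
      · exact absurd hv h.notMem₂.1
  · intro d w hl
    obtain ⟨-, hw, rfl | ho⟩ := off d w hl
    · exact h.three₂
    · exact h.mc.three h.bd ho hw.symm
  · exact fun d d' w hl hl' => (off d w hl).1.trans (off d' w hl').1.symm
  · intro d w v hl hvD hwv hv
    obtain ⟨rfl, hw, rfl | ho⟩ := off d w hl
    · have hvs := h.mem_vs hv hwv.symm
      have := h.two_nbr hv hwv.symm (by simp [h.notMem₂.2])
      rw [Sym2.eq_swap] at this
      rcases h.eq_or_eq h.hd1 this with rfl | rfl
      · exact hvD rfl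
      · exact hn2 hv
    · exact h.key₁ ho hw hv hvD hwv
  · exact fun d d' w w' hl hl' _ hdd => absurd ((off d w hl).1.trans (off d' w' hl').1.symm) hdd
  · intro d w hl hor
    obtain ⟨rfl, hw, rfl | ho⟩ := off d w hl
    · have h1 := h.not_adj₂
      have h2 := h.not_adj_mid h.notMem₂.2
      have h3 := fun h' : H.Adj w p₂ => h2 h'.symm
      tauto
    · exact h.pair₁ ho hw hor

end Forced

theorem exists_avoid {s : Finset ℕ} (hs : s.card = 2) {x y : ℕ} (h : y ∈ s → x ∉ s) :
    ∃ e ∈ s, e ≠ x ∧ e ≠ y := by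
  by_contra hcon
  push Not at hcon
  obtain ⟨b, hb, hbx⟩ := Finset.exists_mem_ne (show 1 < s.card by omega) x
  obtain ⟨e, he, hey⟩ := Finset.exists_mem_ne (show 1 < s.card by omega) y
  have h1 : y ∈ s := hcon b hb hbx ▸ hb
  have h2 : e = x := by by_contra hx; exact hey (hcon e he hx)
  exact h h1 (h2 ▸ he)

namespace Forced

set_option maxHeartbeats 2000000 in
/-- No path of length three with interior off the boundary joins `v₁` to `x`. -/
theorem no_path [Finite V] (h : Forced S H L p p₂ p₁ vs v₁ v₂ n Y c a) {A Z : List V} {x q q' : V}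
    (hd : p :: (vs ++ [p₁]) = p :: v₁ :: v₂ :: (A ++ x :: Z)) (hx : H.Adj v₂ x)
    (hA : ∀ v ∈ A, (L v).card = 2 ∧ H.Adj v₂ v ∧ H.Adj x v ∧ ∀ y, H.Adj v y → y = v₂ ∨ y = x)
    (hq : q ∉ p :: (vs ++ [p₁, p₂])) (hq' : q' ∉ p :: (vs ++ [p₁, p₂])) (h1 : H.Adj v₁ q)
    (h2 : H.Adj q q') (h3 : H.Adj q' x) : False := by
  have h12 := h.adj₁
  have h01 := h.adj₀
  have hnd := h.nodup_of_eq hd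
  have hqX := hq
  have hqX' := hq'
  rw [bdry_eq hd] at hqX hqX'
  simp [List.nodup_append] at hnd hqX hqX'
  have hAne : ∀ v ∈ A, v ≠ v₁ ∧ v ≠ v₂ ∧ v ≠ x ∧ v ≠ q ∧ v ≠ q' ∧ v ≠ p₂ := by
    intro v hv; grind
  have ne1 : v₁ ≠ q ∧ v₁ ≠ q' ∧ v₁ ≠ x ∧ v₂ ≠ q ∧ v₂ ≠ q' ∧ q ≠ x ∧ q' ≠ x ∧ p₂ ≠ x ∧ p₂ ≠ v₁ ∧
      p₂ ≠ q ∧ p₂ ≠ q' := by grind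
  obtain ⟨n1, n2, n3, n4, n5, n6, n7, n8, n9, n10, n11⟩ := ne1
  have hd' : p :: (vs ++ [p₁]) = [p] ++ v₁ :: ((v₂ :: A) ++ x :: Z) := hd
  have hr := bdry_isRotated (p₂ := p₂) hd'
  replace hr : (p :: (vs ++ [p₁, p₂])) ~r cyc2 v₁ x (v₂ :: A) (Z ++ p₂ :: [p]).reverse := by
    rw [cyc2_reverse]; exact hr
  have hB := h.bd.isRotated hr
  have htp := hB.1.twoPaths
  have ht : edgesL (v₁ :: ([q, q'] ++ [x])) = [s(v₁, q), s(q, q'), s(q', x)] := by simp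
  have hmA : ∀ v ∈ v₂ :: A, v ∈ p :: (vs ++ [p₁, p₂]) := fun v hv => by
    rw [bdry_eq hd]; simp at hv ⊢; tauto
  have hmZ : ∀ v ∈ (Z ++ p₂ :: [p]).reverse, v ∈ p :: (vs ++ [p₁, p₂]) := fun v hv => by
    rw [bdry_eq hd]; simp at hv ⊢; tauto
  obtain ⟨K, k1, k2, kb, kb', kq, kcl, kout⟩ := hB.split h.mc.le (q := [q, q']) (by simp)
    ⟨htp.ne, htp.b₁, by simp [n1, n2], htp.b₁', by simp [n6.symm, n7.symm], by
      intro v hv hv'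
      have := hmA v hv
      simp only [List.mem_cons, List.not_mem_nil, or_false] at hv'
      rcases hv' with rfl | rfl <;> contradiction, by simp⟩
    ⟨htp.ne, htp.b₂, by simp [n1, n2], htp.b₂', by simp [n6.symm, n7.symm], by
      intro v hv hv'
      have := hmZ v hv
      simp only [List.mem_cons, List.not_mem_nil, or_false] at hv'
      rcases hv' with rfl | rfl <;> contradiction, by simp⟩
    (by simp [h1, h2, h3]) (by simp [h2.ne])
  rw [ht] at kout
  have kq1 : q ∉ K := kq q (by simp)
  have kq2 : q' ∉ K := kq q' (by simp)
  have kv₂ : v₂ ∈ K := k1 v₂ (by simp)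
  have kA : ∀ v ∈ A, v ∈ K := fun v hv => k1 v (by simp [hv])
  have kcl' : ∀ u ∈ K, ∀ y, H.Adj u y → y ∈ K ∨ y = v₁ ∨ y = x ∨ y = q ∨ y = q' := by
    intro u hu y huy
    have := kcl u hu y huy
    simpa using this
  have kP : ∀ u ∈ [p, p₂, p₁], u ∉ K := by
    intro u hu huK
    have := h.mc.mem hB hu
    rw [mem_cyc2] at this
    rcases this with rfl | rfl | h' | h'
    · exact kb huK
    · exact kb' huK
    · exact (h.notMem_arc hd' h').1 hu
    · exact k2 u h' huK
  obtain ⟨φ₁, f1, g1⟩ := h.mc.restrict_sub (outside_le H K) [p, p₂, p₁]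
    ⟨v₁, v₂, h12, fun h' => h'.2.2 kv₂⟩ (List.Sublist.refl _)
    (isChain_iff_edgesL.2 fun d hd => by
      have := isChain_iff_edgesL.1 h.mc.chain d hd
      induction d with | _ a b
      have hm := mem_of_mem_edgesL hd
      exact ⟨this, kP _ hm.1, kP _ hm.2⟩)
    (fun v hv hv' => absurd hv hv')
  have hv₁ : φ₁ v₁ = a := by
    refine h.two _ (f1 _) fun he => ?_
    exact g1 v₁ p ⟨h01.symm, kb, kP _ (by simp)⟩
      (he.trans (h.mc.eq_of_mem (by simp) (h.col p) (f1 p)))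
  obtain ⟨t, ht2, hta, htx, hpick⟩ := h.mc.exists_pick h.three₂ hx a (φ₁ x)
  have hex : ∀ v ∈ A, ∃ e ∈ L v, e ≠ t ∧ e ≠ φ₁ x := fun v hv =>
    exists_avoid (hA v hv).1 (hpick v (hA v hv).2.1 (hA v hv).2.2.1)
  choose! e e1 e2 e3 using hex
  classical
  obtain ⟨ψ, ψ1, ψ2, ψ3⟩ : ∃ ψ : V → ℕ, ψ v₂ = t ∧ (∀ v ∈ A, ψ v = e v) ∧
      ∀ v, v ≠ v₂ → v ∉ A → ψ v = φ₁ v :=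
    ⟨fun v => if v = v₂ then t else if v ∈ A then e v else φ₁ v, if_pos rfl,
      fun v hv => by dsimp only; rw [if_neg (hAne v hv).2.1, if_pos hv],
      fun v hv hv' => by dsimp only; rw [if_neg hv, if_neg hv']⟩
  have hPA : ∀ v ∈ [q, q', x], v ≠ v₂ ∧ v ∉ A ∧ v ≠ v₁ ∧ v ∉ K := by
    intro v hv
    simp only [List.mem_cons, List.not_mem_nil, or_false] at hv
    rcases hv with rfl | rfl | rfl
    · exact ⟨n4.symm, fun h' => (hAne _ h').2.2.2.1 rfl, n1.symm, kq1⟩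
    · exact ⟨n5.symm, fun h' => (hAne _ h').2.2.2.2.1 rfl, n2.symm, kq2⟩
    · exact ⟨hx.ne', fun h' => (hAne _ h').2.2.1 rfl, n3.symm, kb'⟩
  have ψP : ∀ v ∈ [q, q', x], ψ v = φ₁ v := fun v hv => ψ3 v (hPA v hv).1 (hPA v hv).2.1
  have ψ4 : ψ v₁ = φ₁ v₁ := ψ3 v₁ h12.ne fun h' => (hAne _ h').1 rfl
  have hin : ∀ u v, (inside H K [s(v₁, q), s(q, q'), s(q', x)]).Adj u v →
      u ∉ K → v ∉ K → u = v₁ ∨ u ∈ [q, q', x] := by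
    intro u v huv hu hv
    have := (huv.2.resolve_left hu).resolve_left hv
    rw [← ht] at this
    have := (mem_of_mem_edgesL this).1
    simpa using this
  have F : ∀ v u, ¬ (v = v₁ ∨ v = v₂ ∨ v ∈ A) → v ∉ [q, q', x] →
      (inside H K [s(v₁, q), s(q, q'), s(q', x)]).Adj v u → v ∉ p :: (vs ++ [p₁, p₂]) := by
    intro v u hD hP hvu hC
    have hK : v ∈ K := by
      by_contra hK
      by_cases hu : u ∈ K
      · have := kcl' u hu v hvu.1.symm
        simp at hP hD
        tauto
      · have := hin v u hvu hK hu
        tauto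
    have hm := hr.mem_iff.1 hC
    rw [mem_cyc2] at hm
    rcases hm with rfl | rfl | h' | h'
    · exact hD (by simp)
    · exact hP (by simp)
    · exact hD (by simpa using Or.inr h')
    · exact k2 v h' hK
  have F' : ∀ v u, (inside H K [s(v₁, q), s(q, q'), s(q', x)]).Adj v u →
      ¬ (v = v₁ ∨ v = v₂ ∨ v ∈ A) → v ∉ [q, q', x] → (L v).card ≠ 2 := by
    intro v u hvu hD hP hv
    have := h.mem_vs hv hvu.1
    exact F v u hD hP hvu (by simp [this])
  have nv₂ : ∀ v ∈ [q, q', x], H.Adj v₂ v → v = x := by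
    intro v hv hvv
    simp only [List.mem_cons, List.not_mem_nil, or_false] at hv
    rcases hv with rfl | rfl | rfl
    · exact (h.c4 hvv h2 h3 hx.symm n5 n6).elim
    · exact (h.c4 hvv.symm h12.symm h1 h2 n2.symm n4).elim
    · rfl
  have pA : ∀ u ∈ A, ∀ v, H.Adj u v → ψ u ≠ ψ v := by
    intro u hu v huv
    rw [ψ2 u hu]
    rcases (hA u hu).2.2.2 v huv with rfl | rfl
    · rw [ψ1]; exact e2 u hu
    · rw [ψP v (by simp)]; exact e3 u hu
  have pv₂ : ∀ v, H.Adj v₂ v → (v = v₁ ∨ v = v₂ ∨ v ∈ A) ∨ v ∈ [q, q', x] → ψ v₂ ≠ ψ v := by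
    rintro v hv ((rfl | rfl | hvA) | hvP)
    · rw [ψ1, ψ4, hv₁]; exact hta
    · exact (hv.ne rfl).elim
    · exact (pA v hvA _ hv.symm).symm
    · obtain rfl := nv₂ v hvP hv
      rw [ψ1, ψP v (by simp)]; exact htx
  have lost : ∀ d w, Lost (inside H K [s(v₁, q), s(q, q'), s(q', x)])
      {v | v = v₁ ∨ v = v₂ ∨ v ∈ A} [q, q', x] ψ L d w →
      d = v₁ ∧ H.Adj v₁ w ∧ a ∈ L w ∨ d = v₂ ∧ H.Adj v₂ w ∧ t ∈ L w := by
    intro d w hl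
    have hm := hl.mem
    rcases hl.d_mem with rfl | rfl | hd
    · rw [ψ4, hv₁] at hm; exact Or.inl ⟨rfl, hl.adj.1, hm⟩
    · rw [ψ1] at hm; exact Or.inr ⟨rfl, hl.adj.1, hm⟩
    · rcases (hA d hd).2.2.2 w hl.adj.1 with rfl | rfl
      · exact (hl.notD (by simp)).elim
      · exact (hl.notP (by simp)).elim
  have h0 := h.adj
  obtain ⟨φ₂, f2, g2, e₂⟩ := h.mc.extend_lost (inside_le H K [s(v₁, q), s(q, q'), s(q', x)])
    {v | v = v₁ ∨ v = v₂ ∨ v ∈ A} [q, q', x] ψ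
    (Or.inl ⟨p₂, p, h0.symm, Or.inl fun h' => by
      have := hin p₂ p h' (kP _ (by simp)) (kP _ (by simp))
      simp [n8, n9, n10, n11] at this⟩)
    (by simp [h2.ne, n6, n7]) (by simp)
    (by
      simp only [List.isChain_cons_cons, List.isChain_singleton, and_true]
      exact ⟨⟨h2, by simp⟩, h3, by simp⟩)
    (fun w hw => kout w (by
      rw [mem_cyc2]
      simp only [List.mem_cons, List.not_mem_nil, or_false] at hw ⊢
      rcases hw with rfl | rfl | rfl <;> simp))
    (fun v hv hD => by
      obtain ⟨b1, b2, b3, -⟩ := hPA v hv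
      exact hD.elim b3 fun hD => hD.elim b1 b2)
    (by
      rintro v ((rfl | rfl | hv) | hv)
      · rw [ψ4]; exact f1 v
      · rw [ψ1]; exact ht2
      · rw [ψ2 v hv]; exact e1 v hv
      · rw [ψP v hv]; exact f1 v)
    (by
      intro u v huv hu hv
      rcases id hu with (rfl | rfl | hu') | hu'
      · rcases id hv with (rfl | rfl | hv') | hv'
        · exact (huv.1.ne rfl).elim
        · exact (pv₂ u huv.1.symm hu).symm
        · exact (pA v hv' u huv.1.symm).symm
        · rw [ψ4, ψP v hv']; exact g1 u v ⟨huv.1, kb, (hPA v hv').2.2.2⟩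
      · exact pv₂ v huv.1 hv
      · exact pA u hu' v huv.1
      · rcases id hv with (rfl | rfl | hv') | hv'
        · rw [ψ4, ψP u hu']; exact g1 u v ⟨huv.1, (hPA u hu').2.2.2, kb⟩
        · exact (pv₂ u huv.1.symm hu).symm
        · exact (pA v hv' u huv.1.symm).symm
        · rw [ψP u hu', ψP v hv']; exact g1 u v ⟨huv.1, (hPA u hu').2.2.2, (hPA v hv').2.2.2⟩)
    (fun v hv => kout v (by
      rw [mem_cyc2]
      rcases hv with rfl | rfl | hv
      · simp
      · simp
      · simp [hv]))
    (fun v hv hP hD u hvu => F v u hD hP hvu (by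
      simp only [List.mem_cons, List.not_mem_nil, or_false] at hv
      rcases hv with rfl | rfl | rfl <;> simp))
    (fun v hD hP hv a _ b _ _ hva _ => F' v a hva hD hP hv)
    (fun d w hl => h.mc.three h.bd (F w d hl.notD hl.notP hl.adj.symm) hl.adj.1.symm)
    (by
      have key : ∀ w, H.Adj v₁ w → H.Adj v₂ w → a ∈ L w → t ∈ L w → False := by
        intro w hw1 hw2 ha ht
        refine hta (Finset.card_le_one.1 (h.mc.sep v₂ w hw2) t (by simp [ht, ht2]) a ?_)
        rw [Finset.mem_inter]
        exact ⟨h.use v₂ h12 (fun he => h.notMem₂.1 (by simp [he])), ha⟩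
      intro d d' w hl hl'
      rcases lost d w hl with ⟨rfl, b1, b2⟩ | ⟨rfl, b1, b2⟩ <;>
        rcases lost d' w hl' with ⟨rfl, b3, b4⟩ | ⟨rfl, b3, b4⟩
      · rfl
      · exact (key w b1 b3 b2 b4).elim
      · exact (key w b3 b1 b4 b2).elim
      · rfl)
    (fun d w v hl hD hP hwv => F' v w hwv.symm hD hP)
    (by
      intro d d' w w' hl hl' _ hdd
      rcases lost d w hl with ⟨rfl, -⟩ | ⟨rfl, -⟩ <;>
        rcases lost d' w' hl' with ⟨rfl, -⟩ | ⟨rfl, -⟩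
      · exact absurd rfl hdd
      · exact h12
      · exact h12.symm
      · exact absurd rfl hdd)
    (by
      intro d w hl b hb b' hb' hbb hwb hwb'
      have hD := hl.notD
      have hP := hl.notP
      have hD : ¬ (w = v₁ ∨ w = v₂ ∨ w ∈ A) := hD
      simp only [List.mem_cons, List.not_mem_nil, or_false, not_or] at hD hP
      have c1 : H.Adj v₁ w → ¬ H.Adj w q' := fun k k' => h.c4 k k' h2.symm h1.symm n2 hP.1
      have c2 : H.Adj v₁ w → ¬ H.Adj w x := fun k k' => h.c4 k k' hx.symm h12.symm n3 hD.2.1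
      have c3 : H.Adj v₂ w → ¬ H.Adj w q := fun k k' => h.c4 k k' h1.symm h12 n4 hD.1
      have c4 : H.Adj v₂ w → ¬ (H.Adj w q' ∧ H.Adj w x) := fun k k' =>
        h.c4 k k'.1 h3 hx.symm n5 hP.2.2
      simp only [List.mem_cons, List.not_mem_nil, or_false] at hb hb'
      rcases lost d w hl with ⟨-, b1, -⟩ | ⟨-, b1, -⟩ <;>
        rcases hb with rfl | rfl | rfl <;> rcases hb' with rfl | rfl | rfl <;>
        first
          | exact hbb rfl
          | exact c1 b1 hwb.1
          | exact c1 b1 hwb'.1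
          | exact c2 b1 hwb.1
          | exact c2 b1 hwb'.1
          | exact c3 b1 hwb.1
          | exact c3 b1 hwb'.1
          | exact c4 b1 ⟨hwb.1, hwb'.1⟩
          | exact c4 b1 ⟨hwb'.1, hwb.1⟩)
  refine h.mc.glue K f1 f2 (fun a b hab ha hb => g1 a b ⟨hab, ha, hb⟩)
    (fun a b hab ha => g2 a b ⟨hab, Or.inl ha⟩) fun u y huy hu hy => ?_
  rcases (kcl' u hu y huy).resolve_left hy with rfl | hP
  · rw [e₂ y (Or.inl (Or.inl rfl)), ψ4]
  · have hP : y ∈ [q, q', x] := by simp; tauto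
    rw [e₂ y (Or.inr hP), ψP y hP]

theorem notMem₃ [Finite V] (h : Forced S H L p p₂ p₁ vs v₁ v₂ n Y c a) :
    n ∉ [p, p₂, p₁] ∧ n ∈ vs := by
  have := h.mem_vs h.card₃ h.adj₂.symm
  exact ⟨h.notMem this, this⟩

theorem exists_next [Finite V] (h : Forced S H L p p₂ p₁ vs v₁ v₂ n Y c a) :
    ∃ m Z, Y = m :: Z := by
  have hd := h.hd
  cases Y with
  | nil =>
    have h' := congrArg List.reverse hd
    simp at h'
    exact (h.notMem₃.1 (by simp [h'.1])).elim
  | cons m Z => exact ⟨m, Z, rfl⟩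

theorem pair₂ (h : Forced S H L p p₂ p₁ vs v₁ v₂ n Y c a) {w : V}
    (hwC : w ∉ p :: (vs ++ [p₁, p₂])) (hw : H.Adj v₂ w) : ¬ H.Adj w p := by
  intro hwp
  refine h.c4 hw hwp h.adj₀ h.adj₁ ?_ ?_
  · rintro rfl; exact h.notMem₂.1 (by simp)
  · rintro rfl; exact hwC (by simp [h.notMem₁.2])

theorem no_common (h : Forced S H L p p₂ p₁ vs v₁ v₂ n Y c a) {w : V} {t : ℕ}
    (ht : t ∈ L v₂) (hta : t ≠ a) (hw : H.Adj v₂ w) (hwa : a ∈ L w) : t ∉ L w := fun htw =>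
  hta (Finset.card_le_one.1 (h.mc.sep v₂ w hw) t (by simp [ht, htw]) a
    (by simp [hwa, h.use v₂ h.adj₁ fun he => h.notMem₂.1 (by simp [he])]))

theorem ear_start [Finite V] (h : Forced S H L p p₂ p₁ vs v₁ v₂ n Y c a) {X Z : List V} {d w : V}
    (hd : p :: (vs ++ [p₁]) = p :: X ++ d :: Z)
    (hw : w ∉ p :: (vs ++ [p₁, p₂])) (hwd : H.Adj w d) (hw₂ : H.Adj w p₂) (hw₁ : H.Adj w p) :
    ∃ s X', X = X' ++ [s] ∧ (L s).card = 2 ∧ H.Adj s w := by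
  have hd' : p₁ :: (vs.reverse ++ [p]) = Z.reverse ++ d :: (X.reverse ++ [p]) := by
    have := congrArg List.reverse hd
    simpa using this
  obtain ⟨s, Y', hY, hs, hsw⟩ := h.symm.ear_end hd' (by simp)
    (fun h' => hw (by simp at h' ⊢; tauto)) hwd hw₂ hw₁
  rcases List.eq_nil_or_concat' X with rfl | ⟨X', z, rfl⟩
  · simp at hY
    obtain ⟨rfl, -⟩ := hY
    have := h.mc.one p (by simp)
    omega
  · simp at hY
    obtain ⟨rfl, -⟩ := hY
    exact ⟨z, X', rfl, hs, hsw⟩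

set_option maxHeartbeats 1000000 in
theorem adj₂₄ [Finite V] {m : V} (h : Forced S H L p p₂ p₁ vs v₁ v₂ n (m :: Y) c a) :
    H.Adj v₂ m := by
  by_contra hno
  have hn2 := h.card₃
  have anm : H.Adj n m := h.adj_of_eq h.hd3
  have hnd := h.nodup_of_eq h.hd
  simp at hnd
  have hm2 : (L m).card ≠ 2 := h.mc.nn _ _ anm hn2
  obtain ⟨s, hs, hsm⟩ : ∃ s ∈ L n, s ∉ L m := by
    by_contra hcon
    push Not at hcon
    have := h.mc.sep _ _ anm
    rw [Finset.inter_eq_left.2 hcon] at this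
    omega
  obtain ⟨t, ht, hta, hts, hpick⟩ := h.mc.exists_pick h.three₂ h.adj₂ a s
  have nn : ∀ w, H.Adj n w → w ∈ p :: (vs ++ [p₁, p₂]) → w = v₂ ∨ w = m := fun w hw hwC =>
    h.eq_or_eq h.hd2 (h.two_nbr hn2 hw hwC)
  have n12 : v₁ ≠ v₂ := h.adj₁.ne
  have n1n : v₁ ≠ n := by tauto
  have n2n : v₂ ≠ n := h.adj₂.ne
  have n1m : ¬ H.Adj v₁ n := fun h' => by
    rcases h.nbr₁ h' (by simp [h.notMem₃.2]) with h' | h'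
    · exact h.notMem₃.1 (by simp [h'])
    · exact n2n h'.symm
  classical
  obtain ⟨ψ, e1, e2, e3, eP⟩ : ∃ ψ : V → ℕ, ψ v₁ = a ∧ ψ v₂ = t ∧ ψ n = s ∧
      ∀ q ∈ [p, p₂, p₁], ψ q = c q := by
    refine ⟨fun v => if v = v₁ then a else if v = v₂ then t else if v = n then s else c v,
      by simp, by simp [n12.symm], by simp [n1n.symm, n2n.symm], fun q hq => ?_⟩
    dsimp only
    rw [if_neg, if_neg, if_neg]
    · rintro rfl; exact h.notMem₃.1 hq
    · rintro rfl; exact h.notMem₂.1 hq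
    · rintro rfl; exact h.notMem₁.1 hq
  have off : ∀ d w, Lost H {v₁, v₂, n} [p, p₂, p₁] ψ L d w → w ∉ p :: (vs ++ [p₁, p₂]) := by
    intro d w hl hwC
    have hw := Cfg.mem_bdry h.hd hwC hl.notP
    have hD := hl.notD
    have hP := hl.notP
    simp only [Set.mem_insert_iff, Set.mem_singleton_iff, not_or] at hD
    rcases hl.d_mem with rfl | rfl | rfl
    · rcases h.nbr₁ hl.adj hwC with rfl | rfl
      · exact hP (by simp)
      · exact hD.2.1 rfl
    · have hY : w ∈ n :: m :: Y := by simp at hw hP ⊢; tauto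
      rcases h.fwd h.hd2 hY hl.adj with ⟨Y', hY'⟩ | ⟨s', Y', hY', -⟩
      · simp at hY'; exact hD.2.2 hY'.1.symm
      · simp at hY'
        obtain ⟨rfl, rfl, rfl⟩ := hY'
        exact hno hl.adj
    · rcases nn w hl.adj hwC with rfl | rfl
      · exact hD.2.1 rfl
      · have := hl.mem
        rw [e3] at this
        exact hsm this
  have far : ∀ v ∉ ({v₁, v₂, n} : Set V), (L v).card = 2 → ∀ w, H.Adj w v → v ∈ m :: Y := by
    intro v hvD hv w hwv
    have hvs := h.mem_vs hv hwv.symm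
    have hvP := h.notMem hvs
    have := Cfg.mem_bdry (p₂ := p₂) h.hd (w := v) (by simp [hvs]) hvP
    simp at this hvP hvD ⊢
    tauto
  refine h.delete {v₁, v₂, n} ψ ?_ ⟨v₁, by simp⟩ ?_ ?_ ?_ ?_ ?_ ?_ ?_
  · rintro v (rfl | rfl | rfl)
    exacts [h.notMem₁.2, h.notMem₂.2, h.notMem₃.2]
  · rintro v ((rfl | rfl | rfl) | hv)
    · rw [e1]; exact h.mem_left
    · rw [e2]; exact ht
    · rw [e3]; exact hs
    · rw [eP v hv]; exact h.col v
  · rintro u (rfl | rfl | rfl) v huv ((rfl | rfl | rfl) | hv)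
    · exact (huv.ne rfl).elim
    · rw [e1, e2]; exact hta.symm
    · exact (n1m huv).elim
    · rw [e1, eP v hv]
      rcases h.nbr₁ huv (by simp at hv ⊢; tauto) with rfl | rfl
      · exact h.ne
      · exact absurd hv h.notMem₂.1
    · rw [e1, e2]; exact hta
    · exact (huv.ne rfl).elim
    · rw [e2, e3]; exact hts
    · simp only [List.mem_cons, List.not_mem_nil, or_false] at hv
      rcases hv with rfl | rfl | rfl
      · exact (h.not_adj₂ huv).elim
      · exact (h.not_adj_mid h.notMem₂.2 huv.symm).elim
      · have hY : v ∈ n :: m :: Y := by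
          have hv : v ∈ p :: (vs ++ [v]) := by simp
          have k0 := h.nodup
          have k1 := h.notMem₁.1
          have k2 := h.notMem₂.1
          rw [h.hd] at hv
          simp only [List.mem_cons, List.not_mem_nil, or_false, not_or] at k1 k2
          rcases List.mem_cons.1 hv with he | hv
          · simp [he] at k0
          rcases List.mem_cons.1 hv with he | hv
          · exact (k1.2.2 he.symm).elim
          rcases List.mem_cons.1 hv with he | hv
          · exact (k2.2.2 he.symm).elim
          exact hv
        rcases h.fwd h.hd2 hY huv with ⟨Y', hY'⟩ | ⟨s', Y', hY', -⟩
        · simp at hY'; exact (h.notMem₃.1 (by simp [hY'.1])).elim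
        · simp at hY'
          obtain ⟨rfl, rfl, rfl⟩ := hY'
          exact (hno huv).elim
    · exact (n1m huv.symm).elim
    · rw [e2, e3]; exact hts.symm
    · exact (huv.ne rfl).elim
    · rw [e3, eP v hv]
      rcases nn v huv (by simp at hv ⊢; tauto) with rfl | rfl
      · exact absurd hv h.notMem₂.1
      · exact fun he => hsm (he ▸ h.col _)
  · exact fun d w hl => h.mc.three h.bd (off d w hl) hl.adj.symm
  · have k12 : ∀ w, Lost H {v₁, v₂, n} [p, p₂, p₁] ψ L v₁ w →
        Lost H {v₁, v₂, n} [p, p₂, p₁] ψ L v₂ w → False := fun w l1 l2 =>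
      h.no_common ht hta l2.adj (e1 ▸ l1.mem) (e2 ▸ l2.mem)
    have k23 : ∀ w, Lost H {v₁, v₂, n} [p, p₂, p₁] ψ L v₂ w →
        Lost H {v₁, v₂, n} [p, p₂, p₁] ψ L n w → False := fun w l1 l2 =>
      hpick w l1.adj l2.adj (e3 ▸ l2.mem) (e2 ▸ l1.mem)
    have k13 : ∀ w, Lost H {v₁, v₂, n} [p, p₂, p₁] ψ L v₁ w →
        Lost H {v₁, v₂, n} [p, p₂, p₁] ψ L n w → False := fun w l1 l2 => by
      obtain ⟨s', hs', hs2, -⟩ := h.ear (X := [p]) (a := [v₂]) (b := v₁) (b' := n) h.hd1 (by simp)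
        (off _ _ l1) l1.adj.symm l2.adj.symm
      have := h.three₂
      simp at hs'
      subst hs'
      omega
    intro d d' w hl hl'
    rcases id hl.d_mem with rfl | rfl | rfl <;> rcases id hl'.d_mem with rfl | rfl | rfl
    · rfl
    · exact (k12 w hl hl').elim
    · exact (k13 w hl hl').elim
    · exact (k12 w hl' hl).elim
    · rfl
    · exact (k23 w hl hl').elim
    · exact (k13 w hl' hl).elim
    · exact (k23 w hl' hl).elim
    · rfl
  · intro d w v hl hvD hwv hv
    have ho := off d w hl
    have hY := far v hvD hv w hwv
    have key : ¬ H.Adj w n := by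
      intro hw
      obtain ⟨s', Y', hY', hs', -⟩ := h.ear_two h.hd3 hY hv ho hw hwv
      simp at hY'
      obtain ⟨rfl, -⟩ := hY'
      exact hm2 hs'
    rcases hl.d_mem with rfl | rfl | rfl
    · exact h.key₁ ho hl.adj hv (fun he => hvD (by simp [he])) hwv
    · obtain ⟨s', Y', hY', hs', hsw⟩ := h.ear_two h.hd2 (List.mem_cons_of_mem _ hY) hv ho
        hl.adj.symm hwv
      simp at hY'
      obtain ⟨rfl, -⟩ := hY'
      exact key hsw.symm
    · exact key hl.adj.symm
  · have key : ∀ w w', Lost H {v₁, v₂, n} [p, p₂, p₁] ψ L v₁ w →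
        Lost H {v₁, v₂, n} [p, p₂, p₁] ψ L n w' → H.Adj w w' → False := fun w w' hl hl' hww =>
      h.no_path (A := []) h.hd h.adj₂ (by simp) (off _ _ hl) (off _ _ hl') hl.adj hww hl'.adj.symm
    intro d d' w w' hl hl' hww hdd
    rcases id hl.d_mem with rfl | rfl | rfl <;> rcases id hl'.d_mem with rfl | rfl | rfl
    · exact absurd rfl hdd
    · exact h.adj₁
    · exact (key w w' hl hl' hww).elim
    · exact h.adj₁.symm
    · exact absurd rfl hdd
    · exact h.adj₂
    · exact (key w' w hl' hl hww.symm).elim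
    · exact h.adj₂.symm
    · exact absurd rfl hdd
  · intro d w hl hor
    have ho := off d w hl
    have key : H.Adj w n → H.Adj w p₂ → H.Adj w p₁ → False := by
      intro hw hw₂ hw₁
      obtain ⟨s', Y', hY', hs', -⟩ := h.ear_end h.hd3 (by simp) ho hw hw₂ hw₁
      simp at hY'
      obtain ⟨rfl, -⟩ := hY'
      exact hm2 hs'
    rcases hl.d_mem with rfl | rfl | rfl
    · exact h.pair₁ ho hl.adj hor
    · have := h.pair₂ ho hl.adj
      have hor : H.Adj w p₂ ∧ H.Adj w p₁ := by tauto
      obtain ⟨s', Y', hY', hs', hsw⟩ := h.ear_end h.hd2 (by simp) ho hl.adj.symm hor.1 hor.2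
      simp at hY'
      obtain ⟨rfl, -⟩ := hY'
      exact key hsw.symm hor.1 hor.2
    · rcases hor with ⟨b1, b2⟩ | b | ⟨b1, b2⟩
      · obtain ⟨s', X', hX, hs', -⟩ := h.ear_start (X := [v₁, v₂]) h.hd ho hl.adj.symm b2 b1
        have : v₂ = s' := by
          have := congrArg List.reverse hX
          simp at this
          exact this.1
        subst this
        have := h.three₂
        omega
      · exact h.not_ends hl.notP b
      · exact key hl.adj.symm b1 b2

end Forced

theorem MC.exists_pick_notMem (h : MC S H P L) {m k : V} (hm : 3 ≤ (L m).card) (hmk : H.Adj m k) :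
    ∃ t ∈ L m, t ∉ L k ∧ ∀ w, H.Adj m w → H.Adj k w → t ∉ L w := by
  classical
  have huniq : ∀ w w', H.Adj m w → H.Adj k w → H.Adj m w' → H.Adj k w' → w = w' := by
    intro w w' h1 h2 h3 h4
    by_contra hne
    exact h.c4 m w k w' (h.le h1) (h.le h2.symm) (h.le h4) (h.le h3.symm) hmk.ne hne
  have h2 := Finset.le_card_sdiff (L m ∩ L k) (L m)
  have h3 := h.sep m k hmk
  by_cases hw : ∃ w, H.Adj m w ∧ H.Adj k w
  · obtain ⟨w, hw1, hw2⟩ := hw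
    obtain ⟨t, ht⟩ := Finset.card_pos.1 (show 0 < ((L m \ (L m ∩ L k)) \ (L m ∩ L w)).card by
      have h4 := Finset.le_card_sdiff (L m ∩ L w) (L m \ (L m ∩ L k))
      have h5 := h.sep m w hw1
      omega)
    simp only [Finset.mem_sdiff, Finset.mem_inter, not_and] at ht
    refine ⟨t, ht.1.1, ht.1.2 ht.1.1, fun w' h1 h2 => ?_⟩
    rw [huniq w' w h1 h2 hw1 hw2]
    exact ht.2 ht.1.1
  · obtain ⟨t, ht⟩ := Finset.card_pos.1 (show 0 < (L m \ (L m ∩ L k)).card by omega)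
    simp only [Finset.mem_sdiff, Finset.mem_inter, not_and] at ht
    exact ⟨t, ht.1, ht.2 ht.1, fun w h1 h2 => absurd ⟨w, h1, h2⟩ hw⟩

namespace Forced

set_option maxHeartbeats 2000000 in
theorem not_adj₂₄ [Finite V] {m : V} (h : Forced S H L p p₂ p₁ vs v₁ v₂ n (m :: Y) c a) :
    ¬ H.Adj v₂ m := by
  intro h24
  have hn2 := h.card₃
  have anm : H.Adj n m := h.adj_of_eq h.hd3
  have hmP : m ∉ [p, p₂, p₁] := (h.mc.tri_notMem_of_two hn2 h.adj₂ h24 anm).2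
  have hmv : m ∈ vs := by
    have : m ∈ p :: (vs ++ [p₁]) := by rw [h.hd]; simp
    simp at this hmP
    tauto
  have hm3 : 3 ≤ (L m).card := by
    have := h.mc.nn _ _ anm hn2
    have := h.two_le hmv
    omega
  obtain ⟨k, Z, rfl⟩ : ∃ k Z, Y = k :: Z := by
    cases Y with
    | nil =>
      have h' := congrArg List.reverse h.hd
      simp at h'
      exact (hmP (by simp [h'.1])).elim
    | cons k Z => exact ⟨k, Z, rfl⟩
  have hd2 : p :: (vs ++ [p₁]) = [p, v₁] ++ v₂ :: n :: m :: k :: Z := h.hd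
  have hd4 : p :: (vs ++ [p₁]) = [p, v₁, v₂, n] ++ m :: k :: Z := h.hd
  have hk2 : (L k).card = 2 := h.next_two hd2 hn2 h24
  have amk : H.Adj m k := h.adj_of_eq hd4
  have hkv : k ∈ vs := h.mem_vs hk2 amk.symm
  have hkP := h.notMem hkv
  have nn : ∀ w, H.Adj n w → w = v₂ ∨ w = m := fun w hw => h.deg_two hd2 hn2 h24 hw
  obtain ⟨s, hs, hsk, hsw⟩ := h.mc.exists_pick_notMem hm3 amk
  obtain ⟨t, ht, hta, hts, hpick⟩ := h.mc.exists_pick h.three₂ h24 a s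
  obtain ⟨r, hr, hrt, hrs⟩ := exists_avoid hn2 (hpick n h.adj₂ anm.symm)
  have hnd := h.nodup_of_eq h.hd
  simp at hnd
  have n12 : v₁ ≠ v₂ := h.adj₁.ne
  have n1n : v₁ ≠ n := by tauto
  have n2n : v₂ ≠ n := h.adj₂.ne
  have n1m : v₁ ≠ m := by tauto
  have n2m : v₂ ≠ m := h24.ne
  have nnm : n ≠ m := anm.ne
  have a1n : ¬ H.Adj v₁ n := fun h' => by
    rcases nn _ h'.symm with h' | h'
    · exact n12 h'
    · exact n1m h'
  have a1m : ¬ H.Adj v₁ m := fun h' => by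
    rcases h.nbr₁ h' (by simp [hmv]) with h' | h'
    · exact hmP (by simp [h'])
    · exact n2m h'.symm
  classical
  obtain ⟨ψ, e1, e2, e3, e4, eP⟩ : ∃ ψ : V → ℕ, ψ v₁ = a ∧ ψ v₂ = t ∧ ψ n = r ∧ ψ m = s ∧
      ∀ q ∈ [p, p₂, p₁], ψ q = c q := by
    refine ⟨fun v => if v = v₁ then a else if v = v₂ then t else if v = n then r else
      if v = m then s else c v, by simp, by simp [n12.symm], by simp [n1n.symm, n2n.symm],
      by simp [n1m.symm, n2m.symm, nnm.symm], fun q hq => ?_⟩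
    dsimp only
    rw [if_neg, if_neg, if_neg, if_neg]
    · rintro rfl; exact hmP hq
    · rintro rfl; exact h.notMem₃.1 hq
    · rintro rfl; exact h.notMem₂.1 hq
    · rintro rfl; exact h.notMem₁.1 hq
  have fwd2 : ∀ w ∈ n :: m :: k :: Z, H.Adj v₂ w → w = n ∨ w = m := by
    intro w hw hvw
    rcases h.fwd hd2 hw hvw with ⟨Y', hY'⟩ | ⟨s', Y', hY', -⟩
    · simp at hY'; exact Or.inl hY'.1.symm
    · simp at hY'; exact Or.inr hY'.2.1.symm
  have fwd4 : ∀ w ∈ k :: Z, H.Adj m w → s ∉ L w := by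
    intro w hw hvw
    rcases h.fwd hd4 hw hvw with ⟨Y', hY'⟩ | ⟨s', Y', hY', -⟩
    · simp at hY'; exact hY'.1 ▸ hsk
    · simp at hY'
      obtain ⟨rfl, rfl⟩ := hY'
      exact hsw w hvw (h.adj_of_eq (X := [p, v₁, v₂, n, m]) (by simpa using hd4))
  have off : ∀ d w, Lost H {v₁, v₂, n, m} [p, p₂, p₁] ψ L d w →
      w ∉ p :: (vs ++ [p₁, p₂]) := by
    intro d w hl hwC
    have hw := Cfg.mem_bdry h.hd hwC hl.notP
    have hD := hl.notD
    have hP := hl.notP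
    simp only [Set.mem_insert_iff, Set.mem_singleton_iff, not_or] at hD
    have hk : w ∈ k :: Z := by simp at hw hP ⊢; tauto
    rcases hl.d_mem with rfl | rfl | rfl | rfl
    · rcases h.nbr₁ hl.adj hwC with rfl | rfl
      · exact hP (by simp)
      · exact hD.2.1 rfl
    · rcases fwd2 w (List.mem_cons_of_mem _ (List.mem_cons_of_mem _ hk)) hl.adj with rfl | rfl
      · exact hD.2.2.1 rfl
      · exact hD.2.2.2 rfl
    · rcases nn w hl.adj with rfl | rfl
      · exact hD.2.1 rfl
      · exact hD.2.2.2 rfl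
    · exact fwd4 w hk hl.adj (e4 ▸ hl.mem)
  have lastMem : p₁ ∈ k :: Z := by
    have hv : p₁ ∈ p :: (vs ++ [p₁]) := by simp
    have k0 := h.nodup
    have k1 := h.notMem₁.1
    have k2 := h.notMem₂.1
    have k3 := h.notMem₃.1
    rw [h.hd] at hv
    simp only [List.mem_cons, List.not_mem_nil, or_false, not_or] at k1 k2 k3 hmP
    rcases List.mem_cons.1 hv with he | hv
    · simp [he] at k0
    rcases List.mem_cons.1 hv with he | hv
    · exact (k1.2.2 he.symm).elim
    rcases List.mem_cons.1 hv with he | hv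
    · exact (k2.2.2 he.symm).elim
    rcases List.mem_cons.1 hv with he | hv
    · exact (k3.2.2 he.symm).elim
    rcases List.mem_cons.1 hv with he | hv
    · exact (hmP.2.2 he.symm).elim
    exact hv
  have notN : ∀ w, w ∉ p :: (vs ++ [p₁, p₂]) → ¬ H.Adj n w := by
    intro w hw hnw
    rcases nn w hnw with rfl | rfl
    · exact hw (by simp [h.notMem₂.2])
    · exact hw (by simp [hmv])
  have far : ∀ v ∉ ({v₁, v₂, n, m} : Set V), (L v).card = 2 → ∀ w, H.Adj w v → v ∈ k :: Z := by
    intro v hvD hv w hwv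
    have hvs := h.mem_vs hv hwv.symm
    have hvP := h.notMem hvs
    have := Cfg.mem_bdry (p₂ := p₂) h.hd (w := v) (by simp [hvs]) hvP
    simp at this hvP hvD ⊢
    tauto
  refine h.delete {v₁, v₂, n, m} ψ ?_ ⟨v₁, by simp⟩ ?_ ?_ ?_ ?_ ?_ ?_ ?_
  · rintro v (rfl | rfl | rfl | rfl)
    exacts [h.notMem₁.2, h.notMem₂.2, h.notMem₃.2, hmv]
  · rintro v ((rfl | rfl | rfl | rfl) | hv)
    · rw [e1]; exact h.mem_left
    · rw [e2]; exact ht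
    · rw [e3]; exact hr
    · rw [e4]; exact hs
    · rw [eP v hv]; exact h.col v
  · rintro u (rfl | rfl | rfl | rfl) v huv ((rfl | rfl | rfl | rfl) | hv)
    · exact (huv.ne rfl).elim
    · rw [e1, e2]; exact hta.symm
    · exact (a1n huv).elim
    · exact (a1m huv).elim
    · rw [e1, eP v hv]
      rcases h.nbr₁ huv (by simp at hv ⊢; tauto) with rfl | rfl
      · exact h.ne
      · exact absurd hv h.notMem₂.1
    · rw [e1, e2]; exact hta
    · exact (huv.ne rfl).elim
    · rw [e2, e3]; exact hrt.symm
    · rw [e2, e4]; exact hts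
    · simp only [List.mem_cons, List.not_mem_nil, or_false] at hv
      rcases hv with rfl | rfl | rfl
      · exact (h.not_adj₂ huv).elim
      · exact (h.not_adj_mid h.notMem₂.2 huv.symm).elim
      · rcases fwd2 v (List.mem_cons_of_mem _ (List.mem_cons_of_mem _ lastMem)) huv with rfl | rfl
        · exact (h.notMem₃.1 (by simp)).elim
        · exact (hmP (by simp)).elim
    · exact (a1n huv.symm).elim
    · rw [e2, e3]; exact hrt
    · exact (huv.ne rfl).elim
    · rw [e3, e4]; exact hrs
    · rcases nn v huv with rfl | rfl
      · exact absurd hv h.notMem₂.1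
      · exact absurd hv hmP
    · exact (a1m huv.symm).elim
    · rw [e2, e4]; exact hts.symm
    · rw [e3, e4]; exact hrs.symm
    · exact (huv.ne rfl).elim
    · simp only [List.mem_cons, List.not_mem_nil, or_false] at hv
      rcases hv with rfl | rfl | rfl
      · obtain ⟨s', hs', -⟩ := h.chord (X := []) (a := [v₁, v₂, n]) (Y := k :: Z) h.hd (by simp)
          huv.symm
        simp at hs'
      · exact (h.not_adj_mid hmv huv.symm).elim
      · rw [e4]
        exact fun he => fwd4 v lastMem huv (he ▸ eP v (by simp) ▸ h.col v)
  · exact fun d w hl => h.mc.three h.bd (off d w hl) hl.adj.symm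
  · have k12 : ∀ w, Lost H {v₁, v₂, n, m} [p, p₂, p₁] ψ L v₁ w →
        Lost H {v₁, v₂, n, m} [p, p₂, p₁] ψ L v₂ w → False := fun w l1 l2 =>
      h.no_common ht hta l2.adj (e1 ▸ l1.mem) (e2 ▸ l2.mem)
    have k24 : ∀ w, Lost H {v₁, v₂, n, m} [p, p₂, p₁] ψ L v₂ w →
        Lost H {v₁, v₂, n, m} [p, p₂, p₁] ψ L m w → False := fun w l1 l2 =>
      hpick w l1.adj l2.adj (e4 ▸ l2.mem) (e2 ▸ l1.mem)
    have k14 : ∀ w, Lost H {v₁, v₂, n, m} [p, p₂, p₁] ψ L v₁ w →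
        Lost H {v₁, v₂, n, m} [p, p₂, p₁] ψ L m w → False := fun w l1 l2 => by
      obtain ⟨s', hs', hs2, hsw, -⟩ := h.ear (X := [p]) (a := [v₂, n]) (b := v₁) (b' := m) h.hd
        (by simp) (off _ _ l1) l1.adj.symm l2.adj.symm
      have := h.three₂
      simp at hs'
      rcases hs' with rfl | rfl
      · omega
      · exact notN w (off _ _ l1) hsw
    have k3 : ∀ w, ¬ Lost H {v₁, v₂, n, m} [p, p₂, p₁] ψ L n w := fun w l =>
      notN w (off _ _ l) l.adj
    intro d d' w hl hl'
    rcases id hl.d_mem with rfl | rfl | rfl | rfl <;>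
      rcases id hl'.d_mem with rfl | rfl | rfl | rfl
    · rfl
    · exact (k12 w hl hl').elim
    · exact (k3 w hl').elim
    · exact (k14 w hl hl').elim
    · exact (k12 w hl' hl).elim
    · rfl
    · exact (k3 w hl').elim
    · exact (k24 w hl hl').elim
    · exact (k3 w hl).elim
    · exact (k3 w hl).elim
    · rfl
    · exact (k3 w hl).elim
    · exact (k14 w hl' hl).elim
    · exact (k24 w hl' hl).elim
    · exact (k3 w hl').elim
    · rfl
  · intro d w v hl hvD hwv hv
    have ho := off d w hl
    have hY := far v hvD hv w hwv
    rcases hl.d_mem with rfl | rfl | rfl | rfl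
    · exact h.key₁ ho hl.adj hv (fun he => hvD (by simp [he])) hwv
    · obtain ⟨s', Y', hY', hs', hsw⟩ := h.ear_two hd2
        (List.mem_cons_of_mem _ (List.mem_cons_of_mem _ hY)) hv ho hl.adj.symm hwv
      simp at hY'
      obtain ⟨rfl, -⟩ := hY'
      exact notN w ho hsw
    · exact notN w ho hl.adj
    · obtain ⟨s', Y', hY', hs', hsw'⟩ := h.ear_two hd4 hY hv ho hl.adj.symm hwv
      simp at hY'
      obtain ⟨rfl, -⟩ := hY'
      exact hsw w hl.adj hsw' (e4 ▸ hl.mem)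
  · have key : ∀ w w', Lost H {v₁, v₂, n, m} [p, p₂, p₁] ψ L v₁ w →
        Lost H {v₁, v₂, n, m} [p, p₂, p₁] ψ L m w' → H.Adj w w' → False := fun w w' hl hl' hww =>
      h.no_path (A := [n]) h.hd h24
        (fun v hv => by
          rw [List.mem_singleton.1 hv]
          exact ⟨hn2, h.adj₂, anm.symm, nn⟩)
        (off _ _ hl) (off _ _ hl') hl.adj hww hl'.adj.symm
    intro d d' w w' hl hl' hww hdd
    rcases id hl.d_mem with rfl | rfl | rfl | rfl <;>
      rcases id hl'.d_mem with rfl | rfl | rfl | rfl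
    · exact absurd rfl hdd
    · exact h.adj₁
    · exact (notN _ (off _ _ hl') hl'.adj).elim
    · exact (key w w' hl hl' hww).elim
    · exact h.adj₁.symm
    · exact absurd rfl hdd
    · exact h.adj₂
    · exact h24
    · exact (notN _ (off _ _ hl) hl.adj).elim
    · exact h.adj₂.symm
    · exact absurd rfl hdd
    · exact anm
    · exact (key w' w hl' hl hww.symm).elim
    · exact h24.symm
    · exact anm.symm
    · exact absurd rfl hdd
  · intro d w hl hor
    have ho := off d w hl
    rcases hl.d_mem with rfl | rfl | rfl | rfl
    · exact h.pair₁ ho hl.adj hor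
    · have := h.pair₂ ho hl.adj
      have hor : H.Adj w p₂ ∧ H.Adj w p₁ := by tauto
      obtain ⟨s', Y', hY', hs', hsw⟩ := h.ear_end hd2 (by simp) ho hl.adj.symm hor.1 hor.2
      simp at hY'
      obtain ⟨rfl, -⟩ := hY'
      exact notN w ho hsw
    · exact notN w ho hl.adj
    · rcases hor with ⟨b1, b2⟩ | b | ⟨b1, b2⟩
      · obtain ⟨s', X', hX, hs', hsw⟩ := h.ear_start (X := [v₁, v₂, n]) h.hd ho hl.adj.symm b2 b1
        have : n = s' := by
          have := congrArg List.reverse hX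
          simp at this
          exact this.1
        subst this
        exact notN w ho hsw
      · exact h.not_ends hl.notP b
      · obtain ⟨s', Y', hY', hs', hsw'⟩ := h.ear_end hd4 (by simp) ho hl.adj.symm b1 b2
        simp at hY'
        obtain ⟨rfl, -⟩ := hY'
        exact hsw w hl.adj hsw' (e4 ▸ hl.mem)

end Forced

theorem MC.false [Finite V] (h : MC S H P L) : False := by
  obtain ⟨p, p₂, p₁, vs, hc⟩ := h.exists_cfg
  obtain ⟨v₁, v₂, n, Y, c, a, hf⟩ := hc.forced
  obtain ⟨m, Z, rfl⟩ := hf.exists_next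
  exact hf.not_adj₂₄ hf.adj₂₄

theorem exists_outer (S : ParSys G) (hle : H ≤ G) {u v : V} (huv : H.Adj u v) :
    ∃ x y, H.Adj x y ∧ Outer S H x := by
  obtain ⟨e, he, hout⟩ := S.outer H.edgeSet (SimpleGraph.edgeSet_mono hle) ⟨s(u, v), huv⟩
  induction e with | _ x y
  refine ⟨x, y, he, fun l hl hx z hz => ?_⟩
  cases l with
  | nil => exact hl.elim
  | cons b t =>
    have hG : (b :: t ++ [b]).IsChain G.Adj := hl.2.2.imp fun _ _ h => hle h
    have h1 : ∀ d ∈ edgesL (b :: t ++ [b]), d ∈ H.edgeSet ∧ d ≠ s(x, y) := by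
      intro d hd
      refine ⟨isChain_iff_edgesL.1 hl.2.2 d hd, ?_⟩
      rintro rfl
      have := (mem_of_mem_edgesL hd).1
      simp at this hx
      tauto
    exact (S.prop b t x z y hG hx (hle hz) (hle he)).trans (hout b t hG h1)

/-- If all precolored vertices are isolated, then any outer vertex can be precolored instead. -/
theorem Good.move (h : Good S H P L) (hP : ∀ q ∈ P, ∀ y, ¬ H.Adj q y) {x : V}
    (hx : Outer S H x) : ∃ L' : V → Finset ℕ, Good S H [x] L' ∧ ∀ v, L' v ⊆ L v := by
  classical
  obtain ⟨a, ha⟩ := h.pos x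
  have hsub : ∀ v, Function.update L x {a} v ⊆ L v := by
    intro v
    by_cases hv : v = x
    · subst hv; simpa using ha
    · simp [hv]
  have hP' : ∀ v u, H.Adj v u → v ∉ P := fun v u huv hv => hP v hv u huv
  have h2 : ∀ v, (Function.update L x {a} v).card = 2 → (L v).card = 2 := by
    intro v hv
    by_cases hvx : v = x
    · subst hvx; simp at hv
    · simpa [hvx] using hv
  refine ⟨Function.update L x {a}, ⟨h.le, by simp, by simp, by simp, by simpa using hx, by simp,
    ?_, ?_, ?_, ?_, ?_, ?_, ?_⟩, hsub⟩
  · intro v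
    by_cases hv : v = x
    · subst hv; simp
    · simpa [hv] using h.pos v
  · exact fun u v huv => (Finset.card_le_card (Finset.inter_subset_inter (hsub u) (hsub v))).trans
      (h.sep u v huv)
  · intro v hv u huv
    rw [Function.update_of_ne (by simpa using hv)]
    exact h.two v (hP' v u huv) u huv
  · exact fun v _ u huv hc => h.twoOuter v (hP' v u huv) u huv (h2 v hc)
  · exact fun u v huv hu hv => h.nn u v huv (h2 u hu) (h2 v hv)
  · intro u hu v hv huv
    rw [List.mem_singleton.1 hu, List.mem_singleton.1 hv] at huv
    exact (huv.ne rfl).elim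
  · intro y _ u hu v hv huv
    exact (huv ((List.mem_singleton.1 hu).trans (List.mem_singleton.1 hv).symm)).elim

theorem Good.colorable [Finite V] (h4 : NoC4 G) (h : Good S H P L) : ColorableWith H L := by
  induction hN : 4 * H.edgeSet.ncard + (3 - P.length) using Nat.strong_induction_on
    generalizing H P L with
  | _ N ih =>
  have main : ∀ P' L', Good S H P' L' → P.length ≤ P'.length → (∃ p ∈ P', ∃ y, H.Adj p y) →
      ColorableWith H L' := by
    intro P' L' hg hle hex
    by_contra hnc
    refine MC.false (S := S) (H := H) (P := P') (L := L')
      ⟨hg, h4, hnc, fun H' P'' L'' hg' hlt => ih _ ?_ hg' rfl, hex⟩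
    have := hg'.len
    have := hg.len
    omega
  by_cases hex : ∃ p ∈ P, ∃ y, H.Adj p y
  · exact main P L h le_rfl hex
  push Not at hex
  by_cases hE : ∃ u v, H.Adj u v
  · obtain ⟨u, v, huv⟩ := hE
    obtain ⟨x, y, hxy, hx⟩ := exists_outer S h.le huv
    obtain ⟨L', hg, hsub⟩ := h.move hex hx
    have hl : P.length ≤ 1 := by
      have := h.chain
      rcases P with _ | ⟨q, _ | ⟨r, P⟩⟩
      · simp
      · simp
      · exact (hex q (by simp) r (List.isChain_cons_cons.1 this).1).elim
    obtain ⟨φ, f1, f2⟩ := main [x] L' hg (by simpa using hl) ⟨x, by simp, y, hxy⟩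
    exact ⟨φ, fun v => hsub v (f1 v), f2⟩
  · push Not at hE
    choose φ hφ using h.pos
    exact ⟨φ, hφ, fun u v huv => (hE u v huv).elim⟩

theorem noC4_of_not_hasCycleLen (h : ¬ HasCycleLen G 4) : NoC4 G := by
  intro a b c d hab hbc hcd hda hac hbd
  refine h ⟨a, .cons hab (.cons hbc (.cons hcd (.cons hda .nil))), ?_, rfl⟩
  rw [SimpleGraph.Walk.cons_isCycle_iff]
  simp [SimpleGraph.Walk.isPath_def, hab.ne, hab.ne.symm, hbc.ne, hcd.ne, hda.ne, hda.ne.symm, hac,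
    hac.symm, hbd]

end Extension

/-- **Theorem 6 of the paper.** Let `G` be a plane graph with no 4-cycle, with outer face
`F` carrying a subpath `P` of (the boundary of) `F` with at most three vertices, and let
`L` be a `(*,1)`-list assignment satisfying conditions (i)–(vi).  Then `G` is
`L`-colorable. -/
theorem C4free_precolored_extension {V : Type} [Fintype V]
    (G : SimpleGraph V) (E : PlaneEmb G)
    (hC4 : ¬ HasCycleLen G 4)
    (F : Set (ℝ × ℝ)) (hF : E.IsOuterFace F)
    (P : List V) (hPnd : P.Nodup) (hPlen : P.length ≤ 3)
    (hPF : ∀ v ∈ P, v ∈ E.onFace F)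
    (hPpath : P.Chain' (E.BoundaryEdge F))
    (L : V → Finset ℕ)
    (hL1 : ∀ v, 1 ≤ (L v).card)
    (hsep : ∀ ⦃u v⦄, G.Adj u v → ((L u) ∩ (L v)).card ≤ 1)
    (hi : ∀ v, v ∉ E.onFace F → 3 ≤ (L v).card)
    (hii : ∀ v ∈ E.onFace F, v ∉ P → 2 ≤ (L v).card)
    (hiii : ∀ v ∈ P, (L v).card = 1)
    (hiv : ∀ ⦃u v⦄, G.Adj u v → (L u).card = 2 → (L v).card ≠ 2)
    (hv : ∃ φ : V → ℕ, (∀ v ∈ P, φ v ∈ L v) ∧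
      ∀ ⦃u v⦄, u ∈ P → v ∈ P → G.Adj u v → φ u ≠ φ v)
    (hvi : ∀ x, (L x).card = 2 → ∀ u ∈ P, ∀ v ∈ P, u ≠ v →
      G.Adj x u → G.Adj x v → False) :
    ColorableWith G L := by
  obtain ⟨S, hS⟩ := exists_parSys E hF
  obtain ⟨φ, hφ, hφP⟩ := hv
  refine Good.colorable (S := S) (P := P) (noC4_of_not_hasCycleLen hC4)
    ⟨le_rfl, hPnd, hPlen, hPpath.imp fun _ _ h => h.1, fun v hv => hS v (hPF v hv), hiii,
      fun v => Finset.card_pos.1 (hL1 v), fun u v huv => hsep huv, fun v hvP _ _ => ?_,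
      fun v _ _ _ hv2 => hS v ?_, fun u v huv hu => hiv huv hu, fun u hu v hv huv he => ?_, hvi⟩
  · by_cases hvF : v ∈ E.onFace F
    · exact hii v hvF hvP
    · have := hi v hvF
      omega
  · by_contra hvF
    have := hi v hvF
    omega
  · exact hφP hu hv huv (Finset.card_le_one.1 (hiii v hv).le _ (he ▸ hφ u hu) _ (hφ v hv))

end ChoosSep
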